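/- There exists a fiber bundle over the 6-sphere S⁶ with fiber the 2-sphere S² whose total space is not homotopy equivalent to the product S² × S⁶. -/

import Mathlib

/-- The unit sphere `Sⁿ ⊂ ℝⁿ⁺¹` with the subspace topology. -/
abbrev unitSphere (n : ℕ) : Type :=
  Metric.sphere (0 : EuclideanSpace ℝ (Fin (n + 1))) 1

/-- `p : Z → B` is a fiber bundle with fiber `F`: it is continuous and locally trivial. -/
def IsFiberBundleWithFiber (F : Type*) [TopologicalSpace F] {Z B : Type*}
    [TopologicalSpace Z] [TopologicalSpace B] (p : Z → B) : Prop :=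
  Continuous p ∧ ∀ b : B, ∃ U : Set B, IsOpen U ∧ b ∈ U ∧
    ∃ φ : (p ⁻¹' U) ≃ₜ (U × F), ∀ z : p ⁻¹' U, ((φ z).1 : B) = p (z : Z)

section
open unitInterval Topology

/-- step points -/
noncomputable def stp (n j : ℕ) : I := Set.projIcc (0:ℝ) 1 zero_le_one ((j:ℝ)/n)

lemma stp_dist (n j : ℕ) (hn : 0 < n) (t : I) :
    |((min t (stp n j) : I) : ℝ) - ((min t (stp n (j+1)) : I) : ℝ)| ≤ 1/n := by
  have hn' : (0:ℝ) < n := by exact_mod_cast hn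
  have h1 : |((stp n j : I) : ℝ) - (stp n (j+1) : I)| ≤ 1/n := by
    have := Set.abs_projIcc_sub_projIcc (a := (0:ℝ)) (b := 1) (c := (j:ℝ)/n)
      (d := ((j+1:ℕ):ℝ)/n) zero_le_one
    refine this.trans ?_
    rw [← sub_div, abs_div, abs_of_pos hn']
    push_cast
    gcongr
    simp
  have h2 : ∀ a b : I, |((min t a : I) : ℝ) - ((min t b : I) : ℝ)| ≤ |(a:ℝ) - b| := by
    intro a b
    have := abs_min_sub_min_le_max (t:ℝ) a t b
    simpa using this
  exact (h2 _ _).trans h1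

theorem lift_T1 {X E G : Type*} [TopologicalSpace X] [CompactSpace X] [TopologicalSpace E]
    [TopologicalSpace G] [Monoid G] [ContinuousMul G] (R : G → E → E → Prop)
    (R1 : ∀ p, R 1 p p) (Rm : ∀ g h p q r, R g p q → R h q r → R (h * g) p r)
    (U : Set (E × E)) (hU : IsOpen U) (hd : ∀ p, (p, p) ∈ U) (g : E × E → G)
    (hg : ContinuousOn g U) (hgR : ∀ p q, (p, q) ∈ U → R (g (p, q)) p q)
    (hg1 : ∀ p, g (p, p) = 1) (H : X × I → E) (hH : Continuous H) :
    ∃ Γ : X × I → G, Continuous Γ ∧ (∀ x, Γ (x, 0) = 1) ∧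
      (∀ x t, R (Γ (x, t)) (H (x, 0)) (H (x, t))) ∧
      ∀ x, (∀ t, H (x, t) = H (x, 0)) → ∀ t, Γ (x, t) = 1 := by
  -- uniform subdivision
  obtain ⟨n, hn, hsub⟩ : ∃ n : ℕ, 0 < n ∧ ∀ (x : X) (t t' : I), |(t:ℝ) - t'| ≤ 1/n →
      (H (x, t), H (x, t')) ∈ U := by
    let K : X × I × I → E × E := fun a => (H (a.1, a.2.1), H (a.1, a.2.2))
    have hK : Continuous K := by fun_prop
    have hC : IsCompact (K ⁻¹' Uᶜ) := (hU.isClosed_compl.preimage hK).isCompact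
    rcases (K ⁻¹' Uᶜ).eq_empty_or_nonempty with h0 | h0
    · refine ⟨1, one_pos, fun x t t' _ => ?_⟩
      by_contra hcon
      have : (x, t, t') ∈ K ⁻¹' Uᶜ := hcon
      rw [h0] at this; exact this
    · have hcont : Continuous (fun a : X × I × I => |(a.2.1:ℝ) - a.2.2|) := by fun_prop
      obtain ⟨a, ha, hmin⟩ := hC.exists_isMinOn h0 hcont.continuousOn
      have hpos : 0 < |(a.2.1:ℝ) - a.2.2| := by
        rw [abs_pos, sub_ne_zero]
        intro h
        have h' : a.2.1 = a.2.2 := Subtype.ext h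
        apply ha
        show (H (a.1, a.2.1), H (a.1, a.2.2)) ∈ U
        rw [h']; exact hd _
      obtain ⟨m, hm⟩ := exists_nat_one_div_lt hpos
      refine ⟨m + 1, Nat.succ_pos _, fun x t t' h => ?_⟩
      by_contra hcon
      have h1 : (x, t, t') ∈ K ⁻¹' Uᶜ := hcon
      have h2 := hmin h1
      simp only [Set.mem_ofPred_eq] at h2
      push_cast at h
      linarith
  -- recursive definition
  let Γ : ℕ → X × I → G := fun j => Nat.rec (fun _ => 1)
    (fun j Γj a => g (H (a.1, min a.2 (stp n j)), H (a.1, min a.2 (stp n (j+1)))) * Γj a) j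
  have hΓs : ∀ j a, Γ (j+1) a =
    g (H (a.1, min a.2 (stp n j)), H (a.1, min a.2 (stp n (j+1)))) * Γ j a := fun j a => rfl
  have hΓ0 : ∀ a, Γ 0 a = 1 := fun a => rfl
  have hmem : ∀ j (a : X × I),
      (H (a.1, min a.2 (stp n j)), H (a.1, min a.2 (stp n (j+1)))) ∈ U := fun j a =>
    hsub _ _ _ (stp_dist n j hn a.2)
  have hs0 : stp n 0 = 0 := by
    apply Subtype.ext; simp [stp]
  have hsn : stp n n = 1 := by
    apply Subtype.ext
    have : ((n:ℝ)/n) = 1 := div_self (by exact_mod_cast hn.ne')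
    simp [stp, this]
  have hcont : ∀ j, Continuous (Γ j) := by
    intro j
    induction j with
    | zero => exact continuous_const
    | succ j ih =>
      show Continuous (fun a => Γ (j+1) a)
      simp only [hΓs]
      refine Continuous.mul ?_ ih
      exact hg.comp_continuous (by fun_prop) (hmem j)
  have hR : ∀ j (a : X × I), R (Γ j a) (H (a.1, 0)) (H (a.1, min a.2 (stp n j))) := by
    intro j a
    induction j with
    | zero =>
      rw [hs0, hΓ0]
      have : min a.2 (0:I) = 0 := min_eq_right a.2.2.1
      rw [this]; exact R1 _
    | succ j ih =>
      rw [hΓs]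
      exact Rm _ _ _ _ _ ih (hgR _ _ (hmem j a))
  refine ⟨Γ n, hcont n, ?_, ?_, ?_⟩
  · intro x
    have : ∀ j, Γ j (x, 0) = 1 := by
      intro j
      induction j with
      | zero => rfl
      | succ j ih =>
        rw [hΓs, ih]
        have h1 : ∀ s : I, min (0:I) s = 0 := fun s => min_eq_left s.2.1
        simp only [h1, hg1, mul_one]
    exact this n
  · intro x t
    have := hR n (x, t)
    rw [hsn] at this
    have h1 : min t (1:I) = t := min_eq_left t.2.2
    simpa [h1] using this
  · intro x hx t
    have : ∀ j, Γ j (x, t) = 1 := by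
      intro j
      induction j with
      | zero => rfl
      | succ j ih =>
        rw [hΓs, ih]
        simp only [hx, hg1, mul_one]
    exact this n
end

section
open unitInterval Topology

/-- Smooth approximation of a continuous map on a compact subset of `F`. -/
lemma smooth_approx {X F E : Type*} [TopologicalSpace X] [CompactSpace X]
    [NormedAddCommGroup F] [NormedSpace ℝ F] [NormedAddCommGroup E] [NormedSpace ℝ E]
    [FiniteDimensional ℝ E] (ι : X → F) (hι : Continuous ι) (hinj : Function.Injective ι)
    (c : X → E) (hc : Continuous c) (δ : ℝ) (hδ : 0 < δ) :
    ∃ P : F → E, ContDiff ℝ 1 P ∧ ∀ x, ‖P (ι x) - c x‖ < δ := by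
  let A : Subalgebra ℝ C(X, ℝ) :=
    { carrier := {f | ∃ P : F → ℝ, ContDiff ℝ 1 P ∧ ∀ x, f x = P (ι x)}
      mul_mem' := by
        rintro f g ⟨P, hP, hfP⟩ ⟨Q, hQ, hgQ⟩
        exact ⟨fun y => P y * Q y, hP.mul hQ, fun x => by simp [hfP, hgQ]⟩
      add_mem' := by
        rintro f g ⟨P, hP, hfP⟩ ⟨Q, hQ, hgQ⟩
        exact ⟨fun y => P y + Q y, hP.add hQ, fun x => by simp [hfP, hgQ]⟩
      algebraMap_mem' := fun r => ⟨fun _ => r, contDiff_const, fun x => by simp⟩ }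
  have hA : A.SeparatesPoints := by
    intro x y hxy
    have hne : ι x - ι y ≠ 0 := sub_ne_zero.mpr (hinj.ne hxy)
    obtain ⟨φ, hφ⟩ := SeparatingDual.exists_ne_zero (R := ℝ) hne
    refine ⟨fun z => φ (ι z), ⟨⟨fun z => φ (ι z), by fun_prop⟩, ⟨φ, φ.contDiff, fun _ => rfl⟩, rfl⟩, ?_⟩
    intro h
    apply hφ
    rw [map_sub, sub_eq_zero]; exact h
  let b := Module.finBasis ℝ E
  let S : ℝ := ∑ i, ‖b i‖ + 1
  have hS : 0 < S := by positivity
  have hco : ∀ i, Continuous fun x => b.equivFun (c x) i := by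
    intro i
    have : Continuous (b.coord i) := (b.coord i).continuous_of_finiteDimensional
    exact this.comp hc
  have happ : ∀ i, ∃ P : F → ℝ, ContDiff ℝ 1 P ∧ ∀ x, |P (ι x) - b.equivFun (c x) i| < δ / S := by
    intro i
    obtain ⟨g, hg⟩ := ContinuousMap.exists_mem_subalgebra_near_continuous_of_separatesPoints A hA
      (fun x => b.equivFun (c x) i) (hco i) (δ / S) (by positivity)
    obtain ⟨P, hP, hgP⟩ := g.2
    refine ⟨P, hP, fun x => ?_⟩
    have := hg x
    rw [Real.norm_eq_abs] at this
    rwa [← hgP]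
  choose P hP hPc using happ
  refine ⟨fun y => ∑ i, P i y • b i, ?_, fun x => ?_⟩
  · exact ContDiff.sum fun i _ => (hP i).smul contDiff_const
  · have h1 : c x = ∑ i, b.equivFun (c x) i • b i := (b.sum_equivFun (c x)).symm
    have h2 : (∑ i, P i (ι x) • b i) - c x = ∑ i, (P i (ι x) - b.equivFun (c x) i) • b i := by
      conv_lhs => rw [h1]
      rw [← Finset.sum_sub_distrib]
      simp only [sub_smul]
    rw [h2]
    calc _ ≤ ∑ i, ‖(P i (ι x) - b.equivFun (c x) i) • b i‖ := norm_sum_le _ _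
      _ ≤ ∑ i, δ / S * ‖b i‖ := by
        refine Finset.sum_le_sum fun i _ => ?_
        rw [norm_smul, Real.norm_eq_abs]
        have := (hPc i x).le
        gcongr
      _ = δ / S * (S - 1) := by rw [← Finset.mul_sum]; simp [S]
      _ < δ / S * S := by gcongr; linarith
      _ = δ := by field_simp

theorem T2rel {X F E : Type*} [TopologicalSpace X] [CompactSpace X]
    [NormedAddCommGroup F] [NormedSpace ℝ F] [FiniteDimensional ℝ F]
    [NormedAddCommGroup E] [NormedSpace ℝ E]
    [FiniteDimensional ℝ E] (hdim : Module.finrank ℝ F + 1 < Module.finrank ℝ E)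
    (ι : X → F) (hι : Continuous ι) (hinj : Function.Injective ι)
    (c : X → E) (hc : Continuous c) (hc0 : ∀ x, c x ≠ 0) (e : E) (he : e ≠ 0) :
    ∃ H : X × I → E, Continuous H ∧ (∀ a, H a ≠ 0) ∧ (∀ x, H (x, 0) = c x) ∧
      (∀ x, H (x, 1) = e) ∧ ∀ x, c x = e → ∀ t, H (x, t) = e := by
  have hepos : 0 < ‖e‖ := norm_pos_iff.mpr he
  obtain ⟨m, hm, hmc⟩ : ∃ m > 0, ∀ x, m ≤ ‖c x‖ := by
    rcases isEmpty_or_nonempty X with h | h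
    · exact ⟨1, one_pos, fun x => h.elim x⟩
    · obtain ⟨x0, -, h0⟩ := isCompact_univ.exists_isMinOn Set.univ_nonempty
        (hc.norm.continuousOn)
      exact ⟨‖c x0‖, norm_pos_iff.mpr (hc0 x0), fun x => h0 (Set.mem_univ x)⟩
  set δ := min (m/2) (‖e‖/4) with hδdef
  have hδ : 0 < δ := by positivity
  obtain ⟨P, hP, hPc⟩ := smooth_approx ι hι hinj c hc (δ/2) (by positivity)
  -- translate to miss the line
  have hdense : Dense (Set.range (fun a : F × ℝ => P a.1 + a.2 • e))ᶜ := by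
    apply ContDiff.dense_compl_range_of_finrank_lt_finrank
    · exact (hP.comp contDiff_fst).add (contDiff_snd.smul contDiff_const)
    · simpa using hdim
  obtain ⟨w, hw, hwδ⟩ := Metric.dense_iff.mp hdense 0 (δ/2) (by positivity)
  have hwn : ‖w‖ < δ/2 := by simpa using hw
  let d : X → E := fun x => P (ι x) - w
  have hdc : Continuous d := (hP.continuous.comp hι).sub continuous_const
  have hd1 : ∀ x, ‖d x - c x‖ < δ := by
    intro x
    have : d x - c x = (P (ι x) - c x) - w := by simp [d]; abel
    rw [this]
    calc _ ≤ ‖P (ι x) - c x‖ + ‖w‖ := norm_sub_le _ _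
      _ < δ/2 + δ/2 := add_lt_add (hPc x) hwn
      _ = δ := by ring
  have hd2 : ∀ x (l : ℝ), d x ≠ l • e := by
    intro x l h
    apply hwδ
    refine ⟨(ι x, -l), ?_⟩
    have : P (ι x) = l • e + w := by rw [← h]; simp [d]
    simp [this]
  let χ : X → ℝ := fun x => min 1 (‖c x - e‖ / (‖e‖/2))
  have hχc : Continuous χ := by fun_prop
  have hχ0 : ∀ x, 0 ≤ χ x := fun x => by positivity
  have hχ1 : ∀ x, χ x ≤ 1 := fun x => min_le_left _ _
  let f : X → ℝ → E := fun x a => c x + (a * χ x) • (d x - c x)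
  have hfc : ∀ x a, 0 ≤ a → a ≤ 1 → ‖f x a - c x‖ < δ := by
    intro x a h0 h1
    simp only [f, add_sub_cancel_left, norm_smul, Real.norm_eq_abs]
    have h2 : |a * χ x| ≤ 1 := by
      rw [abs_of_nonneg (mul_nonneg h0 (hχ0 x))]
      exact mul_le_one₀ h1 (hχ0 x) (hχ1 x)
    calc _ ≤ 1 * ‖d x - c x‖ := by gcongr
      _ < δ := by rw [one_mul]; exact hd1 x
  have hf0 : ∀ x a, 0 ≤ a → a ≤ 1 → f x a ≠ 0 := by
    intro x a h0 h1 h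
    have := hfc x a h0 h1
    rw [h, zero_sub, norm_neg] at this
    have h3 := hmc x
    have h4 : δ ≤ m/2 := min_le_left _ _
    linarith
  have hf1 : ∀ x (l : ℝ), 0 ≤ l → f x 1 ≠ -(l • e) := by
    intro x l hl h
    rcases lt_or_ge (‖c x - e‖) (‖e‖/2) with h1 | h1
    · have h2 := hfc x 1 zero_le_one le_rfl
      have h3 : ‖f x 1 - e‖ < ‖e‖ := by
        have : f x 1 - e = (f x 1 - c x) + (c x - e) := by abel
        rw [this]
        have h4 : δ ≤ ‖e‖/4 := min_le_right _ _
        calc _ ≤ ‖f x 1 - c x‖ + ‖c x - e‖ := norm_add_le _ _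
          _ < ‖e‖ := by linarith
      rw [h] at h3
      have h5 : -(l • e) - e = -((l+1) • e) := by rw [add_smul, one_smul]; abel
      rw [h5, norm_neg, norm_smul, Real.norm_eq_abs, abs_of_nonneg (by linarith)] at h3
      nlinarith
    · have h2 : χ x = 1 := by
        apply min_eq_left
        rw [le_div_iff₀ (by positivity)]; linarith
      apply hd2 x (-l)
      simpa [f, h2] using h
  let H : X × I → E := fun a =>
    (1 - max 0 (2 * (a.2:ℝ) - 1)) • f a.1 (min 1 (2 * (a.2:ℝ))) + (max 0 (2 * (a.2:ℝ) - 1)) • e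
  refine ⟨H, ?_, ?_, ?_, ?_, ?_⟩
  · simp only [H, f]; fun_prop
  · rintro ⟨x, t⟩ h
    have ht0 := t.2.1
    have ht1 := t.2.2
    rcases le_total ((2:ℝ) * t) 1 with h1 | h1
    · simp only [H] at h
      rw [max_eq_left (by linarith)] at h
      simp only [sub_zero, one_smul, zero_smul, add_zero] at h
      exact hf0 x _ (by positivity) (min_le_left _ _) h
    · simp only [H] at h
      rw [max_eq_right (by linarith), min_eq_left h1] at h
      set b := 2 * (t:ℝ) - 1 with hb
      rcases eq_or_ne b 1 with h2 | h2
      · rw [h2] at h; simp [he] at h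
      · have h3 : 0 < 1 - b := by
          have : b ≤ 1 := by linarith
          have := lt_of_le_of_ne this h2
          linarith
        apply hf1 x (b/(1-b)) (div_nonneg (by linarith) h3.le)
        have h4 : (1-b) • f x 1 = -(b • e) := eq_neg_of_add_eq_zero_left h
        have h5 : f x 1 = (1-b)⁻¹ • ((1-b) • f x 1) := by
          rw [smul_smul, inv_mul_cancel₀ h3.ne', one_smul]
        rw [h5, h4, smul_neg, smul_smul, div_eq_inv_mul]
  · intro x; simp [H, f]
  · intro x
    have h1 : (1 : ℝ) - (2 - 1) = 0 := by norm_num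
    have h2 : (2 : ℝ) - 1 = 1 := by norm_num
    simp [H, h2]
  · intro x hx t
    have h1 : χ x = 0 := by simp [χ, hx]
    simp only [H, f, h1, hx]
    simp only [mul_zero, zero_smul, add_zero]
    rw [← add_smul]; simp
end

section
open unitInterval Topology Quaternion

lemma S2q_units_continuous {X : Type*} [TopologicalSpace X] {f : X → ℍ[ℝ]ˣ}
    (h : Continuous fun x => (f x : ℍ[ℝ])) : Continuous f :=
  Units.isEmbedding_val₀.continuous_iff.mpr h

/-- unit imaginary quaternions -/
abbrev S2q : Type := {p : ℍ[ℝ] // p * p = -1}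

lemma S2q_ne (p : S2q) : (p : ℍ[ℝ]) ≠ 0 := by
  intro h; have := p.2; rw [h] at this; simp at this

noncomputable def rotg (a : S2q × S2q) : ℍ[ℝ]ˣ :=
  open Classical in
  if h : (1 - (a.2 : ℍ[ℝ]) * a.1 ≠ 0) then Units.mk0 ((1/2 : ℝ) • (1 - (a.2 : ℍ[ℝ]) * a.1))
    (smul_ne_zero (by norm_num) h) else 1

def rotU : Set (S2q × S2q) := {a | (1 - (a.2 : ℍ[ℝ]) * a.1) ≠ 0}

lemma rotg_val {a : S2q × S2q} (h : a ∈ rotU) :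
    (rotg a : ℍ[ℝ]) = (1/2 : ℝ) • (1 - (a.2 : ℍ[ℝ]) * a.1) := by
  have h' : (1 - (a.2 : ℍ[ℝ]) * a.1 ≠ 0) := h
  unfold rotg
  rw [dif_pos h']; rfl

lemma rotU_open : IsOpen rotU := by
  apply IsOpen.preimage (f := fun a : S2q × S2q => (1 - (a.2 : ℍ[ℝ]) * a.1)) (by fun_prop)
    (isOpen_compl_singleton (x := (0:ℍ[ℝ])))

lemma rotU_diag (p : S2q) : (p, p) ∈ rotU := by
  show (1 - (p : ℍ[ℝ]) * p) ≠ 0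
  rw [p.2]
  intro h
  have := congrArg QuaternionAlgebra.re h
  simp at this

lemma rotg_cont : ContinuousOn rotg rotU := by
  have : ContinuousOn (fun a => (rotg a : ℍ[ℝ])) rotU := by
    refine ContinuousOn.congr (f := fun a : S2q × S2q => (1/2 : ℝ) • (1 - (a.2 : ℍ[ℝ]) * a.1)) ?_
      (fun a ha => rotg_val ha)
    exact Continuous.continuousOn (by fun_prop)
  rw [continuousOn_iff_continuous_domRestrict] at this ⊢
  exact S2q_units_continuous this

lemma rotg_R (p q : S2q) (h : (p, q) ∈ rotU) : (rotg (p, q) : ℍ[ℝ]) * p = q * rotg (p, q) := by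
  rw [rotg_val h]
  simp only [smul_mul_assoc, mul_smul_comm]
  congr 1
  rw [sub_mul, mul_sub, mul_assoc, p.2, ← mul_assoc, q.2]
  simp [add_comm]

lemma rotg_diag (p : S2q) : rotg (p, p) = 1 := by
  apply Units.ext
  rw [rotg_val (rotU_diag p)]
  simp only [p.2]
  ext <;> simp <;> norm_num

def qi : ℍ[ℝ] := ⟨0, 1, 0, 0⟩
def qj : ℍ[ℝ] := ⟨0, 0, 1, 0⟩
def qk : ℍ[ℝ] := ⟨0, 0, 0, 1⟩

@[simp] lemma qi_re : qi.re = 0 := rfl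
@[simp] lemma qi_imI : qi.imI = 1 := rfl
@[simp] lemma qi_imJ : qi.imJ = 0 := rfl
@[simp] lemma qi_imK : qi.imK = 0 := rfl
@[simp] lemma qj_re : qj.re = 0 := rfl
@[simp] lemma qj_imI : qj.imI = 0 := rfl
@[simp] lemma qj_imJ : qj.imJ = 1 := rfl
@[simp] lemma qj_imK : qj.imK = 0 := rfl
@[simp] lemma qk_re : qk.re = 0 := rfl
@[simp] lemma qk_imI : qk.imI = 0 := rfl
@[simp] lemma qk_imJ : qk.imJ = 0 := rfl
@[simp] lemma qk_imK : qk.imK = 1 := rfl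
lemma qi_sq : qi * qi = -1 := by ext <;> simp
lemma qj_sq : qj * qj = -1 := by ext <;> simp

noncomputable def etaq (q : ℍ[ℝ]ˣ) : S2q :=
  ⟨q * qi * (q⁻¹ : ℍ[ℝ]ˣ), by
    have : (q : ℍ[ℝ]) * qi * (q⁻¹ : ℍ[ℝ]ˣ) * (q * qi * (q⁻¹ : ℍ[ℝ]ˣ))
      = q * (qi * qi) * (q⁻¹ : ℍ[ℝ]ˣ) := by
        simp [mul_assoc]
    rw [this, qi_sq]; simp⟩

lemma etaq_cont : Continuous etaq := by
  unfold etaq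
  refine Continuous.subtype_mk ?_ _
  exact (Units.continuous_val.mul continuous_const).mul
    (Units.continuous_val.comp continuous_inv)

theorem T4 {X : Type*} [TopologicalSpace X] [CompactSpace X] (f : C(X, ℍ[ℝ]ˣ))
    (h : (ContinuousMap.mk etaq etaq_cont |>.comp f).Nullhomotopic) : f.Nullhomotopic := by
  obtain ⟨J, ⟨F⟩⟩ := h
  obtain ⟨Γ, hΓ, hΓ0, hΓR, -⟩ := lift_T1 (fun (g : ℍ[ℝ]ˣ) (p q : S2q) => (g : ℍ[ℝ]) * p = q * g)
    (fun p => by simp) (by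
      intro g h p q r h1 h2
      simp only [Units.val_mul]
      rw [mul_assoc, h1, ← mul_assoc, h2, mul_assoc]) rotU rotU_open rotU_diag rotg rotg_cont
      rotg_R rotg_diag (fun a : X × I => F (a.2, a.1)) (by fun_prop)
  let f1 : C(X, ℍ[ℝ]ˣ) := ⟨fun x => Γ (x, 1) * f x, by fun_prop⟩
  have h01 : f.Homotopic f1 := by
    refine ⟨⟨⟨fun a => Γ (a.2, a.1) * f a.2, by fun_prop⟩, ?_, ?_⟩⟩
    · intro x; simp [hΓ0]
    · intro x; rfl
  have hf1 : ∀ x, (f1 x : ℍ[ℝ]) * qi = J * f1 x := by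
    intro x
    have := hΓR x 1
    simp only [ContinuousMap.Homotopy.apply_zero, ContinuousMap.Homotopy.apply_one] at this
    simp only [ContinuousMap.comp_apply, ContinuousMap.const_apply, ContinuousMap.coe_mk] at this
    have h2 : (Γ (x,1) : ℍ[ℝ]) * (f x * qi * ((f x)⁻¹ : ℍ[ℝ]ˣ)) = J * Γ (x, 1) := this
    show ((Γ (x,1) * f x : ℍ[ℝ]ˣ) : ℍ[ℝ]) * qi = J * (Γ (x,1) * f x : ℍ[ℝ]ˣ)
    rw [Units.val_mul, ← mul_assoc (J : ℍ[ℝ]), ← h2]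
    simp [mul_assoc]
  obtain ⟨q', hq'0, hq'⟩ : ∃ q' : ℍ[ℝ], q' ≠ 0 ∧ q' * qi ≠ J * q' := by
    by_contra hcon
    push Not at hcon
    have h1 := hcon 1 one_ne_zero
    have h2 := hcon qj (by intro h; have := congrArg QuaternionAlgebra.imJ h; simp at this)
    rw [one_mul, mul_one] at h1
    rw [← h1] at h2
    have := congrArg QuaternionAlgebra.imK h2
    simp at this
    norm_num at this
  have hne : ∀ (x : X) (t : I), (1 - (t:ℝ)) • (f1 x : ℍ[ℝ]) - (t:ℝ) • q' ≠ 0 := by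
    intro x t h
    have ht : (t:ℝ) ≠ 0 := by
      intro h0
      rw [h0] at h
      simp at h
    apply hq'
    have h3 : (t:ℝ) • q' = (1 - (t:ℝ)) • (f1 x : ℍ[ℝ]) := (sub_eq_zero.mp h).symm
    have h4 : (t:ℝ) • (q' * qi) = (t:ℝ) • ((J : ℍ[ℝ]) * q') := by
      rw [← smul_mul_assoc, ← mul_smul_comm, h3, smul_mul_assoc, mul_smul_comm, hf1]
    exact smul_right_injective _ ht h4
  refine ⟨Units.mk0 (-q') (neg_ne_zero.mpr hq'0), h01.trans ?_⟩
  refine ⟨⟨⟨fun a => Units.mk0 _ (hne a.2 a.1), S2q_units_continuous (by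
    simp only [Units.val_mk0]
    have : Continuous fun x => (f1 x : ℍ[ℝ]) := Units.continuous_val.comp f1.continuous
    fun_prop)⟩, ?_, ?_⟩⟩
  · intro x; apply Units.ext; simp
  · intro x; apply Units.ext; simp
end

section
open Topology Quaternion
lemma mat_units_emb {ι K : Type*} [Fintype ι] [DecidableEq ι] [NormedRing K] [CompleteSpace K] :
    IsOpenEmbedding (Units.val : (Matrix ι ι K)ˣ → Matrix ι ι K) := by
  letI N : NormedRing (Matrix ι ι K) := Matrix.linftyOpNormedRing
  have hc : @CompleteSpace (Matrix ι ι K) (N.toMetricSpace.toPseudoMetricSpace.toUniformSpace) :=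
    inferInstanceAs (CompleteSpace (ι → ι → K))
  exact @Units.isOpenEmbedding_val (Matrix ι ι K) N (@instHasSummableGeomSeriesOfCompleteSpace _ N hc)
lemma mat_units_cont {ι K : Type*} [Fintype ι] [DecidableEq ι] [NormedRing K] [CompleteSpace K]
    {X : Type*} [TopologicalSpace X] {f : X → (Matrix ι ι K)ˣ}
    (h : Continuous fun x => (f x : Matrix ι ι K)) : Continuous f := by
  exact mat_units_emb.continuous_iff.mpr h
end

section
open unitInterval Topology Quaternion

theorem idem_lift {n K X B : Type*} [Fintype n] [DecidableEq n] [NormedRing K] [CompleteSpace K]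
    [TopologicalSpace X] [CompactSpace X] [TopologicalSpace B]
    (e : B → Matrix n n K) (he : Continuous e) (hid : ∀ b, e b * e b = e b)
    (H : X × I → B) (hH : Continuous H) :
    ∃ Γ : X × I → (Matrix n n K)ˣ, Continuous Γ ∧ (∀ x, Γ (x, 0) = 1) ∧
      (∀ x t, (Γ (x, t) : Matrix n n K) * e (H (x, 0)) = e (H (x, t)) * Γ (x, t)) ∧
      ∀ x, (∀ t, H (x, t) = H (x, 0)) → ∀ t, Γ (x, t) = 1 := by
  classical
  let M : B × B → Matrix n n K := fun a => e a.2 * e a.1 + (1 - e a.2) * (1 - e a.1)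
  have hM : Continuous M := by
    have h1 : Continuous fun a : B × B => e a.1 := he.comp continuous_fst
    have h2 : Continuous fun a : B × B => e a.2 := he.comp continuous_snd
    exact (h2.mul h1).add ((continuous_const.sub h2).mul (continuous_const.sub h1))
  let g : B × B → (Matrix n n K)ˣ := fun a => if h : IsUnit (M a) then h.unit else 1
  have hgv : ∀ a, IsUnit (M a) → (g a : Matrix n n K) = M a := by
    intro a h
    simp only [g, dif_pos h, IsUnit.unit_spec]
  have hMd : ∀ p, M (p, p) = 1 := by
    intro p
    simp only [M, sub_mul, mul_sub, hid]
    simp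
  refine lift_T1 (fun (g : (Matrix n n K)ˣ) (p q : B) => (g : Matrix n n K) * e p = e q * g)
    (fun p => by simp) ?_ {a | IsUnit (M a)} ?_ ?_ g ?_ ?_ ?_ H hH
  · intro g h p q r h1 h2
    simp only [Units.val_mul]
    rw [mul_assoc, h1, ← mul_assoc, h2, mul_assoc]
  · have : {a | IsUnit (M a)} = M ⁻¹' (Set.range (Units.val : (Matrix n n K)ˣ → Matrix n n K)) := by
      ext a; simp [IsUnit]
    rw [this]
    exact mat_units_emb.isOpen_range.preimage hM
  · intro p
    show IsUnit (M (p, p))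
    rw [hMd]; exact isUnit_one
  · have : ContinuousOn (fun a => (g a : Matrix n n K)) {a | IsUnit (M a)} :=
      hM.continuousOn.congr (fun a ha => hgv a ha)
    rw [continuousOn_iff_continuous_domRestrict] at this ⊢
    exact mat_units_cont this
  · intro p q h
    rw [hgv _ h]
    simp only [M, sub_mul, mul_sub, add_mul, mul_add, mul_assoc, hid, one_mul, mul_one]
    simp only [← mul_assoc, hid]
    abel
  · intro p
    apply Units.ext
    have : IsUnit (M (p, p)) := by rw [hMd]; exact isUnit_one
    rw [hgv _ this, hMd]; rfl

/-- the sphere `S⁶` has no homotopy in low dimensions, relative version -/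
theorem S6_null {X F : Type*} [TopologicalSpace X] [CompactSpace X]
    [NormedAddCommGroup F] [NormedSpace ℝ F] [FiniteDimensional ℝ F]
    (hdim : Module.finrank ℝ F ≤ 5)
    (ι : X → F) (hι : Continuous ι) (hinj : Function.Injective ι)
    (c : C(X, unitSphere 6)) (e : unitSphere 6) :
    ∃ H : C(X × I, unitSphere 6), (∀ x, H (x, 0) = c x) ∧
      (∀ x, H (x, 1) = e) ∧ ∀ x, c x = e → ∀ t, H (x, t) = e := by
  have hn : ∀ b : unitSphere 6, ‖(b : EuclideanSpace ℝ (Fin 7))‖ = 1 := fun b => by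
    simpa using b.2
  have h0 : ∀ b : unitSphere 6, (b : EuclideanSpace ℝ (Fin 7)) ≠ 0 := fun b h => by
    have := hn b
    rw [h] at this; simp at this
  obtain ⟨H, hH, H0, Hc, He, Hr⟩ := T2rel (F := F) (E := EuclideanSpace ℝ (Fin 7))
    (by simp; omega) ι hι hinj (fun x => (c x : EuclideanSpace ℝ (Fin 7)))
    (by fun_prop) (fun x => h0 _) e (h0 e)
  refine ⟨⟨fun a => ⟨‖H a‖⁻¹ • H a, by simp [norm_smul, H0 a]⟩, ?_⟩, ?_, ?_, ?_⟩
  · refine Continuous.subtype_mk ?_ _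
    exact (hH.norm.inv₀ (fun a => by simpa using H0 a)).smul hH
  · intro x; apply Subtype.ext; simp [Hc, hn]
  · intro x; apply Subtype.ext; simp [He, hn]
  · intro x hx t
    apply Subtype.ext
    simp [Hr x (by rw [hx]) t, hn]
end

section
open unitInterval Topology Quaternion Matrix

abbrev M2 := Matrix (Fin 2) (Fin 2) ℍ[ℝ]

/-- total space of complex structures on the line `e b` -/
abbrev ZZ {B : Type*} (e : B → M2) : Type _ :=
  {z : B × M2 // z.2 * z.2 = - e z.1 ∧ e z.1 * z.2 = z.2}

lemma ZZ_right {B : Type*} {e : B → M2} (z : ZZ e) : z.1.2 * e z.1.1 = z.1.2 := by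
  have h1 := z.2.1
  have h2 := z.2.2
  have h3 : e z.1.1 = - (z.1.2 * z.1.2) := by rw [h1, neg_neg]
  rw [h3] at h2 ⊢
  rw [mul_neg, ← mul_assoc]
  rw [neg_mul] at h2
  exact h2

def c1 (p : ℍ[ℝ]) : Matrix (Fin 1) (Fin 1) ℍ[ℝ] := Matrix.of fun _ _ => p

lemma c1_apply (p : ℍ[ℝ]) : c1 p 0 0 = p := rfl
lemma c1_eta (m : Matrix (Fin 1) (Fin 1) ℍ[ℝ]) : c1 (m 0 0) = m := by
  ext1 i j
  rw [Subsingleton.elim i 0, Subsingleton.elim j 0]; rfl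
lemma c1_mul (p q : ℍ[ℝ]) : c1 p * c1 q = c1 (p * q) := by
  ext1 i j
  simp [c1, Matrix.mul_apply]
lemma c1_neg (p : ℍ[ℝ]) : c1 (-p) = - c1 p := by
  ext1 i j
  simp [c1]
lemma c1_one : c1 1 = 1 := by
  ext1 i j
  rw [Subsingleton.elim i 0, Subsingleton.elim j 0]; simp [c1]
lemma c1_cont : Continuous c1 := by
  unfold c1
  exact continuous_matrix (fun _ _ => continuous_id)

/-- the element of ZZ defined by a unit vector and a unit imaginary quaternion -/
lemma vec_mem {v : Matrix (Fin 2) (Fin 1) ℍ[ℝ]} {e : M2} (h1 : v * vᴴ = e) (h2 : vᴴ * v = 1)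
    {p : ℍ[ℝ]} (hp : p * p = -1) :
    (v * c1 p * vᴴ) * (v * c1 p * vᴴ) = - e ∧ e * (v * c1 p * vᴴ) = v * c1 p * vᴴ := by
  constructor
  · calc (v * c1 p * vᴴ) * (v * c1 p * vᴴ) = v * c1 p * (vᴴ * v) * c1 p * vᴴ := by
          simp only [Matrix.mul_assoc]
      _ = v * (c1 p * c1 p) * vᴴ := by rw [h2]; simp only [Matrix.mul_assoc, Matrix.one_mul]
      _ = - e := by
        rw [c1_mul, hp, c1_neg, c1_one, ← h1]; simp
  · calc e * (v * c1 p * vᴴ) = v * (vᴴ * v) * c1 p * vᴴ := by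
          rw [← h1]; simp only [Matrix.mul_assoc]
      _ = _ := by rw [h2, Matrix.mul_one]

lemma vec_mem' {v : Matrix (Fin 2) (Fin 1) ℍ[ℝ]} {e A : M2} (h1 : v * vᴴ = e) (h2 : vᴴ * v = 1)
    (hA : A * A = - e) (hA' : e * A = A) :
    (vᴴ * A * v) 0 0 * (vᴴ * A * v) 0 0 = -1 := by
  have h : (vᴴ * A * v) * (vᴴ * A * v) = -1 := by
    calc (vᴴ * A * v) * (vᴴ * A * v) = vᴴ * A * (v * vᴴ * A) * v := by
          simp only [Matrix.mul_assoc]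
      _ = vᴴ * (A * A) * v := by rw [h1, hA']; simp only [Matrix.mul_assoc]
      _ = - ((vᴴ * v) * (vᴴ * v)) := by
        rw [hA, ← h1]; simp only [Matrix.mul_assoc, Matrix.neg_mul, Matrix.mul_neg]
      _ = -1 := by rw [h2]; simp
  have := congrFun (congrFun h 0) 0
  simpa [Matrix.mul_apply (M := vᴴ * A * v)] using this

theorem ZZ_triv {B : Type*} [TopologicalSpace B] (e : B → M2) (U : Set B)
    (v : B → Matrix (Fin 2) (Fin 1) ℍ[ℝ]) (hv : ContinuousOn v U)
    (h1 : ∀ b ∈ U, v b * (v b)ᴴ = e b) (h2 : ∀ b ∈ U, (v b)ᴴ * v b = 1) :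
    ∃ φ : ((fun z : ZZ e => z.1.1) ⁻¹' U) ≃ₜ (U × S2q),
      ∀ z, ((φ z).1 : B) = (z : ZZ e).1.1 := by
  have hv' : Continuous fun b : U => v b := by
    rw [continuousOn_iff_continuous_domRestrict] at hv
    exact hv
  refine ⟨⟨⟨fun z => (⟨z.1.1.1, z.2⟩, ⟨((v z.1.1.1)ᴴ * z.1.1.2 * v z.1.1.1) 0 0,
      vec_mem' (h1 _ z.2) (h2 _ z.2) z.1.2.1 z.1.2.2⟩),
      fun a => ⟨⟨(a.1.1, v a.1.1 * c1 a.2 * (v a.1.1)ᴴ), vec_mem (h1 _ a.1.2) (h2 _ a.1.2) a.2.2⟩,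
        a.1.2⟩, ?_, ?_⟩, ?_, ?_⟩, fun z => rfl⟩
  · rintro ⟨z, hz⟩
    apply Subtype.ext; apply Subtype.ext
    refine Prod.ext rfl ?_
    simp only [c1_eta]
    have e1 := h1 _ hz
    calc v z.1.1 * ((v z.1.1)ᴴ * z.1.2 * v z.1.1) * (v z.1.1)ᴴ
        = (v z.1.1 * (v z.1.1)ᴴ) * z.1.2 * (v z.1.1 * (v z.1.1)ᴴ) := by
          simp only [Matrix.mul_assoc]
      _ = z.1.2 := by rw [e1, z.2.2, ZZ_right]
  · rintro ⟨b, p⟩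
    refine Prod.ext rfl ?_
    apply Subtype.ext
    have e2 := h2 _ b.2
    show ((v b)ᴴ * (v b * c1 p * (v b)ᴴ) * v b) 0 0 = p
    calc ((v b)ᴴ * (v b * c1 p * (v b)ᴴ) * v b) 0 0
        = (((v b)ᴴ * v b) * c1 p * ((v b)ᴴ * v b)) 0 0 := by
          simp only [Matrix.mul_assoc]
      _ = p := by rw [e2]; simp [c1_apply]
  · have hz : Continuous fun z : ((fun z : ZZ e => z.1.1) ⁻¹' U) => (⟨z.1.1.1, z.2⟩ : U) := by
      fun_prop
    refine hz.prodMk (Continuous.subtype_mk ?_ _)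
    have hvz := hv'.comp hz
    have hA : Continuous fun z : ((fun z : ZZ e => z.1.1) ⁻¹' U) => z.1.1.2 := by fun_prop
    exact (((hvz.matrix_conjTranspose).matrix_mul hA).matrix_mul hvz).matrix_elem 0 0
  · refine Continuous.subtype_mk (Continuous.subtype_mk ?_ _) _
    have hvz : Continuous fun a : U × S2q => v a.1.1 := hv'.comp continuous_fst
    have hc : Continuous fun a : U × S2q => c1 a.2 := c1_cont.comp (by fun_prop)
    exact Continuous.prodMk (by fun_prop)
      ((hvz.matrix_mul hc).matrix_mul hvz.matrix_conjTranspose)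

/-- homotopy lifting -/
theorem ZZ_lift {X B : Type*} [TopologicalSpace X] [CompactSpace X] [TopologicalSpace B]
    (e : B → M2) (he : Continuous e) (hid : ∀ b, e b * e b = e b) (a : C(X, ZZ e))
    (H : C(X × I, B)) (h0 : ∀ x, H (x, 0) = (a x).1.1) :
    ∃ K : C(X × I, ZZ e), (∀ x, K (x, 0) = a x) ∧ (∀ y, (K y).1.1 = H y) ∧
      ∀ x, (∀ t, H (x, t) = H (x, 0)) → ∀ t, K (x, t) = a x := by
  obtain ⟨Γ, hΓ, hΓ0, hΓR, hΓ1⟩ := idem_lift e he hid H H.continuous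
  refine ⟨⟨fun y => ⟨(H y, (Γ y : M2) * (a y.1).1.2 * ((Γ y)⁻¹ : M2ˣ)), ?_, ?_⟩, ?_⟩, ?_, ?_, ?_⟩
  · have h1 := (a y.1).2.1
    have h3 := hΓR y.1 y.2
    rw [h0] at h3
    calc (Γ y : M2) * (a y.1).1.2 * ((Γ y)⁻¹ : M2ˣ) * ((Γ y : M2) * (a y.1).1.2 * ((Γ y)⁻¹ : M2ˣ))
        = (Γ y : M2) * ((a y.1).1.2 * (a y.1).1.2) * ((Γ y)⁻¹ : M2ˣ) := by
          simp [mul_assoc]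
      _ = - e (H y) := by
          rw [h1, mul_neg, neg_mul, h3]; simp [mul_assoc]
  · have h3 := hΓR y.1 y.2
    rw [h0] at h3
    show e (H (y.1, y.2)) * ((Γ (y.1, y.2) : M2) * (a y.1).1.2 * ((Γ y)⁻¹ : M2ˣ)) = _
    rw [← mul_assoc, ← mul_assoc, ← h3, mul_assoc (Γ _ : M2) (e _), (a y.1).2.2]
  · refine Continuous.subtype_mk (H.continuous.prodMk ?_) _
    have : Continuous fun y : X × I => (a y.1).1.2 := by fun_prop
    exact ((Units.continuous_val.comp hΓ).mul this).mul
      (Units.continuous_val.comp (continuous_inv.comp hΓ))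
  · intro x
    apply Subtype.ext
    refine Prod.ext (h0 x) ?_
    simp [hΓ0]
  · intro y; rfl
  · intro x hx t
    apply Subtype.ext
    refine Prod.ext ((hx t).trans (h0 x)) ?_
    simp [hΓ1 x hx]
end

section
open unitInterval Topology Quaternion Matrix

noncomputable def eb (s : ℝ) (F : ℍ[ℝ]) : M2 :=
  !![((1 + s)/2 : ℝ) • (1 : ℍ[ℝ]), (1/2 : ℝ) • star F; (1/2 : ℝ) • F, ((1 - s)/2 : ℝ) • (1 : ℍ[ℝ])]

lemma eb_cont {B : Type*} [TopologicalSpace B] {s : B → ℝ} {F : B → ℍ[ℝ]} (hs : Continuous s)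
    (hF : Continuous F) : Continuous fun b => eb (s b) (F b) := by
  have hc : Continuous fun r : ℝ => (r : ℍ[ℝ]) := Quaternion.continuous_coe
  unfold eb
  refine continuous_matrix fun i j => ?_
  fin_cases i <;> fin_cases j <;> simp <;> fun_prop

/-- unit vector spanning, `s = c²-d²`, `F = 2cd u` -/
noncomputable def vb (a : ℝ) (q : ℍ[ℝ]) : Matrix (Fin 2) (Fin 1) ℍ[ℝ] := !![(a : ℍ[ℝ]); q]
noncomputable def vb' (q : ℍ[ℝ]) (a : ℝ) : Matrix (Fin 2) (Fin 1) ℍ[ℝ] := !![q; (a : ℍ[ℝ])]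

lemma vb_outer (a : ℝ) (q : ℍ[ℝ]) (s : ℝ) (F : ℍ[ℝ]) (h1 : a * a = (1 + s)/2)
    (h2 : a • q = (1/2 : ℝ) • F) (h3 : normSq q = (1 - s)/2) :
    vb a q * (vb a q)ᴴ = eb s F := by
  have h2' : a • star q = (1/2 : ℝ) • star F := by
    rw [← Quaternion.star_smul, h2, Quaternion.star_smul]
  ext1 i j
  fin_cases i <;> fin_cases j
  · simp [vb, eb, Matrix.mul_apply, Matrix.conjTranspose_apply]
    rw [← Quaternion.coe_mul, h1, ← Quaternion.coe_mul_eq_smul, mul_one]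
  · simp [vb, eb, Matrix.mul_apply, Matrix.conjTranspose_apply]
    rw [Quaternion.coe_mul_eq_smul, h2']; norm_num
  · simp [vb, eb, Matrix.mul_apply, Matrix.conjTranspose_apply]
    rw [Quaternion.mul_coe_eq_smul, h2]; norm_num
  · simp [vb, eb, Matrix.mul_apply, Matrix.conjTranspose_apply]
    rw [Quaternion.self_mul_star, h3, ← Quaternion.coe_mul_eq_smul, mul_one]

lemma vb'_outer (a : ℝ) (q : ℍ[ℝ]) (s : ℝ) (F : ℍ[ℝ]) (h1 : a * a = (1 - s)/2)
    (h2 : a • star q = (1/2 : ℝ) • F) (h3 : normSq q = (1 + s)/2) :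
    vb' q a * (vb' q a)ᴴ = eb s F := by
  have h2' : a • q = (1/2 : ℝ) • star F := by
    rw [← Quaternion.star_smul, ← h2, Quaternion.star_smul, star_star]
  ext1 i j
  fin_cases i <;> fin_cases j
  · simp [vb', eb, Matrix.mul_apply, Matrix.conjTranspose_apply]
    rw [Quaternion.self_mul_star, h3, ← Quaternion.coe_mul_eq_smul, mul_one]
  · simp [vb', eb, Matrix.mul_apply, Matrix.conjTranspose_apply]
    rw [Quaternion.mul_coe_eq_smul, h2']; norm_num
  · simp [vb', eb, Matrix.mul_apply, Matrix.conjTranspose_apply]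
    rw [Quaternion.coe_mul_eq_smul, h2]; norm_num
  · simp [vb', eb, Matrix.mul_apply, Matrix.conjTranspose_apply]
    rw [← Quaternion.coe_mul, h1, ← Quaternion.coe_mul_eq_smul, mul_one]

lemma vb_inner (a : ℝ) (q : ℍ[ℝ]) (h : a * a + normSq q = 1) : (vb a q)ᴴ * vb a q = 1 := by
  ext1 i j
  rw [Subsingleton.elim i 0, Subsingleton.elim j 0]
  simp [vb, Matrix.mul_apply, Matrix.conjTranspose_apply, Fin.sum_univ_two]
  rw [Quaternion.star_mul_self, ← Quaternion.coe_mul, ← Quaternion.coe_add, h, Quaternion.coe_one]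
lemma vb'_inner (a : ℝ) (q : ℍ[ℝ]) (h : a * a + normSq q = 1) : (vb' q a)ᴴ * vb' q a = 1 := by
  ext1 i j
  rw [Subsingleton.elim i 0, Subsingleton.elim j 0]
  simp [vb', Matrix.mul_apply, Matrix.conjTranspose_apply, Fin.sum_univ_two]
  rw [Quaternion.star_mul_self, add_comm, ← Quaternion.coe_mul, ← Quaternion.coe_add, h,
    Quaternion.coe_one]

lemma vb_cont {B : Type*} [TopologicalSpace B] {s : B → ℝ} {F : B → ℍ[ℝ]} (hs : Continuous s)
    (hF : Continuous F) : Continuous fun b => vb (s b) (F b) := by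
  have hc : Continuous fun r : ℝ => (r : ℍ[ℝ]) := Quaternion.continuous_coe
  unfold vb
  refine continuous_matrix fun i j => ?_
  rw [Subsingleton.elim j 0]
  fin_cases i <;> simp
  · exact hc.comp hs
  · exact hF
lemma vb'_cont {B : Type*} [TopologicalSpace B] {s : B → ℝ} {F : B → ℍ[ℝ]} (hs : Continuous s)
    (hF : Continuous F) : Continuous fun b => vb' (F b) (s b) := by
  have hc : Continuous fun r : ℝ => (r : ℍ[ℝ]) := Quaternion.continuous_coe
  unfold vb'
  refine continuous_matrix fun i j => ?_
  rw [Subsingleton.elim j 0]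
  fin_cases i <;> simp
  · exact hF
  · exact hc.comp hs

lemma eb_idem (s : ℝ) (F : ℍ[ℝ]) (h : s * s + normSq F = 1) : eb s F * eb s F = eb s F := by
  have h1 : F * star F = (1 - s * s) • (1 : ℍ[ℝ]) := by
    rw [Quaternion.self_mul_star, eq_sub_of_add_eq' h, ← Quaternion.coe_mul_eq_smul, mul_one]
  have h2 : star F * F = (1 - s * s) • (1 : ℍ[ℝ]) := by
    rw [Quaternion.star_mul_self, eq_sub_of_add_eq' h, ← Quaternion.coe_mul_eq_smul, mul_one]
  ext1 i j
  fin_cases i <;> fin_cases j <;>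
    simp [eb, Matrix.mul_apply, h1, h2, smul_smul, ← add_smul] <;> congr 1 <;> ring

theorem eb_triv {B : Type*} [TopologicalSpace B] {s : B → ℝ} {F : B → ℍ[ℝ]} (hs : Continuous s)
    (hF : Continuous F) (h : ∀ b, s b * s b + normSq (F b) = 1) (b : B) :
    ∃ U : Set B, IsOpen U ∧ b ∈ U ∧
    ∃ φ : ((fun z : ZZ (fun b => eb (s b) (F b)) => z.1.1) ⁻¹' U) ≃ₜ (U × S2q),
      ∀ z, ((φ z).1 : B) = z.1.1.1 := by
  rcases lt_or_ge (-1) (s b) with hb | hb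
  · refine ⟨{b | -1 < s b}, isOpen_lt continuous_const hs, hb, ?_⟩
    have hN : ∀ b ∈ {b | -1 < s b}, 0 < 2 * (1 + s b) := by intro b hb; simp at hb; linarith
    have key : ∀ b ∈ {b | -1 < s b}, normSq ((((Real.sqrt (2 * (1 + s b)))⁻¹ : ℝ)) • F b)
        = (1 - s b)/2 := by
      intro b hb
      have := hN b hb
      rw [Quaternion.normSq_smul, inv_pow, Real.sq_sqrt this.le, eq_sub_of_add_eq' (h b)]
      have : 1 + s b ≠ 0 := by linarith
      field_simp; ring
    have key1 : ∀ b ∈ {b | -1 < s b}, (Real.sqrt (2 * (1 + s b)) / 2) * (Real.sqrt (2 * (1 + s b)) / 2)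
        = (1 + s b)/2 := by
      intro b hb
      have := hN b hb
      rw [div_mul_div_comm, Real.mul_self_sqrt this.le]; ring
    refine ZZ_triv _ _ (fun b => vb (Real.sqrt (2 * (1 + s b)) / 2)
      ((((Real.sqrt (2 * (1 + s b)))⁻¹ : ℝ)) • F b)) ?_ ?_ ?_
    · rw [continuousOn_iff_continuous_domRestrict]
      refine vb_cont (B := {b | -1 < s b}) (s := fun b => (Real.sqrt (2 * (1 + s b)) / 2))
        (F := fun b => (((Real.sqrt (2 * (1 + s b)))⁻¹ : ℝ)) • F b) (by fun_prop) ?_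
      apply Continuous.fun_smul
      swap
      · fun_prop
      apply Continuous.fun_inv₀
      · fun_prop
      intro b
      exact (Real.sqrt_pos.mpr (hN b b.2)).ne'
    · intro b hb
      refine vb_outer _ _ _ _ (key1 b hb) ?_ (key b hb)
      have := Real.sqrt_pos.mpr (hN b hb)
      rw [smul_smul]
      congr 1; field_simp
    · intro b hb
      exact vb_inner _ _ (by rw [key b hb, key1 b hb]; ring)
  · have hb' : s b < 1 := by linarith
    refine ⟨{b | s b < 1}, isOpen_lt hs continuous_const, hb', ?_⟩
    have hN : ∀ b ∈ {b | s b < 1}, 0 < 2 * (1 - s b) := by intro b hb; simp at hb; linarith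
    have key : ∀ b ∈ {b | s b < 1}, normSq ((((Real.sqrt (2 * (1 - s b)))⁻¹ : ℝ)) • star (F b))
        = (1 + s b)/2 := by
      intro b hb
      have := hN b hb
      rw [Quaternion.normSq_smul, inv_pow, Real.sq_sqrt this.le, Quaternion.normSq_star,
        eq_sub_of_add_eq' (h b)]
      have : 1 - s b ≠ 0 := by intro h; linarith
      field_simp; ring
    have key1 : ∀ b ∈ {b | s b < 1}, (Real.sqrt (2 * (1 - s b)) / 2) * (Real.sqrt (2 * (1 - s b)) / 2)
        = (1 - s b)/2 := by
      intro b hb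
      have := hN b hb
      rw [div_mul_div_comm, Real.mul_self_sqrt this.le]; ring
    refine ZZ_triv _ _ (fun b => vb' ((((Real.sqrt (2 * (1 - s b)))⁻¹ : ℝ)) • star (F b))
      (Real.sqrt (2 * (1 - s b)) / 2)) ?_ ?_ ?_
    · rw [continuousOn_iff_continuous_domRestrict]
      refine vb'_cont (B := {b | s b < 1}) (s := fun b => (Real.sqrt (2 * (1 - s b)) / 2))
        (F := fun b => (((Real.sqrt (2 * (1 - s b)))⁻¹ : ℝ)) • star (F b)) (by fun_prop) ?_
      apply Continuous.fun_smul
      swap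
      · fun_prop
      apply Continuous.fun_inv₀
      · fun_prop
      intro b
      exact (Real.sqrt_pos.mpr (hN b b.2)).ne'
    · intro b hb
      refine vb'_outer _ _ _ _ (key1 b hb) ?_ (key b hb)
      have := Real.sqrt_pos.mpr (hN b hb)
      rw [Quaternion.star_smul, star_star, smul_smul]
      congr 1; field_simp
    · intro b hb
      exact vb'_inner _ _ (by rw [key b hb, key1 b hb]; ring)

lemma S2q_iff (p : ℍ[ℝ]) : p * p = -1 ↔ p.re = 0 ∧ p.imI^2 + p.imJ^2 + p.imK^2 = 1 := by
  constructor
  · intro h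
    have h0 := congrArg QuaternionAlgebra.re h
    have h1 := congrArg QuaternionAlgebra.imI h
    have h2 := congrArg QuaternionAlgebra.imJ h
    have h3 := congrArg QuaternionAlgebra.imK h
    simp at h0 h1 h2 h3
    have hre : p.re = 0 := by
      by_contra hne
      have e1 : p.imI = 0 := by
        apply mul_left_cancel₀ hne; linarith
      have e2 : p.imJ = 0 := by
        apply mul_left_cancel₀ hne; linarith
      have e3 : p.imK = 0 := by
        apply mul_left_cancel₀ hne; linarith
      rw [e1, e2, e3] at h0
      nlinarith
    rw [hre] at h0
    exact ⟨hre, by nlinarith⟩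
  · rintro ⟨h0, h1⟩
    ext <;> simp [h0] <;> nlinarith

noncomputable def S2q_homeo : S2q ≃ₜ unitSphere 2 where
  toFun p := ⟨!₂[p.1.imI, p.1.imJ, p.1.imK], by
    have := ((S2q_iff p.1).1 p.2).2
    simp [EuclideanSpace.norm_eq, Fin.sum_univ_three, this]⟩
  invFun x := ⟨x.1 0 • qi + x.1 1 • qj + x.1 2 • qk, by
    have h : ‖x.1‖ = 1 := by simp
    rw [EuclideanSpace.norm_eq] at h
    simp [Fin.sum_univ_three] at h
    rw [S2q_iff]
    simpa using h⟩
  left_inv p := by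
    have := ((S2q_iff p.1).1 p.2).1
    apply Subtype.ext
    ext <;> simp [this]
  right_inv x := by
    apply Subtype.ext
    ext i; fin_cases i <;> simp
  continuous_toFun := by
    refine Continuous.subtype_mk ?_ _
    refine (PiLp.continuous_toLp 2 _).comp ?_
    refine continuous_pi fun i => ?_
    fin_cases i
    · exact Quaternion.continuous_imI.comp continuous_subtype_val
    · exact Quaternion.continuous_imJ.comp continuous_subtype_val
    · exact Quaternion.continuous_imK.comp continuous_subtype_val
  continuous_invFun := by
    refine Continuous.subtype_mk ?_ _
    fun_prop
end

section
open unitInterval Topology Quaternion Matrix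

section radial
variable (f : C(unitSphere 5, ℍ[ℝ]ˣ))

noncomputable def sph5 (y : EuclideanSpace ℝ (Fin 6)) (h : y ≠ 0) : unitSphere 5 :=
  ⟨‖y‖⁻¹ • y, by simp [norm_smul, h]⟩

noncomputable def fhat (x : unitSphere 5) : ℍ[ℝ] := ‖(f x : ℍ[ℝ])‖⁻¹ • (f x : ℍ[ℝ])

lemma fhat_cont : Continuous (fhat f) := by
  have h : Continuous fun x => (f x : ℍ[ℝ]) := Units.continuous_val.comp f.continuous
  exact (h.norm.inv₀ (fun x => by simp)).smul h

lemma fhat_norm (x) : ‖fhat f x‖ = 1 := by simp [fhat, norm_smul]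

open Classical in
noncomputable def Fx (y : EuclideanSpace ℝ (Fin 6)) : ℍ[ℝ] :=
  if h : y ≠ 0 then ‖y‖ • fhat f (sph5 y h) else 0

lemma Fx_norm (y) : ‖Fx f y‖ = ‖y‖ := by
  unfold Fx
  split_ifs with h
  · simp [norm_smul, fhat_norm]
  · push Not at h; simp [h]

lemma Fx_smul (r : ℝ) (hr : 0 ≤ r) (x : unitSphere 5) : Fx f (r • (x : EuclideanSpace ℝ (Fin 6)))
    = r • fhat f x := by
  have hx : ‖(x : EuclideanSpace ℝ (Fin 6))‖ = 1 := by simp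
  rcases hr.eq_or_lt with h | h
  · subst h; simp [Fx]
  · have h0 : r • (x : EuclideanSpace ℝ (Fin 6)) ≠ 0 := by
      intro h1
      have := congrArg norm h1
      rw [norm_smul, hx] at this
      simp at this; exact h.ne' this
    unfold Fx
    rw [dif_pos h0]
    have : sph5 _ h0 = x := by
      apply Subtype.ext
      simp [sph5, norm_smul, abs_of_pos h, smul_smul, h.ne']
    rw [this, norm_smul, hx]; simp [abs_of_pos h]

lemma Fx_cont : Continuous (Fx f) := by
  rw [continuous_iff_continuousAt]
  intro y
  by_cases h : y = 0
  · subst h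
    unfold ContinuousAt
    have h0 : Fx f 0 = 0 := by simp [Fx]
    rw [h0, tendsto_zero_iff_norm_tendsto_zero]
    simp only [Fx_norm]
    exact tendsto_norm_zero
  · have : ContinuousOn (Fx f) {0}ᶜ := by
      rw [continuousOn_iff_continuous_domRestrict]
      have : Set.domRestrict {0}ᶜ (Fx f) = fun y : ({0}ᶜ : Set (EuclideanSpace ℝ (Fin 6))) =>
          ‖(y : EuclideanSpace ℝ (Fin 6))‖ • fhat f (sph5 y y.2) := by
        ext1 y
        have hy : (y : EuclideanSpace ℝ (Fin 6)) ≠ 0 := y.2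
        simp [Set.domRestrict, Fx, hy]
      rw [this]
      refine Continuous.fun_smul (by fun_prop) ((fhat_cont f).comp ?_)
      refine Continuous.subtype_mk ?_ _
      refine Continuous.fun_smul (Continuous.fun_inv₀ (by fun_prop) ?_) (by fun_prop)
      intro y
      have hy : (y : EuclideanSpace ℝ (Fin 6)) ≠ 0 := y.2
      simpa using hy
    exact this.continuousAt (isOpen_compl_singleton.mem_nhds h)

noncomputable def yb (b : unitSphere 6) : EuclideanSpace ℝ (Fin 6) :=
  WithLp.toLp 2 fun i => b.1 i.castSucc

noncomputable def sb (b : unitSphere 6) : ℝ := b.1 (Fin.last 6)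

lemma yb_cont : Continuous yb := by
  refine (PiLp.continuous_toLp 2 _).comp ?_
  fun_prop
lemma sb_cont : Continuous sb := by unfold sb; fun_prop

lemma yb_sb (b : unitSphere 6) : sb b * sb b + ‖yb b‖^2 = 1 := by
  have h : ‖b.1‖^2 = 1 := by simp
  rw [EuclideanSpace.norm_sq_eq, Fin.sum_univ_castSucc] at h
  rw [EuclideanSpace.norm_sq_eq]
  simp at h
  simp [yb, sb]
  linarith

noncomputable def pt6 (t : ℝ) (x : unitSphere 5) : unitSphere 6 :=
  ⟨WithLp.toLp 2 (Fin.snoc (α := fun _ => ℝ) (fun i => Real.sin t * x.1 i) (Real.cos t)), by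
    have h : ‖x.1‖^2 = 1 := by simp
    rw [EuclideanSpace.norm_sq_eq] at h
    have h2 : ‖(WithLp.toLp 2 (Fin.snoc (α := fun _ => ℝ) (fun i => Real.sin t * x.1 i) (Real.cos t)) :
      EuclideanSpace ℝ (Fin 7))‖^2 = 1 := by
      rw [EuclideanSpace.norm_sq_eq, Fin.sum_univ_castSucc]
      simp [mul_pow, ← Finset.mul_sum, -Fin.reduceLast] at h ⊢
      rw [h]; simp
    have h3 := norm_nonneg (WithLp.toLp 2 (Fin.snoc (α := fun _ => ℝ) (fun i => Real.sin t * x.1 i) (Real.cos t)) :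
      EuclideanSpace ℝ (Fin 7))
    rw [mem_sphere_zero_iff_norm]
    nlinarith⟩

lemma pt6_y (t x) : yb (pt6 t x) = Real.sin t • x.1 := by
  ext i; simp [yb, pt6]
lemma pt6_s (t x) : sb (pt6 t x) = Real.cos t := by
  simp [sb, pt6, -Fin.reduceLast]
lemma pt6_cont : Continuous fun a : ℝ × unitSphere 5 => pt6 a.1 a.2 := by
  refine Continuous.subtype_mk ((PiLp.continuous_toLp 2 _).comp ?_) _
  refine continuous_pi fun i => ?_
  refine Fin.lastCases ?_ (fun i => ?_) i
  · simp; fun_prop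
  · simp; fun_prop

/-- south pole -/
noncomputable def sp6 : unitSphere 6 := ⟨EuclideanSpace.single (Fin.last 6) (-1), by simp⟩
lemma sp6_y : yb sp6 = 0 := by
  ext i; simp [yb, sp6, Fin.castSucc_ne_last, -Fin.reduceLast]
lemma sp6_s : sb sp6 = -1 := by simp [sb, sp6]
lemma pt6_pi (x) : pt6 Real.pi x = sp6 := by
  apply Subtype.ext
  ext i
  refine Fin.lastCases ?_ (fun i => ?_) i
  · simp [pt6, sp6, -Fin.reduceLast]
  · simp [pt6, sp6, Fin.castSucc_ne_last, -Fin.reduceLast]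

noncomputable def ee (b : unitSphere 6) : M2 := eb (sb b) (Fx f (yb b))
lemma ee_cont : Continuous (ee f) := eb_cont sb_cont ((Fx_cont f).comp yb_cont)
lemma ee_norm (b) : sb b * sb b + normSq (Fx f (yb b)) = 1 := by
  rw [Quaternion.normSq_eq_norm_mul_self, Fx_norm, ← sq ‖_‖]; exact yb_sb b
lemma ee_idem (b) : ee f b * ee f b = ee f b := eb_idem _ _ (ee_norm f b)
lemma ee_sp : ee f sp6 = vb 0 1 * (vb 0 1)ᴴ := by
  have : Fx f 0 = 0 := by simp [Fx]
  rw [vb_outer 0 1 (-1) 0 (by norm_num) (by simp) (by norm_num)]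
  unfold ee
  rw [sp6_y, sp6_s, this]
lemma v0_inner : (vb 0 1)ᴴ * vb 0 1 = 1 := vb_inner _ _ (by simp)

theorem ZZ_bundle : IsFiberBundleWithFiber (unitSphere 2) (fun z : ZZ (ee f) => z.1.1) := by
  refine ⟨by fun_prop, fun b => ?_⟩
  obtain ⟨U, hU, hb, φ, hφ⟩ := eb_triv sb_cont ((Fx_cont f).comp yb_cont) (ee_norm f) b
  exact ⟨U, hU, hb, φ.trans ((Homeomorph.refl U).prodCongr S2q_homeo), fun z => hφ z⟩

noncomputable def inclq : C(S2q, ZZ (ee f)) :=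
  ⟨fun p => ⟨(sp6, vb 0 1 * c1 p * (vb 0 1)ᴴ), vec_mem (ee_sp f).symm v0_inner p.2⟩, by
    refine Continuous.subtype_mk (continuous_const.prodMk ?_) _
    have : Continuous fun p : S2q => c1 p := c1_cont.comp (by fun_prop)
    exact (continuous_const.matrix_mul this).matrix_mul continuous_const⟩

/-- map into the fibre -/
theorem fib_proj {X : Type*} [TopologicalSpace X] (h : C(X, ZZ (ee f)))
    (hh : ∀ x, (h x).1.1 = sp6) : ∃ g : C(X, S2q), ∀ x, inclq f (g x) = h x := by
  refine ⟨⟨fun x => ⟨((vb 0 1)ᴴ * (h x).1.2 * vb 0 1) 0 0, ?_⟩, ?_⟩, ?_⟩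
  · have h1 := (h x).2
    rw [hh x] at h1
    exact vec_mem' (ee_sp f).symm v0_inner h1.1 h1.2
  · refine Continuous.subtype_mk ?_ _
    have : Continuous fun x => (h x).1.2 := by fun_prop
    exact ((continuous_const.matrix_mul this).matrix_mul continuous_const).matrix_elem 0 0
  · intro x
    apply Subtype.ext
    refine Prod.ext (hh x).symm ?_
    simp only [inclq, ContinuousMap.coe_mk, c1_eta]
    have h1 := (h x).2.2
    have h2 := ZZ_right (h x)
    rw [hh x, ee_sp] at h1 h2
    calc vb 0 1 * ((vb 0 1)ᴴ * (h x).1.2 * vb 0 1) * (vb 0 1)ᴴ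
        = (vb 0 1 * (vb 0 1)ᴴ * (h x).1.2) * (vb 0 1 * (vb 0 1)ᴴ) := by
          simp only [Matrix.mul_assoc]
      _ = (h x).1.2 := by rw [h1, h2]

lemma inclq_inj : Function.Injective (inclq f) := by
  intro p q h
  have h2 := congrArg (fun z : ZZ (ee f) => ((vb 0 1)ᴴ * z.1.2 * vb 0 1) 0 0) h
  have key : ∀ p : S2q, ((vb 0 1)ᴴ * (vb 0 1 * c1 p * (vb 0 1)ᴴ) * vb 0 1) 0 0 = p := by
    intro p
    calc ((vb 0 1)ᴴ * (vb 0 1 * c1 p * (vb 0 1)ᴴ) * vb 0 1) 0 0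
        = (((vb 0 1)ᴴ * vb 0 1) * c1 p * ((vb 0 1)ᴴ * vb 0 1)) 0 0 := by
          simp only [Matrix.mul_assoc]
      _ = p := by rw [v0_inner]; simp [c1_apply]
  apply Subtype.ext
  simpa [inclq, key] using h2

/-- the attaching map is killed in the total space -/
theorem incl_eta_null :
    ((inclq f).comp ((ContinuousMap.mk etaq etaq_cont).comp f)).Nullhomotopic := by
  have hv : ∀ (t : I) (x : unitSphere 5), vb (Real.cos (t * (Real.pi/2))) (Real.sin (t * (Real.pi/2)) • fhat f x) *
      (vb (Real.cos (t * (Real.pi/2))) (Real.sin (t * (Real.pi/2)) • fhat f x))ᴴ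
      = ee f (pt6 (t * Real.pi) x) := by
    intro t x
    have e2 : (t * Real.pi : ℝ) = 2 * (t * (Real.pi/2)) := by ring
    have hs : 0 ≤ Real.sin (t * Real.pi) := by
      apply Real.sin_nonneg_of_nonneg_of_le_pi
      · have := t.2.1; positivity
      · have := t.2.2; nlinarith [Real.pi_pos]
    unfold ee
    rw [pt6_y, pt6_s, Fx_smul _ _ hs]
    apply vb_outer
    · rw [e2, Real.cos_two_mul]; ring
    · rw [e2, Real.sin_two_mul, smul_smul, smul_smul]; congr 1; ring
    · rw [Quaternion.normSq_smul, Quaternion.normSq_eq_norm_mul_self, fhat_norm, e2, Real.cos_two_mul,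
        Real.sin_sq]; ring
  have hi : ∀ (t : I) (x : unitSphere 5), (vb (Real.cos (t * (Real.pi/2))) (Real.sin (t * (Real.pi/2)) • fhat f x))ᴴ
      * vb (Real.cos (t * (Real.pi/2))) (Real.sin (t * (Real.pi/2)) • fhat f x) = 1 := by
    intro t x
    apply vb_inner
    rw [Quaternion.normSq_smul, Quaternion.normSq_eq_norm_mul_self, fhat_norm, Real.sin_sq]; ring
  let K : C(I × unitSphere 5, ZZ (ee f)) := ⟨fun a => ⟨(pt6 (a.1 * Real.pi) a.2, _),
    vec_mem (hv a.1 a.2) (hi a.1 a.2) qi_sq⟩, by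
      refine Continuous.subtype_mk (Continuous.prodMk ?_ ?_) _
      · exact pt6_cont.comp (f := fun a : I × unitSphere 5 => ((a.1 * Real.pi : ℝ), a.2)) (by fun_prop)
      · have h1 : Continuous fun a : I × unitSphere 5 =>
            vb (Real.cos (a.1 * (Real.pi/2))) (Real.sin (a.1 * (Real.pi/2)) • fhat f a.2) := by
          apply vb_cont
          · fun_prop
          · exact Continuous.fun_smul (by fun_prop) ((fhat_cont f).comp continuous_snd)
        exact (h1.matrix_mul continuous_const).matrix_mul h1.matrix_conjTranspose⟩
  have hK0 : ∀ x, K (0, x) = ⟨(pt6 0 x, vb 1 0 * c1 qi * (vb 1 0)ᴴ), by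
      have h1 := hv 0 x
      have h2 := hi 0 x
      simp at h1 h2
      exact vec_mem h1 h2 qi_sq⟩ := by
    intro x
    apply Subtype.ext
    simp [K]
  have hK1 : ∀ x, K (1, x) = inclq f (etaq (f x)) := by
    intro x
    apply Subtype.ext
    refine Prod.ext ?_ ?_
    · simp [K, inclq, pt6_pi]
    · have e : etaq (f x) = fhat f x * qi * star (fhat f x) := by
        have hne : ‖(f x : ℍ[ℝ])‖ ≠ 0 := by simp
        simp only [etaq, fhat, Units.val_inv_eq_inv_val, Quaternion.inv_def,
          Quaternion.star_smul, smul_mul_assoc, mul_smul_comm, smul_smul,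
          Quaternion.normSq_eq_norm_mul_self]
        congr 1; field_simp
      simp only [K, inclq, ContinuousMap.coe_mk, e]
      ext1 i j
      fin_cases i <;> fin_cases j <;> simp [vb, c1, Matrix.mul_apply, Matrix.conjTranspose_apply]
  have x0 : unitSphere 5 := ⟨EuclideanSpace.single 0 1, by simp⟩
  refine ⟨K (0, x0), ContinuousMap.Homotopic.symm ⟨⟨K, ?_, ?_⟩⟩⟩
  · intro x
    simp only [ContinuousMap.const_apply]
    show K (0, x) = _
    rw [hK0, hK0]
    apply Subtype.ext
    refine Prod.ext ?_ rfl
    apply Subtype.ext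
    simp [pt6]
  · intro x
    exact hK1 x

end radial
end

section
open unitInterval Topology Quaternion Matrix

instance S2q_compact : CompactSpace S2q := S2q_homeo.symm.compactSpace

theorem bundle_of_essential (f : C(unitSphere 5, ℍ[ℝ]ˣ)) (hf : ¬ f.Nullhomotopic) :
    ∃ (Z : Type) (_ : TopologicalSpace Z) (p : Z → unitSphere 6),
      IsFiberBundleWithFiber (unitSphere 2) p ∧
        ¬ Nonempty (ContinuousMap.HomotopyEquiv Z (unitSphere 2 × unitSphere 6)) := by
  refine ⟨ZZ (ee f), inferInstance, fun z => z.1.1, ZZ_bundle f, ?_⟩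
  rintro ⟨Φ⟩
  apply hf
  apply T4
  set η : C(unitSphere 5, S2q) := (ContinuousMap.mk etaq etaq_cont).comp f with hη
  let fst' : C(unitSphere 2 × unitSphere 6, unitSphere 2) := ContinuousMap.fst
  let k : C(S2q, unitSphere 2) := fst'.comp (Φ.toFun.comp (inclq f))
  let m : C(unitSphere 2, ZZ (ee f)) :=
    Φ.invFun.comp ((ContinuousMap.id _).prodMk (ContinuousMap.const _ sp6))
  -- push m into the fibre
  obtain ⟨H, H0, H1, -⟩ := S6_null (F := EuclideanSpace ℝ (Fin 3)) (by simp)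
    (fun x : unitSphere 2 => x.1) (by fun_prop) Subtype.val_injective
    ⟨fun x => (m x).1.1, by fun_prop⟩ sp6
  obtain ⟨K, K0, K1, -⟩ := ZZ_lift (ee f) (ee_cont f) (ee_idem f) m H H0
  obtain ⟨g, hg⟩ := fib_proj f (K.comp ((ContinuousMap.id _).prodMk (ContinuousMap.const _ 1)))
    (fun x => by simp [K1, H1])
  have hm : m.Homotopic ((inclq f).comp g) := by
    refine ⟨⟨K.comp (ContinuousMap.prodSwap), ?_, ?_⟩⟩
    · intro x
      exact K0 x
    · intro x
      exact (hg x).symm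
  -- i ~ i g k
  have hi : (inclq f).Homotopic ((inclq f).comp (g.comp k)) := by
    have s1 : ((ContinuousMap.id _).comp (inclq f)).Homotopic
        ((Φ.invFun.comp Φ.toFun).comp (inclq f)) :=
      ContinuousMap.Homotopic.comp Φ.left_inv.symm (ContinuousMap.Homotopic.refl _)
    obtain ⟨N, N0, N1, -⟩ := S6_null (F := ℍ[ℝ]) (by rw [Quaternion.finrank_eq_four]; norm_num)
      (fun x : S2q => x.1) (by fun_prop) Subtype.val_injective
      ⟨fun x => (Φ.toFun (inclq f x)).2, by fun_prop⟩ sp6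
    have s2 : ((Φ.invFun.comp Φ.toFun).comp (inclq f)).Homotopic (m.comp k) := by
      refine ⟨⟨Φ.invFun.comp ((k.comp ContinuousMap.snd).prodMk (N.comp ContinuousMap.prodSwap)),
        ?_, ?_⟩⟩
      · intro x
        simp [k, N0, fst', ContinuousMap.prodSwap]
      · intro x
        simp [k, N1, fst', ContinuousMap.prodSwap, m]
    have s3 : (m.comp k).Homotopic (((inclq f).comp g).comp k) :=
      ContinuousMap.Homotopic.comp hm (ContinuousMap.Homotopic.refl _)
    exact (s1.trans s2).trans s3
  -- g k ~ id
  have hgk : (ContinuousMap.id S2q).Homotopic (g.comp k) := by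
    obtain ⟨h⟩ := hi
    let h' : C(S2q × I, ZZ (ee f)) := h.toContinuousMap.comp ContinuousMap.prodSwap
    obtain ⟨N, N0, N1, N2⟩ := S6_null (F := ℍ[ℝ] × ℝ)
      (by rw [Module.finrank_prod, Quaternion.finrank_eq_four]; simp)
      (fun x : S2q × I => ((x.1 : ℍ[ℝ]), (x.2 : ℝ))) (by fun_prop)
      (by
        rintro ⟨a, b⟩ ⟨c, d⟩ hh
        simp only [Prod.mk.injEq] at hh
        exact Prod.ext (Subtype.ext hh.1) (Subtype.ext hh.2))
      ⟨fun x => (h' x).1.1, by fun_prop⟩ sp6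
    obtain ⟨L, L0, L1, L2⟩ := ZZ_lift (ee f) (ee_cont f) (ee_idem f) h' N N0
    obtain ⟨r, hr⟩ := fib_proj f (L.comp ((ContinuousMap.id _).prodMk (ContinuousMap.const _ 1)))
      (fun x => by simp [L1, N1])
    have key : ∀ a : S2q × I, (h' a).1.1 = sp6 → inclq f (r a) = h' a := by
      intro a ha
      rw [hr]
      have h1 := N2 a ha
      exact L2 a (fun t => by rw [h1, h1]) 1
    refine ⟨⟨r.comp ContinuousMap.prodSwap, ?_, ?_⟩⟩
    · intro x
      have e : h' (x, 0) = inclq f x := h.apply_zero x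
      have := key (x, 0) (by rw [e]; rfl)
      rw [e] at this
      exact inclq_inj f this
    · intro x
      have e : h' (x, 1) = inclq f (g (k x)) := h.apply_one x
      have := key (x, 1) (by rw [e]; rfl)
      rw [e] at this
      exact inclq_inj f this
  have hnull : ((g.comp (fst'.comp Φ.toFun)).comp ((inclq f).comp η)).Nullhomotopic :=
    (incl_eta_null f).comp_right _
  obtain ⟨y, hy⟩ := hnull
  refine ⟨y, ContinuousMap.Homotopic.trans ?_ hy⟩
  exact ContinuousMap.Homotopic.comp hgk (ContinuousMap.Homotopic.refl η)
end

section
open unitInterval Topology Quaternion Matrix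

section colred
variable {K : Type*}

/-- block upper triangular matrix with unit corner -/
def blk [Ring K] {n : ℕ} (r : Fin n → K) (g : Matrix (Fin n) (Fin n) K) :
    Matrix (Fin (n+1)) (Fin (n+1)) K :=
  Matrix.of fun i j => Fin.cases (Fin.cases 1 (fun j' => r j') j)
    (fun i' => Fin.cases 0 (fun j' => g i' j') j) i

@[simp] lemma blk_00 [Ring K] {n : ℕ} (r : Fin n → K) (g : Matrix (Fin n) (Fin n) K) :
    blk r g 0 0 = 1 := rfl
@[simp] lemma blk_0s [Ring K] {n : ℕ} (r : Fin n → K) (g : Matrix (Fin n) (Fin n) K) (j) :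
    blk r g 0 (Fin.succ j) = r j := rfl
@[simp] lemma blk_s0 [Ring K] {n : ℕ} (r : Fin n → K) (g : Matrix (Fin n) (Fin n) K) (i) :
    blk r g (Fin.succ i) 0 = 0 := rfl
@[simp] lemma blk_ss [Ring K] {n : ℕ} (r : Fin n → K) (g : Matrix (Fin n) (Fin n) K) (i j) :
    blk r g (Fin.succ i) (Fin.succ j) = g i j := rfl

lemma blk_mul [Ring K] {n : ℕ} (r r' : Fin n → K) (g g' : Matrix (Fin n) (Fin n) K) :
    blk r g * blk r' g' = blk (r' + r ᵥ* g') (g * g') := by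
  ext1 i j
  refine Fin.cases ?_ (fun i => ?_) i <;> refine Fin.cases ?_ (fun j => ?_) j <;>
    simp [Matrix.mul_apply, Fin.sum_univ_succ, Matrix.vecMul, dotProduct]

lemma blk_one [Ring K] {n : ℕ} : blk (0 : Fin n → K) 1 = 1 := by
  ext1 i j
  refine Fin.cases ?_ (fun i => ?_) i <;> refine Fin.cases ?_ (fun j => ?_) j <;>
    simp [Matrix.one_apply, Fin.succ_ne_zero, (Fin.succ_ne_zero _).symm]

lemma blk_inj [Ring K] {n : ℕ} {r r' : Fin n → K} {g g' : Matrix (Fin n) (Fin n) K}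
    (h : blk r g = blk r' g') : r = r' ∧ g = g' := by
  constructor
  · ext j; simpa using congrFun (congrFun h 0) j.succ
  · ext i j; simpa using congrFun (congrFun h i.succ) j.succ

lemma blk_of_col [Ring K] {n : ℕ} (M : Matrix (Fin (n+1)) (Fin (n+1)) K)
    (h : M *ᵥ Pi.single 0 1 = Pi.single 0 1) :
    M = blk (fun j => M 0 j.succ) (M.submatrix Fin.succ Fin.succ) := by
  have h' : ∀ i, M i 0 = (Pi.single 0 1 : Fin (n+1) → K) i := by
    intro i
    have := congrFun h i
    simpa using this
  ext1 i j
  refine Fin.cases ?_ (fun i => ?_) i <;> refine Fin.cases ?_ (fun j => ?_) j <;>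
    simp [h']

lemma blk_col [Ring K] {n : ℕ} (r : Fin n → K) (g : Matrix (Fin n) (Fin n) K) :
    blk r g *ᵥ Pi.single 0 1 = Pi.single 0 1 := by
  ext i
  refine Fin.cases ?_ (fun i => ?_) i <;> simp

lemma blk_cont [Ring K] [TopologicalSpace K] {n : ℕ} {X : Type*} [TopologicalSpace X]
    {r : X → Fin n → K} {g : X → Matrix (Fin n) (Fin n) K} (hr : Continuous r) (hg : Continuous g) :
    Continuous fun x => blk (r x) (g x) := by
  refine continuous_matrix fun i j => ?_
  refine Fin.cases ?_ (fun i => ?_) i <;> refine Fin.cases ?_ (fun j => ?_) j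
  · exact continuous_const
  · exact (continuous_apply j).comp hr
  · exact continuous_const
  · exact hg.matrix_elem i j

/-- stabilization -/
def embm [Ring K] {n : ℕ} : Matrix (Fin n) (Fin n) K →* Matrix (Fin (n+1)) (Fin (n+1)) K where
  toFun g := blk 0 g
  map_one' := blk_one
  map_mul' g g' := by rw [blk_mul]; simp

abbrev embu [Ring K] {n : ℕ} :
    (Matrix (Fin n) (Fin n) K)ˣ →* (Matrix (Fin (n+1)) (Fin (n+1)) K)ˣ := Units.map embm

lemma embu_val [Ring K] {n : ℕ} (g : (Matrix (Fin n) (Fin n) K)ˣ) :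
    (embu g : Matrix (Fin (n+1)) (Fin (n+1)) K) = blk 0 g := rfl

lemma embu_inj [Ring K] {n : ℕ} : Function.Injective (embu (K := K) (n := n)) := by
  intro a b h
  apply Units.ext
  have := congrArg Units.val h
  rw [embu_val, embu_val] at this
  exact (blk_inj this).2

lemma embu_cont [NormedRing K] [CompleteSpace K] {n : ℕ} : Continuous (embu (K := K) (n := n)) :=
  mat_units_cont (blk_cont continuous_const Units.continuous_val)

/-- Triangular elimination in one parameter. -/
theorem tri_red [NormedRing K] [NormedAlgebra ℝ K] [CompleteSpace K] {n : ℕ} {X : Type*} [TopologicalSpace X]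
    (f : C(X, (Matrix (Fin (n+1)) (Fin (n+1)) K)ˣ))
    (h : ∀ x, (f x : Matrix (Fin (n+1)) (Fin (n+1)) K) *ᵥ Pi.single 0 1 = Pi.single 0 1) :
    ∃ g : C(X, (Matrix (Fin n) (Fin n) K)ˣ), ∃ H : C(X × I, (Matrix (Fin (n+1)) (Fin (n+1)) K)ˣ),
      (∀ x, H (x, 0) = f x) ∧ (∀ x, H (x, 1) = embu (g x)) ∧
      ∀ x, (∃ h, f x = embu h) → ∀ t, H (x, t) = f x := by
  have hinv : ∀ x, ((f x)⁻¹ : (Matrix (Fin (n+1)) (Fin (n+1)) K)ˣ).val *ᵥ Pi.single 0 1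
      = Pi.single 0 1 := by
    intro x
    conv_lhs => rw [← h x]
    rw [Matrix.mulVec_mulVec, Units.inv_mul, Matrix.one_mulVec]
  let r : X → Fin n → K := fun x j => (f x).val 0 j.succ
  let g : X → Matrix (Fin n) (Fin n) K := fun x => (f x).val.submatrix Fin.succ Fin.succ
  let r' : X → Fin n → K := fun x j => ((f x)⁻¹).val 0 j.succ
  let g' : X → Matrix (Fin n) (Fin n) K := fun x => ((f x)⁻¹).val.submatrix Fin.succ Fin.succ
  have hf : ∀ x, (f x).val = blk (r x) (g x) := fun x => blk_of_col _ (h x)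
  have hf' : ∀ x, ((f x)⁻¹).val = blk (r' x) (g' x) := fun x => blk_of_col _ (hinv x)
  have e1 : ∀ x, g x * g' x = 1 := by
    intro x
    have : (f x).val * ((f x)⁻¹).val = 1 := by simp
    rw [hf, hf', blk_mul, ← blk_one] at this
    exact (blk_inj this).2
  have e2 : ∀ x, g' x * g x = 1 := by
    intro x
    have : ((f x)⁻¹).val * (f x).val = 1 := by simp
    rw [hf, hf', blk_mul, ← blk_one] at this
    exact (blk_inj this).2
  have hfc : Continuous fun x => (f x).val := Units.continuous_val.comp f.continuous
  have hrc : Continuous r := continuous_pi fun j => hfc.matrix_elem _ _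
  have hgc : Continuous g := continuous_matrix fun i j => hfc.matrix_elem _ _
  let G : C(X, (Matrix (Fin n) (Fin n) K)ˣ) := ⟨fun x => ⟨g x, g' x, e1 x, e2 x⟩, mat_units_cont hgc⟩
  let H : X × I → (Matrix (Fin (n+1)) (Fin (n+1)) K)ˣ := fun a =>
    ⟨blk ((1 - (a.2:ℝ)) • r a.1) (g a.1), blk (-(((1 - (a.2:ℝ)) • r a.1) ᵥ* g' a.1)) (g' a.1), by
      rw [blk_mul, e1, ← blk_one, neg_add_cancel], by
      rw [blk_mul, e2, ← blk_one, Matrix.neg_vecMul, Matrix.vecMul_vecMul, e2, Matrix.vecMul_one,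
        add_neg_cancel]⟩
  refine ⟨G, ⟨H, mat_units_cont ?_⟩, ?_, ?_, ?_⟩
  · refine blk_cont ?_ (hgc.comp continuous_fst)
    have := hrc.comp (continuous_fst (X := X) (Y := I))
    exact Continuous.fun_smul (by fun_prop) this
  · intro x
    apply Units.ext
    simp [H, hf]
  · intro x
    apply Units.ext
    rw [embu_val]
    simp [H, G]
  · rintro x ⟨k, hk⟩ t
    apply Units.ext
    have : blk (r x) (g x) = blk 0 k.val := by rw [← hf, hk, embu_val]
    have hr := (blk_inj this).1
    simp [H, hf, hr]

theorem col_red [NormedDivisionRing K] [StarRing K] [ContinuousStar K]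
    [NormedAlgebra ℝ K] [CompleteSpace K]
    [FiniteDimensional ℝ K]
    (ν : K → ℝ) (hν : Continuous ν) (hν1 : ∀ x, star x * x = algebraMap ℝ K (ν x))
    (hν0 : ∀ x, 0 ≤ ν x) (hν2 : ∀ x, ν x = 0 → x = 0)
    {n : ℕ} {X F : Type*} [TopologicalSpace X] [CompactSpace X]
    [NormedAddCommGroup F] [NormedSpace ℝ F] [FiniteDimensional ℝ F]
    (hdim : Module.finrank ℝ F + 1 < (n+1) * Module.finrank ℝ K)
    (ι : X → F) (hι : Continuous ι) (hinj : Function.Injective ι)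
    (f : C(X, (Matrix (Fin (n+1)) (Fin (n+1)) K)ˣ)) :
    ∃ g : C(X, (Matrix (Fin n) (Fin n) K)ˣ), ∃ f1 : C(X, (Matrix (Fin (n+1)) (Fin (n+1)) K)ˣ),
    ∃ H1 H2 : C(X × I, (Matrix (Fin (n+1)) (Fin (n+1)) K)ˣ),
      (∀ x, H1 (x, 0) = f x) ∧ (∀ x, H1 (x, 1) = f1 x) ∧ (∀ x, H2 (x, 0) = f1 x) ∧
      (∀ x, H2 (x, 1) = embu (g x)) ∧
      ∀ x, (∃ h, f x = embu h) → f x = embu (g x) := by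
  classical
  let V := Fin (n+1) → K
  let c : X → V := fun x => (f x).val *ᵥ Pi.single 0 1
  have hfc : Continuous fun x => (f x).val := Units.continuous_val.comp f.continuous
  have hc : Continuous c := hfc.matrix_mulVec continuous_const
  have he : (Pi.single 0 1 : V) ≠ 0 := by
    intro h
    have := congrFun h 0
    simp at this
  have hc0 : ∀ x, c x ≠ 0 := by
    intro x h
    apply he
    have : ((f x)⁻¹).val *ᵥ c x = Pi.single 0 1 := by
      simp only [c]
      rw [Matrix.mulVec_mulVec, Units.inv_mul, Matrix.one_mulVec]
    rw [← this, h, Matrix.mulVec_zero]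
  obtain ⟨H, hH, H0, Hc, He, Hr⟩ := T2rel (F := F) (E := V)
    (by simpa [V, Module.finrank_pi_fintype] using hdim) ι hι hinj c hc hc0 _ he
  let E := {p : V // p ≠ 0}
  let S : V → ℝ := fun p => ∑ i, ν (p i)
  have hS : Continuous S := by
    refine continuous_finsetSum _ fun i _ => hν.comp (continuous_apply i)
  have hSne : ∀ p : E, S p.1 ≠ 0 := by
    intro p h
    apply p.2
    have := (Finset.sum_eq_zero_iff_of_nonneg (fun i _ => hν0 (p.1 i))).1 h
    ext i
    exact hν2 _ (this i (Finset.mem_univ i))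
  let w : E → V := fun p => (S p.1)⁻¹ • star p.1
  have hw : Continuous w := by
    apply Continuous.fun_smul
    · exact Continuous.fun_inv₀ (hS.comp continuous_subtype_val) hSne
    · exact continuous_star.comp continuous_subtype_val
  have hwp : ∀ p : E, w p ⬝ᵥ p.1 = 1 := by
    intro p
    show ((S p.1)⁻¹ • star p.1) ⬝ᵥ p.1 = 1
    rw [smul_dotProduct]
    have : star p.1 ⬝ᵥ p.1 = algebraMap ℝ K (S p.1) := by
      simp only [dotProduct, Pi.star_apply, hν1, S, map_sum]
    rw [this, Algebra.smul_def, ← map_mul, inv_mul_cancel₀ (hSne p), map_one]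
  let M : E × E → Matrix (Fin (n+1)) (Fin (n+1)) K := fun a =>
    1 + Matrix.vecMulVec (a.2.1 - a.1.1) (w a.1)
  have hM : Continuous M := by
    refine continuous_const.add (Continuous.matrix_vecMulVec ?_ (hw.comp continuous_fst))
    exact (continuous_subtype_val.comp continuous_snd).sub (continuous_subtype_val.comp continuous_fst)
  have hMp : ∀ p q : E, M (p, q) *ᵥ p.1 = q.1 := by
    intro p q
    simp only [M]
    rw [Matrix.add_mulVec, Matrix.one_mulVec, Matrix.vecMulVec_mulVec, hwp]
    ext i; simp
    show p.1 i + (q.1 i - p.1 i) = q.1 i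
    abel
  have hMd : ∀ p, M (p, p) = 1 := by
    intro p
    simp [M]
  let G : E × E → (Matrix (Fin (n+1)) (Fin (n+1)) K)ˣ := fun a => if h : IsUnit (M a) then h.unit else 1
  have hgv : ∀ a, IsUnit (M a) → (G a).val = M a := by
    intro a h
    simp only [G, dif_pos h, IsUnit.unit_spec]
  obtain ⟨Γ, hΓ, hΓ0, hΓR, hΓ1⟩ := lift_T1
    (fun (g : (Matrix (Fin (n+1)) (Fin (n+1)) K)ˣ) (p q : E) => g.val *ᵥ p.1 = q.1)
    (fun p => by simp) (by
      intro g h p q r h1 h2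
      rw [Units.val_mul, ← Matrix.mulVec_mulVec, h1, h2]) {a | IsUnit (M a)} (by
      have : {a | IsUnit (M a)} = M ⁻¹' (Set.range (Units.val : (Matrix (Fin (n+1)) (Fin (n+1)) K)ˣ → _)) := by
        ext a; simp [IsUnit]
      rw [this]
      exact mat_units_emb.isOpen_range.preimage hM) (by
      intro p
      show IsUnit (M (p, p))
      rw [hMd]; exact isUnit_one) G (by
      have : ContinuousOn (fun a => (G a).val) {a | IsUnit (M a)} :=
        hM.continuousOn.congr (fun a ha => hgv a ha)
      rw [continuousOn_iff_continuous_domRestrict] at this ⊢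
      exact mat_units_cont this) (by
      intro p q h
      rw [hgv _ h]; exact hMp p q) (by
      intro p
      apply Units.ext
      have : IsUnit (M (p, p)) := by rw [hMd]; exact isUnit_one
      rw [hgv _ this, hMd]; rfl) (fun a : X × I => (⟨H a, H0 a⟩ : E)) (hH.subtype_mk _)
  let f1 : C(X, (Matrix (Fin (n+1)) (Fin (n+1)) K)ˣ) := ⟨fun x => Γ (x, 1) * f x, by fun_prop⟩
  obtain ⟨g, H2, H20, H21, H22⟩ := tri_red f1 (by
    intro x
    have := hΓR x 1
    simp only [Hc, He] at this
    refine Eq.trans ?_ this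
    simp only [f1, ContinuousMap.coe_mk, Units.val_mul, c]
    rw [Matrix.mulVec_mulVec])
  refine ⟨g, f1, ⟨fun a => Γ a * f a.1, by fun_prop⟩, H2, ?_, ?_, H20, H21, ?_⟩
  · intro x; simp [hΓ0]
  · intro x; rfl
  · rintro x ⟨h, hh⟩
    have hcx : c x = Pi.single 0 1 := by
      simp only [c, hh, embu_val]; exact blk_col _ _
    have e1 : f1 x = f x := by
      have := hΓ1 x (fun t => by
        apply Subtype.ext
        show H (x, t) = H (x, 0)
        rw [Hr x hcx, Hr x hcx]) 1
      simp [f1, this]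
    have := H22 x ⟨h, by rw [e1, hh]⟩ 1
    rw [H21] at this
    rw [← e1, this]

end colred
end

section
open unitInterval Topology Quaternion Matrix

lemma homotopic_of_fun {X Y : Type*} [TopologicalSpace X] [TopologicalSpace Y] {f g : C(X, Y)}
    (H : C(X × I, Y)) (h0 : ∀ x, H (x, 0) = f x) (h1 : ∀ x, H (x, 1) = g x) : f.Homotopic g := by
  refine ⟨⟨⟨fun a => H (a.2, a.1), by fun_prop⟩, ?_, ?_⟩⟩
  · intro x; exact h0 x
  · intro x; exact h1 x

lemma quat_null_step {n : ℕ} (hn : 1 ≤ n)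
    (h : ∀ g : C(unitSphere 5, (Matrix (Fin n) (Fin n) ℍ[ℝ])ˣ), g.Nullhomotopic)
    (f : C(unitSphere 5, (Matrix (Fin (n+1)) (Fin (n+1)) ℍ[ℝ])ˣ)) : f.Nullhomotopic := by
  have : CompactSpace (unitSphere 5) := inferInstanceAs (CompactSpace (Metric.sphere _ _))
  obtain ⟨g, f1, H1, H2, a1, a2, a3, a4, -⟩ := col_red (K := ℍ[ℝ]) (fun x => Quaternion.normSq x)
    Quaternion.continuous_normSq (fun x => by
      rw [Quaternion.star_mul_self]; rfl) (fun x => Quaternion.normSq_nonneg)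
    (fun x hx => Quaternion.normSq_eq_zero.1 hx) (F := EuclideanSpace ℝ (Fin 6)) (n := n) (by
      rw [Quaternion.finrank_eq_four]; simp; omega) (fun x : unitSphere 5 => x.1)
    continuous_subtype_val Subtype.val_injective f
  obtain ⟨c, hc⟩ := h g
  let E : C((Matrix (Fin n) (Fin n) ℍ[ℝ])ˣ, (Matrix (Fin (n+1)) (Fin (n+1)) ℍ[ℝ])ˣ) :=
    ⟨embu, embu_cont⟩
  refine ⟨embu c, ?_⟩
  have e1 : f.Homotopic f1 := homotopic_of_fun H1 a1 a2
  have e2 : f1.Homotopic (E.comp g) := homotopic_of_fun H2 a3 a4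
  have e3 : (E.comp g).Homotopic (E.comp (ContinuousMap.const _ c)) :=
    ContinuousMap.Homotopic.comp (ContinuousMap.Homotopic.refl E) hc
  exact (e1.trans e2).trans e3

lemma quat_null_one (h : ∀ g : C(unitSphere 5, ℍ[ℝ]ˣ), g.Nullhomotopic)
    (f : C(unitSphere 5, (Matrix (Fin 1) (Fin 1) ℍ[ℝ])ˣ)) : f.Nullhomotopic := by
  let e : Matrix (Fin 1) (Fin 1) ℍ[ℝ] ≃+* ℍ[ℝ] := Matrix.uniqueRingEquiv
  have he : Continuous e := by
    show Continuous fun A : Matrix (Fin 1) (Fin 1) ℍ[ℝ] => A default default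
    exact continuous_id.matrix_elem _ _
  have he' : Continuous e.symm := by
    show Continuous fun a : ℍ[ℝ] => (Matrix.of fun _ _ => a : Matrix (Fin 1) (Fin 1) ℍ[ℝ])
    exact continuous_matrix fun _ _ => continuous_id
  let a : C((Matrix (Fin 1) (Fin 1) ℍ[ℝ])ˣ, ℍ[ℝ]ˣ) := ⟨Units.map e.toMonoidHom, Continuous.units_map _ he⟩
  let b : C(ℍ[ℝ]ˣ, (Matrix (Fin 1) (Fin 1) ℍ[ℝ])ˣ) :=
    ⟨Units.map e.symm.toMonoidHom, Continuous.units_map _ he'⟩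
  obtain ⟨c, hc⟩ := h (a.comp f)
  refine ⟨b c, ?_⟩
  have e3 : (b.comp (a.comp f)).Homotopic (b.comp (ContinuousMap.const _ c)) :=
    ContinuousMap.Homotopic.comp (ContinuousMap.Homotopic.refl b) hc
  have : b.comp (a.comp f) = f := by
    ext1 x
    apply Units.ext
    show e.symm (e (f x).val) = _
    simp
  rw [this] at e3
  exact e3

theorem quat_null_four (h : ∀ g : C(unitSphere 5, ℍ[ℝ]ˣ), g.Nullhomotopic)
    (f : C(unitSphere 5, (Matrix (Fin 4) (Fin 4) ℍ[ℝ])ˣ)) : f.Nullhomotopic :=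
  quat_null_step (by norm_num) (quat_null_step (by norm_num) (quat_null_step (by norm_num)
    (quat_null_one h))) f
end

section
open unitInterval Topology Quaternion Matrix

/-- frames in the imaginary quaternions -/
abbrev QFr : Type := {p : ℍ[ℝ] × ℍ[ℝ] // p.1 * p.1 = -1 ∧ p.2 * p.2 = -1 ∧ p.1 * p.2 = -(p.2 * p.1)}

noncomputable def frm (p q : QFr) : ℍ[ℝ] :=
  (4⁻¹ : ℝ) • ((1 - q.1.1 * p.1.1) - q.1.2 * (1 - q.1.1 * p.1.1) * p.1.2)

lemma frm_cont : Continuous fun a : QFr × QFr => frm a.1 a.2 := by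
  unfold frm
  fun_prop

lemma frm_self (p : QFr) : frm p p = 1 := by
  obtain ⟨⟨a, b⟩, ha, hb, hab⟩ := p
  simp only at ha hb hab
  have : b * (1 - -1) * b = -(2:ℝ) • 1 := by
    have : b * (1 - -1) * b = b * b + b * b := by noncomm_ring
    rw [this, hb]; ext <;> (simp; try norm_num)
  simp only [frm, ha, this]
  ext <;> (simp; try norm_num)

lemma frm_1 (p q : QFr) : frm p q * p.1.1 = q.1.1 * frm p q := by
  obtain ⟨⟨a, b⟩, ha, hb, hab⟩ := p
  obtain ⟨⟨c, d⟩, hc, hd, hcd⟩ := q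
  simp only at ha hb hab hc hd hcd
  simp only [frm, smul_mul_assoc, mul_smul_comm]
  congr 1
  have e1 : (1 - c * a) * a = c * (1 - c * a) := by
    rw [sub_mul, mul_sub, mul_assoc, ha, ← mul_assoc, hc]; simp [add_comm]
  generalize 1 - c * a = g at *
  calc (g - d * g * b) * a = g * a - d * g * (b * a) := by noncomm_ring
    _ = g * a + d * (g * a) * b := by
      rw [← neg_eq_iff_eq_neg.2 hab]; noncomm_ring
    _ = c * g + (d * c) * g * b := by rw [e1]; noncomm_ring
    _ = c * (g - d * g * b) := by rw [← neg_eq_iff_eq_neg.2 hcd]; noncomm_ring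

lemma frm_2 (p q : QFr) : frm p q * p.1.2 = q.1.2 * frm p q := by
  obtain ⟨⟨a, b⟩, ha, hb, hab⟩ := p
  obtain ⟨⟨c, d⟩, hc, hd, hcd⟩ := q
  simp only at ha hb hab hc hd hcd
  simp only [frm, smul_mul_assoc, mul_smul_comm]
  congr 1
  generalize 1 - c * a = g at *
  calc (g - d * g * b) * b = g * b - d * g * (b * b) := by noncomm_ring
    _ = d * g - (d * d) * g * b := by rw [hb, hd]; noncomm_ring
    _ = d * (g - d * g * b) := by noncomm_ring

/-- lifting of frames -/
theorem frame_lift {X : Type*} [TopologicalSpace X] [CompactSpace X] (H : X × I → QFr)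
    (hH : Continuous H) : ∃ Γ : X × I → ℍ[ℝ]ˣ, Continuous Γ ∧ (∀ x, Γ (x, 0) = 1) ∧
      (∀ x t, (Γ (x, t)).val * (H (x, 0)).1.1 = (H (x, t)).1.1 * (Γ (x, t)).val ∧
        (Γ (x, t)).val * (H (x, 0)).1.2 = (H (x, t)).1.2 * (Γ (x, t)).val) ∧
      ∀ x, (∀ t, H (x, t) = H (x, 0)) → ∀ t, Γ (x, t) = 1 := by
  classical
  let g : QFr × QFr → ℍ[ℝ]ˣ := fun a => if h : frm a.1 a.2 ≠ 0 then Units.mk0 _ h else 1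
  have hgv : ∀ a : QFr × QFr, frm a.1 a.2 ≠ 0 → (g a).val = frm a.1 a.2 := by
    intro a h
    simp only [g, dif_pos h, Units.val_mk0]
  have hd : ∀ p : QFr, frm p p ≠ 0 := fun p => by rw [frm_self]; exact one_ne_zero
  refine lift_T1 (fun (g : ℍ[ℝ]ˣ) (p q : QFr) => g.val * p.1.1 = q.1.1 * g.val ∧
      g.val * p.1.2 = q.1.2 * g.val) (fun p => by simp) ?_
      {a | frm a.1 a.2 ≠ 0} ?_ hd g ?_ ?_ ?_ H hH
  · rintro g h p q r ⟨h1, h2⟩ ⟨h3, h4⟩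
    constructor
    · rw [Units.val_mul, mul_assoc, h1, ← mul_assoc, h3, mul_assoc]
    · rw [Units.val_mul, mul_assoc, h2, ← mul_assoc, h4, mul_assoc]
  · exact IsOpen.preimage frm_cont (isOpen_compl_singleton (x := (0:ℍ[ℝ])))
  · have : ContinuousOn (fun a => (g a).val) {a : QFr × QFr | frm a.1 a.2 ≠ 0} :=
      frm_cont.continuousOn.congr (fun a ha => hgv a ha)
    rw [continuousOn_iff_continuous_domRestrict] at this ⊢
    exact S2q_units_continuous this
  · intro p q h
    have e : (g (p, q)).val = frm p q := hgv (p, q) h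
    show (g (p, q)).val * _ = _ * (g (p, q)).val ∧ (g (p, q)).val * _ = _ * (g (p, q)).val
    rw [e]
    exact ⟨frm_1 p q, frm_2 p q⟩
  · intro p
    apply Units.ext
    exact (hgv (p, p) (hd p)).trans (frm_self p)

/-- no square of frames bounding the full rotation -/
theorem frame_core (H : I × I → QFr) (hH : Continuous H) (h0 : ∀ τ, (H (0, τ)).1 = (qk, qi))
    (h1 : ∀ τ, (H (1, τ)).1 = (qk, qi)) (h2 : ∀ t, (H (t, 0)).1 = (qk, qi))
    (h3 : ∀ t : I, (H (t, 1)).1 = (qk, Real.cos (2 * Real.pi * t) • qi +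
      Real.sin (2 * Real.pi * t) • qj)) : False := by
  obtain ⟨Γ, hΓ, -, hR, hc⟩ := frame_lift H hH
  let x : I → ℝ := fun t => (Γ (t, 1)).val.re
  let y : I → ℝ := fun t => (Γ (t, 1)).val.imK
  have hv : Continuous fun t : I => (Γ (t, 1)).val :=
    Units.continuous_val.comp (hΓ.comp (by fun_prop))
  have hx : Continuous x := Quaternion.continuous_re.comp hv
  have hy : Continuous y := Quaternion.continuous_imK.comp hv
  have key : ∀ t : I, x t * Real.sin (Real.pi * t) = y t * Real.cos (Real.pi * t) ∧
      (x t ≠ 0 ∨ y t ≠ 0) := by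
    intro t
    obtain ⟨e1, e2⟩ := hR t 1
    rw [h2, h3] at e1 e2
    simp only at e1 e2
    have hne : (Γ (t, 1)).val ≠ 0 := (Γ (t, 1)).ne_zero
    simp only [x, y]
    generalize (Γ (t, 1)).val = q at *
    have hi : q.imI = 0 := by
      have := congrArg QuaternionAlgebra.imJ e1
      simp at this
      linarith
    have hj : q.imJ = 0 := by
      have := congrArg QuaternionAlgebra.imI e1
      simp at this
      linarith
    have f1 := congrArg QuaternionAlgebra.imI e2
    have f2 := congrArg QuaternionAlgebra.imJ e2
    simp [hi, hj] at f1 f2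
    have hc2 : Real.cos (2 * Real.pi * t) = Real.cos (Real.pi * t) ^ 2 - Real.sin (Real.pi * t) ^ 2 := by
      rw [mul_assoc, Real.cos_two_mul']
    have hs2 : Real.sin (2 * Real.pi * t) = 2 * Real.sin (Real.pi * t) * Real.cos (Real.pi * t) := by
      rw [mul_assoc, Real.sin_two_mul]
    rw [hc2, hs2] at f1 f2
    have hsc := Real.sin_sq_add_cos_sq (Real.pi * t)
    generalize Real.sin (Real.pi * t) = S at *
    generalize Real.cos (Real.pi * t) = C at *
    constructor
    · have a1 : S * (q.re * S - q.imK * C) = 0 := by linear_combination (1/2) * f1 + (1/2) * q.re * hsc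
      have a2 : C * (q.re * S - q.imK * C) = 0 := by
        linear_combination (-1/2) * f2 - (1/2) * q.imK * hsc
      linear_combination S * a1 + C * a2 - (q.re * S - q.imK * C) * hsc
    · by_contra hcon
      push Not at hcon
      apply hne
      ext <;> simp [hi, hj, hcon.1, hcon.2]
  have g0 : Γ (0, 1) = 1 := hc 0 (fun t => Subtype.ext (by rw [h0, h0])) 1
  have g1 : Γ (1, 1) = 1 := hc 1 (fun t => Subtype.ext (by rw [h1, h1])) 1
  let ρ : I → ℝ := fun t => x t * Real.cos (Real.pi * t) + y t * Real.sin (Real.pi * t)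
  have hρ : Continuous ρ := by fun_prop
  have r0 : ρ 0 = 1 := by simp [ρ, x, y, g0]
  have r1 : ρ 1 = -1 := by simp [ρ, x, y, g1]
  obtain ⟨t, ht⟩ : ∃ t, ρ t = 0 := by
    have := mem_range_of_exists_le_of_exists_ge hρ (c := 0) ⟨1, by rw [r1]; norm_num⟩
      ⟨0, by rw [r0]; norm_num⟩
    exact this
  obtain ⟨k1, k2⟩ := key t
  have hsc := Real.sin_sq_add_cos_sq (Real.pi * t)
  simp only [ρ] at ht
  have z1 : x t = 0 := by
    linear_combination Real.cos (Real.pi * t) * ht + Real.sin (Real.pi * t) * k1 - x t * hsc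
  have z2 : y t = 0 := by
    linear_combination Real.sin (Real.pi * t) * ht - Real.cos (Real.pi * t) * k1 - y t * hsc
  rcases k2 with k2 | k2
  · exact k2 z1
  · exact k2 z2
end

section
open unitInterval Topology Quaternion Matrix

noncomputable def rot3 (θ : ℝ) : (Matrix (Fin 3) (Fin 3) ℝ)ˣ where
  val := !![1,0,0; 0, Real.cos θ, -Real.sin θ; 0, Real.sin θ, Real.cos θ]
  inv := !![1,0,0; 0, Real.cos θ, Real.sin θ; 0, -Real.sin θ, Real.cos θ]
  val_inv := by
    have := Real.sin_sq_add_cos_sq θ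
    ext i j; fin_cases i <;> fin_cases j <;>
    simp [Matrix.mul_apply, Fin.sum_univ_three] <;> linarith
  inv_val := by
    have := Real.sin_sq_add_cos_sq θ
    ext i j; fin_cases i <;> fin_cases j <;>
    simp [Matrix.mul_apply, Fin.sum_univ_three] <;> linarith

noncomputable def rotN : (m : ℕ) → ℝ → (Matrix (Fin (m+3)) (Fin (m+3)) ℝ)ˣ
  | 0, θ => rot3 θ
  | m+1, θ => embu (rotN m θ)

lemma im_sq {p : ℍ[ℝ]} (h : p.re = 0) : p * p = -(Quaternion.normSq p • (1 : ℍ[ℝ])) := by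
  ext <;> simp [h, Quaternion.normSq_def'] <;> ring

lemma im_sq_unit {p : ℍ[ℝ]} (h : p.re = 0) (h0 : p ≠ 0) :
    ((√(Quaternion.normSq p))⁻¹ • p) * ((√(Quaternion.normSq p))⁻¹ • p) = -1 := by
  have hp : 0 < Quaternion.normSq p := lt_of_le_of_ne Quaternion.normSq_nonneg
    (fun h => h0 (Quaternion.normSq_eq_zero.1 h.symm))
  rw [smul_mul_smul_comm, im_sq h, smul_neg, smul_smul, ← mul_inv, Real.mul_self_sqrt hp.le,
    inv_mul_cancel₀ hp.ne', one_smul]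

noncomputable def colq (v : Fin 3 → ℝ) : ℍ[ℝ] := v 1 • qi + v 2 • qj + v 0 • qk

theorem core_base (T : C(I × I, (Matrix (Fin 3) (Fin 3) ℝ)ˣ)) (h0 : ∀ τ, T (0, τ) = 1)
    (h1 : ∀ τ, T (1, τ) = 1) (h2 : ∀ t, T (t, 1) = 1)
    (h3 : ∀ t : I, T (t, 0) = rot3 (2 * Real.pi * t)) : False := by
  let u : I × I → ℍ[ℝ] := fun x => (T x).val 1 0 • qi + (T x).val 2 0 • qj + (T x).val 0 0 • qk
  let w : I × I → ℍ[ℝ] := fun x => (T x).val 1 1 • qi + (T x).val 2 1 • qj + (T x).val 0 1 • qk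
  let N : I × I → ℝ := fun x => Quaternion.normSq (u x)
  let d : I × I → ℝ := fun x => (T x).val 0 0 * (T x).val 0 1 + (T x).val 1 0 * (T x).val 1 1 +
    (T x).val 2 0 * (T x).val 2 1
  have hTc : Continuous fun x => (T x).val := Units.continuous_val.comp T.continuous
  have hTe : ∀ i j, Continuous fun x => (T x).val i j := fun i j => hTc.matrix_elem i j
  have hu : Continuous u := by
    have := hTe 1 0; have := hTe 2 0; have := hTe 0 0
    fun_prop
  have hw : Continuous w := by
    have := hTe 1 1; have := hTe 2 1; have := hTe 0 1
    fun_prop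
  have hN : Continuous N := Quaternion.continuous_normSq.comp hu
  have hd : Continuous d := by
    have := hTe 1 0; have := hTe 2 0; have := hTe 0 0
    have := hTe 1 1; have := hTe 2 1; have := hTe 0 1
    fun_prop
  let b : I × I → ℍ[ℝ] := fun x => N x • w x - d x • u x
  have hb : Continuous b := by fun_prop
  have ure : ∀ x, (u x).re = 0 := fun x => by simp [u]
  have bre : ∀ x, (b x).re = 0 := fun x => by simp [b, u, w]
  have hker : ∀ x (v : Fin 3 → ℝ), (T x).val *ᵥ v = 0 → v = 0 := by
    intro x v h
    have : ((T x)⁻¹).val *ᵥ ((T x).val *ᵥ v) = v := by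
      rw [Matrix.mulVec_mulVec, Units.inv_mul, Matrix.one_mulVec]
    rw [← this, h, Matrix.mulVec_zero]
  have lin : ∀ x (α β : ℝ), α • u x + β • w x = 0 → α = 0 ∧ β = 0 := by
    intro x α β h
    have i1 := congrArg QuaternionAlgebra.imI h
    have i2 := congrArg QuaternionAlgebra.imJ h
    have i3 := congrArg QuaternionAlgebra.imK h
    simp [u, w] at i1 i2 i3
    have := hker x ![α, β, 0] (by
      ext i
      fin_cases i <;> simp [Matrix.mulVec, dotProduct, Fin.sum_univ_three] <;> linarith)
    exact ⟨by simpa using congrFun this 0, by simpa using congrFun this 1⟩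
  have u0 : ∀ x, u x ≠ 0 := by
    intro x h
    have := (lin x 1 0 (by simp [h])).1
    norm_num at this
  have hN0 : ∀ x, N x ≠ 0 := fun x h => u0 x (Quaternion.normSq_eq_zero.1 h)
  have b0 : ∀ x, b x ≠ 0 := by
    intro x h
    have := (lin x (-d x) (N x) (by rw [← h]; simp only [b]; module)).2
    exact hN0 x this
  have anti : ∀ x, u x * b x = -(b x * u x) := by
    intro x
    simp only [b, u, w, N, d, Quaternion.normSq_def']
    ext <;> simp <;> ring
  let F : I × I → QFr := fun x => ⟨((√(Quaternion.normSq (u x)))⁻¹ • u x,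
    (√(Quaternion.normSq (b x)))⁻¹ • b x), im_sq_unit (ure x) (u0 x), im_sq_unit (bre x) (b0 x), by
      simp only
      rw [smul_mul_smul_comm, smul_mul_smul_comm, anti, smul_neg, mul_comm]⟩
  have hsq : ∀ p : I × I → ℍ[ℝ], Continuous p → (∀ x, p x ≠ 0) →
      Continuous fun x => (√(Quaternion.normSq (p x)))⁻¹ • p x := by
    intro p hp h0
    refine Continuous.fun_smul (Continuous.fun_inv₀ ?_ ?_) hp
    · exact Real.continuous_sqrt.comp (Quaternion.continuous_normSq.comp hp)
    · intro x h
      have := (Real.sqrt_eq_zero Quaternion.normSq_nonneg).1 h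
      exact h0 x (Quaternion.normSq_eq_zero.1 this)
  have hF : Continuous F := ((hsq u hu u0).prodMk (hsq b hb b0)).subtype_mk _
  have F1 : ∀ x, T x = 1 → (F x).1 = (qk, qi) := by
    intro x hx
    have hu1 : u x = qk := by simp [u, hx]
    have hw1 : w x = qi := by simp [w, hx]
    have hd1 : d x = 0 := by simp [d, hx]
    have hN1 : N x = 1 := by simp [N, hu1, Quaternion.normSq_def']
    have hb1 : b x = qi := by simp [b, hd1, hN1, hw1]
    simp [F, hu1, hb1, Quaternion.normSq_def']
  refine frame_core (fun x => F (x.1, σ x.2)) (by fun_prop) (fun τ => F1 _ (h0 _))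
    (fun τ => F1 _ (h1 _)) (fun t => F1 _ (by simp [h2])) ?_
  intro t
  simp only [unitInterval.symm_one]
  have hx := h3 t
  have hu1 : u (t, 0) = qk := by simp [u, hx, rot3]
  have hw1 : w (t, 0) = Real.cos (2 * Real.pi * t) • qi + Real.sin (2 * Real.pi * t) • qj := by
    simp [w, hx, rot3]
  have hd1 : d (t, 0) = 0 := by simp [d, hx, rot3]
  have hN1 : N (t, 0) = 1 := by simp [N, hu1, Quaternion.normSq_def']
  have hb1 : b (t, 0) = Real.cos (2 * Real.pi * t) • qi + Real.sin (2 * Real.pi * t) • qj := by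
    simp [b, hd1, hN1, hw1]
  simp [F, hu1, hb1, Quaternion.normSq_def']

theorem core (m : ℕ) (T : C(I × I, (Matrix (Fin (m+3)) (Fin (m+3)) ℝ)ˣ)) (h0 : ∀ τ, T (0, τ) = 1)
    (h1 : ∀ τ, T (1, τ) = 1) (h2 : ∀ t, T (t, 1) = 1)
    (h3 : ∀ t : I, T (t, 0) = rotN m (2 * Real.pi * t)) : False := by
  induction m with
  | zero => exact core_base T h0 h1 h2 h3
  | succ m ih =>
    obtain ⟨g, -, -, -, -, -, -, -, hg⟩ := col_red (K := ℝ) (fun x => x * x) (by fun_prop)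
      (fun x => by simp) (fun x => mul_self_nonneg x) (fun x hx => by simpa using hx)
      (F := ℝ × ℝ) (n := m + 3) (by simp) (fun x : I × I => ((x.1 : ℝ), (x.2 : ℝ)))
      (by fun_prop) (by
        rintro ⟨a, b⟩ ⟨c, d⟩ h
        simp only [Prod.mk.injEq] at h
        exact Prod.ext (Subtype.ext h.1) (Subtype.ext h.2)) T
    have hg' : ∀ x k, T x = embu k → g x = k := by
      intro x k h
      have := hg x ⟨k, h⟩
      rw [h] at this
      exact (embu_inj this).symm
    refine ih g (fun τ => hg' _ _ ?_) (fun τ => hg' _ _ ?_) (fun t => hg' _ _ ?_)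
      (fun t => hg' _ _ ?_)
    · rw [h0, map_one]
    · rw [h1, map_one]
    · rw [h2, map_one]
    · rw [h3, rotN]
end

section
open unitInterval Topology Matrix

/-- weak continuity of a family of endomorphisms -/
def ContEnd {X V W : Type*} [TopologicalSpace X] [AddCommGroup V] [Module ℝ V] [AddCommGroup W]
    [Module ℝ W] (A : X → V →ₗ[ℝ] W) : Prop :=
  ∀ (l : W →ₗ[ℝ] ℝ) (v : V), Continuous fun x => l (A x v)

section
variable {X V W Z : Type*} [TopologicalSpace X] [AddCommGroup V] [Module ℝ V] [AddCommGroup W]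
    [Module ℝ W] [AddCommGroup Z] [Module ℝ Z]

lemma ContEnd.const (A : V →ₗ[ℝ] W) : ContEnd (fun _ : X => A) := fun _ _ => continuous_const

lemma ContEnd.add {A B : X → V →ₗ[ℝ] W} (hA : ContEnd A) (hB : ContEnd B) :
    ContEnd (fun x => A x + B x) := by
  intro l v
  simp only [LinearMap.add_apply, map_add]
  exact (hA l v).add (hB l v)

lemma ContEnd.sub {A B : X → V →ₗ[ℝ] W} (hA : ContEnd A) (hB : ContEnd B) :
    ContEnd (fun x => A x - B x) := by
  intro l v
  simp only [LinearMap.sub_apply, map_sub]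
  exact (hA l v).sub (hB l v)

lemma ContEnd.smul {c : X → ℝ} {A : X → V →ₗ[ℝ] W} (hc : Continuous c) (hA : ContEnd A) :
    ContEnd (fun x => c x • A x) := by
  intro l v
  simp only [LinearMap.smul_apply, map_smul, smul_eq_mul]
  exact hc.mul (hA l v)

lemma ContEnd.sum {ι : Type*} (s : Finset ι) {A : ι → X → V →ₗ[ℝ] W} (hA : ∀ i ∈ s, ContEnd (A i)) :
    ContEnd (fun x => ∑ i ∈ s, A i x) := by
  intro l v
  simp only [LinearMap.sum_apply, map_sum]
  exact continuous_finsetSum _ fun i hi => hA i hi l v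

lemma ContEnd.comp [FiniteDimensional ℝ W] {A : X → W →ₗ[ℝ] Z} {B : X → V →ₗ[ℝ] W} (hA : ContEnd A)
    (hB : ContEnd B) : ContEnd (fun x => A x ∘ₗ B x) := by
  intro l v
  let b := Module.finBasis ℝ W
  have : ∀ x, l ((A x ∘ₗ B x) v) = ∑ i, (b.coord i (B x v)) * l (A x (b i)) := by
    intro x
    rw [LinearMap.comp_apply]
    conv_lhs => rw [← b.sum_repr (B x v)]
    simp only [map_sum, map_smul, smul_eq_mul, Module.Basis.coord_apply]
  simp only [this]
  exact continuous_finsetSum _ fun i _ => (hB _ _).mul (hA _ _)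

lemma ContEnd.mul [FiniteDimensional ℝ V] {A B : X → Module.End ℝ V} (hA : ContEnd A)
    (hB : ContEnd B) : ContEnd (fun x => A x * B x) := ContEnd.comp hA hB

lemma ContEnd.precomp {Y : Type*} [TopologicalSpace Y] {A : X → V →ₗ[ℝ] W} (hA : ContEnd A)
    {f : Y → X} (hf : Continuous f) : ContEnd (fun y => A (f y)) := fun l v => (hA l v).comp hf

end

section alg
variable {S : Type*} [Ring S] [Algebra ℝ S]

/-- partial rotation -/
noncomputable def eX (p X : S) (θ : ℝ) : S := 1 - p + Real.cos θ • p + Real.sin θ • X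

lemma eX_mul {p X : S} (hp : p * p = p) (hX : X * X = -p) (h1 : p * X = X) (h2 : X * p = X)
    (θ η : ℝ) : eX p X θ * eX p X η = eX p X (θ + η) := by
  simp only [eX, Real.cos_add, Real.sin_add, sub_mul, mul_sub, add_mul, mul_add, one_mul, mul_one,
    smul_mul_assoc, mul_smul_comm, hp, hX, h1, h2]
  module

lemma eX_neg {p X : S} (θ : ℝ) : eX p (-X) θ = eX p X (-θ) := by
  simp [eX]

lemma eX_zero {p X : S} : eX p X 0 = 1 := by simp [eX]

lemma eX_two_pi {p X : S} : eX p X (2 * Real.pi) = 1 := by simp [eX]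

lemma eX_comm {p X q Y : S} (h1 : p * q = 0) (h2 : p * Y = 0) (h3 : X * q = 0) (h4 : X * Y = 0)
    (θ : ℝ) : eX p X θ * eX q Y θ = eX (p + q) (X + Y) θ := by
  simp only [eX, sub_mul, mul_sub, add_mul, mul_add, one_mul, mul_one,
    smul_mul_assoc, mul_smul_comm, h1, h2, h3, h4]
  module

end alg

/-- diagonal action -/
def dg {V : Type*} [AddCommGroup V] [Module ℝ V] (p : Module.End ℝ V) : Module.End ℝ (V × V) :=
  LinearMap.prodMap p p

def KK (V : Type*) [AddCommGroup V] [Module ℝ V] : Module.End ℝ (V × V) :=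
  LinearMap.prod (-LinearMap.snd ℝ V V) (LinearMap.fst ℝ V V)

def KS (V : Type*) [AddCommGroup V] [Module ℝ V] : Module.End ℝ (V × V) :=
  LinearMap.prod (LinearMap.snd ℝ V V) (LinearMap.fst ℝ V V)

section
variable {V : Type*} [AddCommGroup V] [Module ℝ V]
@[simp] lemma dg_apply (p : Module.End ℝ V) (x : V × V) : dg p x = (p x.1, p x.2) := rfl
@[simp] lemma KK_apply (x : V × V) : KK V x = (-x.2, x.1) := rfl
@[simp] lemma KS_apply (x : V × V) : KS V x = (x.2, x.1) := rfl
lemma dg_mul (p q : Module.End ℝ V) : dg (p * q) = dg p * dg q := rfl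
lemma dg_KK (p : Module.End ℝ V) : dg p * KK V = KK V * dg p := by
  ext x <;> simp
lemma dg_KS (p : Module.End ℝ V) : dg p * KS V = KS V * dg p := by
  ext x <;> simp
lemma KK_sq : KK V * KK V = -1 := by ext x <;> simp
lemma KS_sq : KS V * KS V = 1 := by ext x <;> simp
lemma KS_KK : KS V * KK V = - (KK V * KS V) := by ext x <;> simp
end

lemma rotN_mulVec (m : ℕ) (θ : ℝ) (w : Fin (m+3) → ℝ) (i : Fin (m + 3)) :
    ((rotN m θ).val *ᵥ w) i = if i.val ≤ m then w i else
      if i.val = m + 1 then Real.cos θ * w ⟨m+1, by omega⟩ - Real.sin θ * w ⟨m+2, by omega⟩ else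
        Real.sin θ * w ⟨m+1, by omega⟩ + Real.cos θ * w ⟨m+2, by omega⟩ := by
  induction m with
  | zero =>
    fin_cases i <;> simp [rotN, rot3, Matrix.mulVec, dotProduct, Fin.sum_univ_three] <;> ring
  | succ m ih =>
    rw [rotN, embu_val]
    refine Fin.cases ?_ (fun i => ?_) i
    · simp [Matrix.mulVec, dotProduct, Fin.sum_univ_succ]
    · have : (blk 0 (rotN m θ).val *ᵥ w) i.succ = ((rotN m θ).val *ᵥ (fun j => w j.succ)) i := by
        simp [Matrix.mulVec, dotProduct, Fin.sum_univ_succ (n := m + 3)]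
      rw [this, ih]
      simp [Fin.succ]

theorem core_lin {V : Type*} [AddCommGroup V] [Module ℝ V] [FiniteDimensional ℝ V]
    (hV : 2 ≤ Module.finrank ℝ V) (b : V) (l : V →ₗ[ℝ] ℝ) (hl : l b = 1)
    (T : I × I → Module.End ℝ (V × V)) (hT : ContEnd T) (hu : ∀ x, IsUnit (T x))
    (h0 : ∀ τ, T (0, τ) = 1) (h1 : ∀ τ, T (1, τ) = 1) (h2 : ∀ t, T (t, 1) = 1)
    (h3 : ∀ t : I, T (t, 0) = eX (dg (l.smulRight b)) (dg (l.smulRight b) * KK V) (2 * Real.pi * t)) :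
    False := by
  obtain ⟨m, hm⟩ : ∃ m, Module.finrank ℝ (LinearMap.ker l × LinearMap.ker l) = m + 1 := by
    have : Module.finrank ℝ (LinearMap.ker l) + 1 = Module.finrank ℝ V := by
      have := LinearMap.finrank_range_add_finrank_ker l
      have hs : LinearMap.range l = ⊤ := by
        rw [LinearMap.range_eq_top]
        intro c
        exact ⟨c • b, by simp [hl]⟩
      rw [hs] at this
      simp at this
      omega
    rw [Module.finrank_prod]
    exact ⟨Module.finrank ℝ (LinearMap.ker l) + Module.finrank ℝ (LinearMap.ker l) - 1, by omega⟩
  let κ : (LinearMap.ker l × LinearMap.ker l) ≃ₗ[ℝ] (Fin (m+1) → ℝ) :=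
    LinearEquiv.ofFinrankEq _ _ (by simp [hm])
  let π : V →ₗ[ℝ] LinearMap.ker l := LinearMap.codRestrict _ (LinearMap.id - l.smulRight b) (by
    intro x; simp [hl])
  have hπv : ∀ x, (π x : V) = x - l x • b := fun x => rfl
  let E0 : (V × V) ≃ₗ[ℝ] ((LinearMap.ker l × LinearMap.ker l) × (Fin 2 → ℝ)) :=
    LinearEquiv.ofLinearMap
      (LinearMap.prod (LinearMap.prodMap π π) (LinearMap.pi ![l ∘ₗ LinearMap.fst ℝ V V,
        l ∘ₗ LinearMap.snd ℝ V V]))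
      (LinearMap.prod
        ((LinearMap.ker l).subtype ∘ₗ LinearMap.fst ℝ _ _ ∘ₗ LinearMap.fst ℝ _ _ +
          (LinearMap.proj (R := ℝ) (φ := fun _ : Fin 2 => ℝ) 0 ∘ₗ LinearMap.snd ℝ _ _).smulRight b)
        ((LinearMap.ker l).subtype ∘ₗ LinearMap.snd ℝ _ _ ∘ₗ LinearMap.fst ℝ _ _ +
          (LinearMap.proj (R := ℝ) (φ := fun _ : Fin 2 => ℝ) 1 ∘ₗ LinearMap.snd ℝ _ _).smulRight b))
      (by
        apply LinearMap.ext
        rintro ⟨⟨x, y⟩, c⟩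
        have hx : l x.1 = 0 := x.2
        have hy : l y.1 = 0 := y.2
        refine Prod.ext (Prod.ext (Subtype.ext ?_) (Subtype.ext ?_)) (funext fun i => ?_)
        · simp [hπv, hx, hl]
        · simp [hπv, hy, hl]
        · fin_cases i <;> simp [hx, hy, hl])
      (by
        apply LinearMap.ext
        rintro ⟨x, y⟩
        refine Prod.ext ?_ ?_ <;> simp [hπv])
  let E : (V × V) ≃ₗ[ℝ] (Fin (m+3) → ℝ) := E0 ≪≫ₗ
    (LinearEquiv.prodCongr κ (LinearEquiv.refl ℝ (Fin 2 → ℝ))) ≪≫ₗ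
    (LinearEquiv.sumArrowLequivProdArrow (Fin (m+1)) (Fin 2) ℝ ℝ).symm ≪≫ₗ
    (LinearEquiv.funCongrLeft ℝ ℝ (finSumFinEquiv (m := m+1) (n := 2)).symm)
  have Ea : ∀ z (i : Fin (m+1)), E z ⟨i.val, by omega⟩ = κ (π z.1, π z.2) i := by
    intro z i
    have : (finSumFinEquiv (m := m+1) (n := 2)).symm ⟨i.val, by omega⟩ = Sum.inl i := by
      rw [Equiv.symm_apply_eq]; rfl
    simp [E, E0, LinearEquiv.funCongrLeft, LinearMap.funLeft, this]
  have Eb : ∀ z, E z ⟨m+1, by omega⟩ = l z.1 := by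
    intro z
    have : (finSumFinEquiv (m := m+1) (n := 2)).symm ⟨m+1, by omega⟩ = Sum.inr 0 := by
      rw [Equiv.symm_apply_eq]; rfl
    simp [E, E0, LinearEquiv.funCongrLeft, LinearMap.funLeft, this]
  have Ec : ∀ z, E z ⟨m+2, by omega⟩ = l z.2 := by
    intro z
    have : (finSumFinEquiv (m := m+1) (n := 2)).symm ⟨m+2, by omega⟩ = Sum.inr 1 := by
      rw [Equiv.symm_apply_eq]; rfl
    simp [E, E0, LinearEquiv.funCongrLeft, LinearMap.funLeft, this]
  let Φ : Module.End ℝ (V × V) ≃ₐ[ℝ] Matrix (Fin (m+3)) (Fin (m+3)) ℝ :=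
    E.conjAlgEquiv ℝ |>.trans LinearMap.toMatrixAlgEquiv'
  have hΦ : ∀ A z, Φ A *ᵥ E z = E (A z) := by
    intro A z
    simp [Φ, LinearMap.toMatrixAlgEquiv']
  let TT : I × I → (Matrix (Fin (m+3)) (Fin (m+3)) ℝ)ˣ := fun x => Units.map Φ.toMonoidHom (hu x).unit
  have hTT : ∀ x, (TT x).val = Φ (T x) := fun x => rfl
  have hc : Continuous TT := by
    refine mat_units_cont (continuous_matrix fun i j => ?_)
    have : ∀ x, (TT x).val i j = (LinearMap.proj i ∘ₗ E.toLinearMap) (T x (E.symm (Pi.single j 1))) := by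
      intro x
      rw [hTT]
      have := congrFun (hΦ (T x) (E.symm (Pi.single j 1))) i
      simp at this
      simp [this]
    simp only [this]
    exact hT _ _
  refine core m ⟨TT, hc⟩ (fun τ => Units.ext ?_) (fun τ => Units.ext ?_) (fun τ => Units.ext ?_)
    (fun t => Units.ext ?_)
  · simp [hTT, h0]
  · simp [hTT, h1]
  · simp [hTT, h2]
  · show (TT (t, 0)).val = _
    rw [hTT, h3]
    set θ := 2 * Real.pi * (t:ℝ)
    apply Matrix.ext_of_mulVec_single
    intro j
    obtain ⟨z, hz⟩ := E.surjective (Pi.single j 1)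
    rw [← hz, hΦ]
    have hπ : ∀ x (c : ℝ), π (x + c • b) = π x := by
      intro x c
      apply Subtype.ext
      simp [hπv, hl]; try module
    have hv : eX (dg (l.smulRight b)) (dg (l.smulRight b) * KK V) θ z =
        (z.1 + ((Real.cos θ - 1) * l z.1 - Real.sin θ * l z.2) • b,
          z.2 + ((Real.cos θ - 1) * l z.2 + Real.sin θ * l z.1) • b) := by
      simp only [eX]
      refine Prod.ext ?_ ?_ <;> simp <;> module
    rw [hv]
    ext i
    rw [rotN_mulVec]
    split_ifs with c1 c2
    · have := Ea z ⟨i.val, by omega⟩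
      have t2 := Ea (z.1 + ((Real.cos θ - 1) * l z.1 - Real.sin θ * l z.2) • b,
          z.2 + ((Real.cos θ - 1) * l z.2 + Real.sin θ * l z.1) • b) ⟨i.val, by omega⟩
      simp only [hπ] at t2
      exact t2.trans this.symm
    · have : i = ⟨m+1, by omega⟩ := Fin.ext c2
      rw [this, Eb, Eb, Ec]
      simp [hl]; ring
    · have : i = ⟨m+2, by omega⟩ := Fin.ext (by simp; omega)
      rw [this, Eb, Ec, Ec]
      simp [hl]; ring
end

section
open unitInterval Topology Matrix

section
variable {V : Type*} [AddCommGroup V] [Module ℝ V]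

lemma end_mul_neg (a b : Module.End ℝ V) : a * -b = -(a * b) := by
  apply LinearMap.ext; intro x; simp

lemma end_mul_neg_one (a : Module.End ℝ V) : a * -1 = -a := by
  apply LinearMap.ext; intro x; simp

lemma ContEnd.eX {Y : Type*} [TopologicalSpace Y] (p : Module.End ℝ V) {X : Y → Module.End ℝ V}
    (hX : ContEnd X) {θ : Y → ℝ} (hθ : Continuous θ) : ContEnd (fun y => eX p (X y) (θ y)) := by
  unfold _root_.eX
  exact ((ContEnd.const _).add (ContEnd.smul (Real.continuous_cos.comp hθ) (ContEnd.const _))).add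
    (ContEnd.smul (Real.continuous_sin.comp hθ) hX)

/-- null-homotopy of the double loop attached to an idempotent with complex structure -/
theorem even_null [FiniteDimensional ℝ V] (p J : Module.End ℝ V) (hp : p * p = p) (hJ : J * J = -p)
    (h1 : p * J = J) (h2 : J * p = J) :
    ∃ N N' : I × I → Module.End ℝ (V × V), ContEnd N ∧ ContEnd N' ∧ (∀ x, N x * N' x = 1) ∧
      (∀ x, N' x * N x = 1) ∧
      (∀ τ, N (0, τ) = 1) ∧ (∀ τ, N (1, τ) = 1) ∧ (∀ t, N (t, 1) = 1) ∧
      (∀ t : I, N (t, 0) = eX (dg p) (dg p * KK V) (2 * Real.pi * t)) := by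
  let q := dg p
  let X1 : Module.End ℝ (V × V) := dg p * KK V
  let X2 : Module.End ℝ (V × V) := dg J * KS V
  have hq : q * q = q := by simp only [q]; rw [← dg_mul, hp]
  have q1 : q * X1 = X1 := by simp only [q, X1]; rw [← mul_assoc, ← dg_mul, hp]
  have q2 : X1 * q = X1 := by
    simp only [q, X1]; rw [mul_assoc, ← dg_KK, ← mul_assoc, ← dg_mul, hp]
  have q3 : q * X2 = X2 := by simp only [q, X2]; rw [← mul_assoc, ← dg_mul, h1]
  have q4 : X2 * q = X2 := by
    simp only [q, X2]; rw [mul_assoc, ← dg_KS, ← mul_assoc, ← dg_mul, h2]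
  have s1 : X1 * X1 = -q := by
    have : X1 * X1 = (dg p * dg p) * (KK V * KK V) := by
      simp only [X1]
      rw [mul_assoc, ← mul_assoc (KK V), ← dg_KK]; simp only [mul_assoc]
    rw [this, KK_sq, ← dg_mul, hp, end_mul_neg_one]
  have s2 : X2 * X2 = -q := by
    have : X2 * X2 = (dg J * dg J) * (KS V * KS V) := by
      simp only [X2]
      rw [mul_assoc, ← mul_assoc (KS V), ← dg_KS]; simp only [mul_assoc]
    rw [this, KS_sq, ← dg_mul, hJ, mul_one]
    ext x <;> simp [q]
  have s3 : X2 * X1 = -(X1 * X2) := by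
    have e1 : X2 * X1 = (dg J * dg p) * (KS V * KK V) := by
      simp only [X1, X2]
      rw [mul_assoc, ← mul_assoc (KS V), ← dg_KS]; simp only [mul_assoc]
    have e2 : X1 * X2 = (dg p * dg J) * (KK V * KS V) := by
      simp only [X1, X2]
      rw [mul_assoc, ← mul_assoc (KK V), ← dg_KK]; simp only [mul_assoc]
    rw [e1, e2, KS_KK, ← dg_mul, ← dg_mul, h1, h2, end_mul_neg]
  let Y : I → Module.End ℝ (V × V) := fun τ =>
    Real.cos (Real.pi * τ) • X1 + Real.sin (Real.pi * τ) • X2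
  have hY : ContEnd Y := (ContEnd.smul (by fun_prop) (ContEnd.const _)).add
    (ContEnd.smul (by fun_prop) (ContEnd.const _))
  have y1 : ∀ τ, q * Y τ = Y τ := fun τ => by
    simp only [Y, mul_add, mul_smul_comm, q1, q3]
  have y2 : ∀ τ, Y τ * q = Y τ := fun τ => by
    simp only [Y, add_mul, smul_mul_assoc, q2, q4]
  have y3 : ∀ τ, Y τ * Y τ = -q := fun τ => by
    have := Real.cos_sq_add_sin_sq (Real.pi * τ)
    simp only [Y, add_mul, mul_add, smul_mul_assoc, mul_smul_comm, s1, s2, s3]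
    generalize Real.cos (Real.pi * τ) = c at *
    generalize Real.sin (Real.pi * τ) = s at *
    have e : -q = (c^2 + s^2) • -q := by rw [this, one_smul]
    refine Eq.trans ?_ e.symm
    module
  have inv1 : ∀ θ, eX q X1 θ * eX q X1 (-θ) = 1 := fun θ => by
    rw [eX_mul hq s1 q1 q2]; simp [eX_zero]
  have inv1' : ∀ θ, eX q X1 (-θ) * eX q X1 θ = 1 := fun θ => by
    rw [eX_mul hq s1 q1 q2]; simp [eX_zero]
  have inv2 : ∀ τ θ, eX q (Y τ) θ * eX q (Y τ) (-θ) = 1 := fun τ θ => by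
    rw [eX_mul hq (y3 τ) (y1 τ) (y2 τ)]; simp [eX_zero]
  have inv2' : ∀ τ θ, eX q (Y τ) (-θ) * eX q (Y τ) θ = 1 := fun τ θ => by
    rw [eX_mul hq (y3 τ) (y1 τ) (y2 τ)]; simp [eX_zero]
  refine ⟨fun x => eX q X1 (Real.pi * x.1) * eX q (Y x.2) (Real.pi * x.1),
    fun x => eX q (Y x.2) (-(Real.pi * x.1)) * eX q X1 (-(Real.pi * x.1)), ?_, ?_, ?_, ?_, ?_, ?_,
    ?_, ?_⟩
  · exact ((ContEnd.const _).eX _ (by fun_prop)).mul ((hY.precomp continuous_snd).eX _ (by fun_prop))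
  · exact ((hY.precomp continuous_snd).eX _ (by fun_prop)).mul ((ContEnd.const _).eX _ (by fun_prop))
  · intro x
    rw [mul_assoc, ← mul_assoc (eX q (Y x.2) _), inv2, one_mul, inv1]
  · intro x
    rw [mul_assoc, ← mul_assoc (eX q X1 _), inv1', one_mul, inv2']
  · intro τ; simp [eX_zero]
  · intro τ
    have : ∀ X, eX q X (Real.pi * (1:I)) = 1 - q - q := by
      intro X; simp [eX, sub_eq_add_neg]
    simp only [this, sub_mul, mul_sub, one_mul, mul_one, hq]
    abel
  · intro t
    have : Y 1 = -X1 := by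
      simp only [Y, Set.Icc.coe_one, mul_one, Real.cos_pi, Real.sin_pi]; module
    simp only [this, eX_neg, inv1]
  · intro t
    have : Y 0 = X1 := by simp [Y]
    simp only [this]
    rw [eX_mul hq s1 q1 q2]
    congr 1; ring

/-- The loop `P e^{K θ} + (1-P) e^{-K θ}` -/
noncomputable def Lp (p : Module.End ℝ V) (θ : ℝ) : Module.End ℝ (V × V) :=
  Real.cos θ • 1 + Real.sin θ • (KK V * (dg p + dg p - 1))

lemma Lp_mul_E (p : Module.End ℝ V) (θ : ℝ) :
    Lp p θ * (Real.cos θ • 1 + Real.sin θ • KK V) = eX (dg p) (dg p * KK V) (2 * θ) := by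
  have h : KK V * (dg p + dg p - 1) * KK V = -(dg p + dg p - 1) := by
    have : KK V * (dg p + dg p - 1) = (dg p + dg p - 1) * KK V := by
      simp only [mul_sub, sub_mul, mul_add, add_mul, dg_KK]; simp
    rw [this, mul_assoc, KK_sq, end_mul_neg_one]
  have h2 : KK V * (dg p + dg p - 1) = dg p * KK V + dg p * KK V - KK V := by
      simp only [mul_sub, mul_add, dg_KK]; simp
  simp only [Lp, eX, Real.cos_two_mul', Real.sin_two_mul, add_mul, mul_add, smul_mul_assoc,
    mul_smul_comm, h, one_mul, mul_one]
  rw [h2]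
  have hsc := Real.cos_sq_add_sin_sq θ
  generalize Real.cos θ = c at *
  generalize Real.sin θ = s at *
  have : (1 : Module.End ℝ (V × V)) - dg p = (c^2+s^2) • (1 - dg p) := by rw [hsc, one_smul]
  rw [this]
  module

lemma Lp_inv (p : Module.End ℝ V) (hp : p * p = p) (θ : ℝ) : Lp p (-θ) * Lp p θ = 1 := by
  have hq : dg p * dg p = dg p := by rw [← dg_mul, hp]
  set Z := KK V * (dg p + dg p - 1) with hZ
  have h1 : KK V * (dg p + dg p - 1) = (dg p + dg p - 1) * KK V := by
      simp only [mul_sub, sub_mul, mul_add, add_mul, dg_KK]; simp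
  have : Z * Z = -1 := by
    have : Z * Z = ((dg p + dg p - 1) * (dg p + dg p - 1)) * (-1) := by
      rw [← KK_sq, hZ]
      nth_rewrite 2 [h1]
      rw [h1]
      nth_rewrite 1 [← h1]
      generalize dg p + dg p - 1 = a at *
      rw [h1, mul_assoc, ← mul_assoc (KK V), h1]
      simp only [mul_assoc]
    rw [this]
    have : (dg p + dg p - 1) * (dg p + dg p - 1) = 1 := by
      simp only [mul_sub, sub_mul, mul_add, add_mul, hq, mul_one, one_mul]; abel
    rw [this, end_mul_neg_one]
  simp only [Lp, Real.cos_neg, Real.sin_neg, ← hZ, add_mul, mul_add, smul_mul_assoc,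
    mul_smul_comm, one_mul, mul_one, this]
  have hsc := Real.cos_sq_add_sin_sq θ
  generalize Real.cos θ = c at *
  generalize Real.sin θ = s at *
  have e : (1 : Module.End ℝ (V × V)) = (c^2+s^2) • 1 := by rw [hsc, one_smul]
  refine Eq.trans ?_ e.symm
  module

theorem core_final [FiniteDimensional ℝ V]
    (hV : 2 ≤ Module.finrank ℝ V) (p p0 J0 : Module.End ℝ V) (hp : p * p = p)
    (hodd : Odd (Module.finrank ℝ (LinearMap.range p))) (hp0 : p0 * p0 = p0) (hJ0 : J0 * J0 = -p0)
    (hJ1 : p0 * J0 = J0) (hJ2 : J0 * p0 = J0)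
    (T : I × I → Module.End ℝ (V × V)) (hT : ContEnd T) (hu : ∀ x, IsUnit (T x))
    (h0 : ∀ τ, T (0, τ) = 1) (h1 : ∀ τ, T (1, τ) = 1) (h2 : ∀ t, T (t, 1) = 1)
    (h3 : ∀ t : I, T (t, 0) = Lp p (Real.pi * t) * Lp p0 (-(Real.pi * t))) :
    False := by
  obtain ⟨r, hr⟩ := hodd
  let e : LinearMap.range p ≃ₗ[ℝ] (ℝ × (Fin r → ℝ) × (Fin r → ℝ)) :=
    LinearEquiv.ofFinrankEq _ _ (by rw [hr]; simp; omega)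
  let i : (ℝ × (Fin r → ℝ) × (Fin r → ℝ)) →ₗ[ℝ] V := (LinearMap.range p).subtype ∘ₗ e.symm.toLinearMap
  let q : V →ₗ[ℝ] (ℝ × (Fin r → ℝ) × (Fin r → ℝ)) := e.toLinearMap ∘ₗ p.rangeRestrict
  have hpp : ∀ x, p (p x) = p x := fun x => LinearMap.congr_fun hp x
  have hqi : ∀ x, q (i x) = x := by
    intro x
    have : p.rangeRestrict (e.symm x).1 = e.symm x := by
      apply Subtype.ext
      obtain ⟨y, hy⟩ := (e.symm x).2
      show p (e.symm x).1 = (e.symm x).1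
      rw [← hy, hpp]
    simp [q, i, this]
  have hiq : ∀ x, i (q x) = p x := by
    intro x; simp [q, i]
  let j1 : Module.End ℝ (ℝ × (Fin r → ℝ) × (Fin r → ℝ)) := LinearMap.prodMap 0 LinearMap.id
  let jJ : Module.End ℝ (ℝ × (Fin r → ℝ) × (Fin r → ℝ)) := LinearMap.prodMap 0
    (LinearMap.prod (-LinearMap.snd ℝ _ _) (LinearMap.fst ℝ _ _))
  let p' : Module.End ℝ V := i ∘ₗ j1 ∘ₗ q
  let J' : Module.End ℝ V := i ∘ₗ jJ ∘ₗ q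
  let b : V := i (1, 0)
  let l : V →ₗ[ℝ] ℝ := LinearMap.fst ℝ _ _ ∘ₗ q
  have hl : l b = 1 := by simp [l, b, hqi]
  let p1 : Module.End ℝ V := l.smulRight b
  have hsum : p' + p1 = p := by
    apply LinearMap.ext; intro x
    have : i (j1 (q x)) + (q x).1 • i (1, 0) = i (q x) := by
      rw [← map_smul, ← map_add]
      congr 1
      refine Prod.ext ?_ ?_ <;> simp [j1]
    rw [← hiq, ← this]; rfl
  have c1 : p' * p' = p' := by
    apply LinearMap.ext; intro x
    show i (j1 (q (i (j1 (q x))))) = i (j1 (q x))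
    rw [hqi]; rfl
  have c2 : J' * J' = -p' := by
    apply LinearMap.ext; intro x
    show i (jJ (q (i (jJ (q x))))) = -i (j1 (q x))
    rw [hqi, ← map_neg]
    congr 1
    refine Prod.ext ?_ (Prod.ext ?_ ?_) <;> simp [j1, jJ]
  have c3 : p' * J' = J' := by
    apply LinearMap.ext; intro x
    show i (j1 (q (i (jJ (q x))))) = i (jJ (q x))
    rw [hqi]; congr 1
  have c4 : J' * p' = J' := by
    apply LinearMap.ext; intro x
    show i (jJ (q (i (j1 (q x))))) = i (jJ (q x))
    rw [hqi]; rfl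
  have c5 : p' * p1 = 0 := by
    apply LinearMap.ext; intro x
    show i (j1 (q ((q x).1 • i (1, 0)))) = 0
    rw [map_smul, hqi]
    have : j1 ((q x).1 • ((1 : ℝ), (0 : (Fin r → ℝ) × (Fin r → ℝ)))) = 0 := by
      refine Prod.ext ?_ ?_ <;> simp [j1]
    rw [this, map_zero]
  obtain ⟨N, N', hN, hN', n1, n2, n3, n4, n5, n6⟩ := even_null p' J' c1 c2 c3 c4
  obtain ⟨M, M', hM, hM', m1, m2, m3, m4, m5, m6⟩ := even_null p0 J0 hp0 hJ0 hJ1 hJ2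
  have one' : ∀ x, N x = 1 → N' x = 1 := fun x hx => by
    have := n1 x; rwa [hx, one_mul] at this
  refine core_lin hV b l hl (fun x => N' x * T x * M x) ((hN'.mul hT).mul hM) ?_ ?_ ?_ ?_ ?_
  · intro x
    refine IsUnit.mul (IsUnit.mul ?_ (hu x)) ?_
    · exact ⟨⟨N' x, N x, n2 x, n1 x⟩, rfl⟩
    · exact ⟨⟨M x, M' x, m1 x, m2 x⟩, rfl⟩
  · intro τ; simp [one' _ (n3 τ), h0, m3]
  · intro τ; simp [one' _ (n4 τ), h1, m4]
  · intro τ; simp [one' _ (n5 τ), h2, m5]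
  · intro t
    have e1 : T (t, 0) * M (t, 0) = eX (dg p) (dg p * KK V) (2 * Real.pi * t) := by
      rw [h3, m6, mul_assoc 2, ← Lp_mul_E, mul_assoc, ← mul_assoc (Lp p0 _), Lp_inv _ hp0, one_mul,
        Lp_mul_E]
    have e2 : eX (dg p) (dg p * KK V) (2 * Real.pi * t) = N (t, 0) *
        eX (dg p1) (dg p1 * KK V) (2 * Real.pi * t) := by
      have z : dg p' * dg p1 = 0 := by rw [← dg_mul, c5]; ext x <;> simp
      rw [n6, eX_comm z]
      · have : dg p' + dg p1 = dg p := by rw [← hsum]; ext x <;> simp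
        rw [← add_mul, this]
      · rw [← mul_assoc, z, zero_mul]
      · rw [mul_assoc, ← dg_KK, ← mul_assoc, z, zero_mul]
      · rw [mul_assoc, ← mul_assoc (KK V), ← dg_KK, mul_assoc, ← mul_assoc (dg p'), z, zero_mul]
    show N' (t, 0) * T (t, 0) * M (t, 0) = _
    rw [mul_assoc, e1, e2, ← mul_assoc, n2, one_mul]
end
end

section
open unitInterval Topology Matrix

theorem correct_boundary {U Z : Type*} [AddCommGroup U] [Module ℝ U] [FiniteDimensional ℝ U]
    [AddCommGroup Z] [Module ℝ Z] (n : Seminorm ℝ Z) (ψ : U →ₗ[ℝ] Z) (hψ : ∀ ξ, n (ψ ξ) = 0 → ξ = 0)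
    (H : I × I → Z → Z) (T : I × I → Module.End ℝ U) (L : I → Module.End ℝ U)
    (hT : ContEnd T) (hL : ContEnd L) (ε C : ℝ) (hε : 0 < ε)
    (hTH : ∀ x ξ, n (ψ (T x ξ) - H x (ψ ξ)) ≤ ε * n (ψ ξ))
    (hLH : ∀ t ξ, n (ψ (L t ξ) - H (t, 0) (ψ ξ)) ≤ ε * n (ψ ξ))
    (H0 : ∀ τ z, H (0, τ) z = z) (H1 : ∀ τ z, H (1, τ) z = z) (H2 : ∀ t z, H (t, 1) z = z)
    (L0 : L 0 = 1) (L1 : L 1 = 1) (hC : ∀ x z, n z ≤ C * n (H x z)) (hC0 : 0 ≤ C)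
    (hCε : C * (10 * ε) < 1) :
    ∃ T' : I × I → Module.End ℝ U, ContEnd T' ∧ (∀ x, IsUnit (T' x)) ∧ (∀ τ, T' (0, τ) = 1) ∧
      (∀ τ, T' (1, τ) = 1) ∧ (∀ t, T' (t, 1) = 1) ∧ (∀ t, T' (t, 0) = L t) := by
  let T1 : I × I → Module.End ℝ U := fun x => T x - (1 - (x.1:ℝ)) • (T (0, x.2) - 1) -
    (x.1:ℝ) • (T (1, x.2) - 1)
  have cT1 : ContEnd T1 := (hT.sub (ContEnd.smul (by fun_prop)
    ((hT.precomp (f := fun x : I × I => ((0:I), x.2)) (by fun_prop)).sub (ContEnd.const _)))).sub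
    (ContEnd.smul (by fun_prop)
    ((hT.precomp (f := fun x : I × I => ((1:I), x.2)) (by fun_prop)).sub (ContEnd.const _)))
  have T10 : ∀ τ, T1 (0, τ) = 1 := fun τ => by simp [T1]
  have T11 : ∀ τ, T1 (1, τ) = 1 := fun τ => by simp [T1]
  have sm : ∀ (r : I) (z : Z) (B : ℝ), n z ≤ B → n ((r:ℝ) • z) ≤ B := by
    intro r z B h
    rw [map_smul_eq_mul, Real.norm_of_nonneg r.2.1]
    nlinarith [r.2.1, r.2.2, apply_nonneg n z]
  have tri : ∀ (a b c : Z) (A B D : ℝ), n a ≤ A → n b ≤ B → n c ≤ D → n (a - b - c) ≤ A + B + D := by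
    intro a b c A B D h1 h2 h3
    have := map_sub_le_add n (a - b) c
    have := map_sub_le_add n a b
    linarith
  have hT1 : ∀ x ξ, n (ψ (T1 x ξ) - H x (ψ ξ)) ≤ (3 * ε) * n (ψ ξ) := by
    intro x ξ
    have e : ψ (T1 x ξ) - H x (ψ ξ) = (ψ (T x ξ) - H x (ψ ξ)) -
        ((σ x.1 : I) : ℝ) • (ψ (T (0, x.2) ξ) - H (0, x.2) (ψ ξ)) -
        ((x.1 : I) : ℝ) • (ψ (T (1, x.2) ξ) - H (1, x.2) (ψ ξ)) := by
      rw [H0, H1]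
      simp [T1]; module
    rw [e]
    have := tri _ _ _ _ _ _ (hTH x ξ) (sm (σ x.1) _ _ (hTH (0, x.2) ξ)) (sm x.1 _ _ (hTH (1, x.2) ξ))
    linarith
  let T2 : I × I → Module.End ℝ U := fun x => T1 x - (1 - (x.2:ℝ)) • (T1 (x.1, 0) - L x.1) -
    (x.2:ℝ) • (T1 (x.1, 1) - 1)
  have cT2 : ContEnd T2 := (cT1.sub (ContEnd.smul (by fun_prop)
    ((cT1.precomp (f := fun x : I × I => (x.1, (0:I))) (by fun_prop)).sub
      (hL.precomp continuous_fst)))).sub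
    (ContEnd.smul (by fun_prop)
    ((cT1.precomp (f := fun x : I × I => (x.1, (1:I))) (by fun_prop)).sub (ContEnd.const _)))
  have hT2 : ∀ x ξ, n (ψ (T2 x ξ) - H x (ψ ξ)) ≤ (10 * ε) * n (ψ ξ) := by
    intro x ξ
    have e : ψ (T2 x ξ) - H x (ψ ξ) = (ψ (T1 x ξ) - H x (ψ ξ)) -
        ((σ x.2 : I) : ℝ) • ((ψ (T1 (x.1, 0) ξ) - H (x.1, 0) (ψ ξ)) -
          (ψ (L x.1 ξ) - H (x.1, 0) (ψ ξ)) - (0 : Z)) -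
        ((x.2 : I) : ℝ) • (ψ (T1 (x.1, 1) ξ) - H (x.1, 1) (ψ ξ)) := by
      rw [H2]
      simp [T2]; module
    rw [e]
    have := tri _ _ _ _ _ _ (hT1 x ξ) (sm (σ x.2) _ _ (tri _ _ _ _ _ _ (hT1 (x.1, 0) ξ) (hLH x.1 ξ)
      (map_zero n).le)) (sm x.2 _ _ (hT1 (x.1, 1) ξ))
    linarith
  refine ⟨T2, cT2, ?_, ?_, ?_, ?_, ?_⟩
  · intro x
    rw [LinearMap.isUnit_iff_ker_eq_bot, LinearMap.ker_eq_bot']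
    intro ξ h
    apply hψ
    have a1 := hT2 x ξ
    rw [h, map_zero, zero_sub, map_neg_eq_map] at a1
    have a2 := hC x (ψ ξ)
    have a3 := apply_nonneg n (ψ ξ)
    have a4 : C * n (H x (ψ ξ)) ≤ C * ((10 * ε) * n (ψ ξ)) := mul_le_mul_of_nonneg_left a1 hC0
    nlinarith
  · intro τ; simp [T2, T10, L0]
  · intro τ; simp [T2, T11, L1]
  · intro τ; simp [T2]
  · intro τ; simp [T2]
end

section
open unitInterval Topology Matrix Quaternion

structure QD {Ω : Type} [TopologicalSpace Ω] [CompactSpace Ω] (v : Fin 2 → C(Ω, ℍ[ℝ]))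
    (N : Seminorm ℝ C(Ω, ℍ[ℝ])) where
  W : Type
  [i1 : AddCommGroup W]
  [i2 : Module ℝ W]
  [i3 : FiniteDimensional ℝ W]
  φ : W →ₗ[ℝ] C(Ω, ℍ[ℝ])
  φ_inj : ∀ α, N (φ α) = 0 → α = 0
  Q : ℍ[ℝ] → Module.End ℝ W
  hQ : ∀ q α, φ (Q q α) = ContinuousMap.const Ω q * φ α
  A : Fin 2 → Fin 2 → Module.End ℝ W
  idem : ∀ a c, ∑ b, A a b * A b c = A a c
  δ : ℝ
  hA : ∀ a b α, N (φ (A a b α) - v a * star (v b) * φ α) ≤ δ * N (φ α)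
  odd : Odd (Module.finrank ℝ (LinearMap.range
    (LinearMap.pi fun a => ∑ b, A a b ∘ₗ LinearMap.proj b : Module.End ℝ (Fin 2 → W))))
  two : 1 ≤ Module.finrank ℝ W

attribute [instance] QD.i1 QD.i2 QD.i3

section
variable {Ω : Type} [TopologicalSpace Ω] [CompactSpace Ω] (v : Fin 2 → C(Ω, ℍ[ℝ]))
    (N : Seminorm ℝ C(Ω, ℍ[ℝ]))

def Appr (Φ : C((I × I) × Ω, ℍ[ℝ])) : Prop :=
  ∀ ε : ℝ, 0 < ε → ∃ δ : ℝ, 0 < δ ∧ ∀ D : QD v N, D.δ ≤ δ → ∃ A : I × I → Module.End ℝ D.W,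
    ContEnd A ∧ ∀ κ α, N (D.φ (A κ α) - Φ.curry κ * D.φ α) ≤ ε * N (D.φ α)

variable {v N} 

lemma curry_norm_le (Φ : C((I × I) × Ω, ℍ[ℝ])) (κ : I × I) : ‖Φ.curry κ‖ ≤ ‖Φ‖ := by
  rw [ContinuousMap.norm_le _ (norm_nonneg _)]
  intro x
  exact Φ.norm_coe_le_norm (κ, x)

lemma Appr.add {Φ Ψ : C((I × I) × Ω, ℍ[ℝ])} (h1 : Appr v N Φ) (h2 : Appr v N Ψ) :
    Appr v N (Φ + Ψ) := by
  intro ε hε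
  obtain ⟨d1, hd1, H1⟩ := h1 (ε/2) (by positivity)
  obtain ⟨d2, hd2, H2⟩ := h2 (ε/2) (by positivity)
  refine ⟨min d1 d2, lt_min hd1 hd2, fun D hD => ?_⟩
  obtain ⟨A, cA, hA⟩ := H1 D (hD.trans (min_le_left _ _))
  obtain ⟨B, cB, hB⟩ := H2 D (hD.trans (min_le_right _ _))
  refine ⟨_, cA.add cB, fun κ α => ?_⟩
  have e : D.φ ((A κ + B κ) α) - (Φ + Ψ).curry κ * D.φ α = (D.φ (A κ α) - Φ.curry κ * D.φ α) +
      (D.φ (B κ α) - Ψ.curry κ * D.φ α) := by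
    have : (Φ + Ψ).curry κ = Φ.curry κ + Ψ.curry κ := rfl
    rw [this, LinearMap.add_apply, map_add]; noncomm_ring
  rw [e]
  have := map_add_le_add N (D.φ (A κ α) - Φ.curry κ * D.φ α) (D.φ (B κ α) - Ψ.curry κ * D.φ α)
  linarith [hA κ α, hB κ α]

lemma Appr.mul (hN : ∀ g f, N (g * f) ≤ ‖g‖ * N f)
    {Φ Ψ : C((I × I) × Ω, ℍ[ℝ])} (h1 : Appr v N Φ) (h2 : Appr v N Ψ) :
    Appr v N (Φ * Ψ) := by
  intro ε hε
  have p1 : 0 < ‖Φ‖ + 1 := by positivity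
  have p2 : 0 < ‖Ψ‖ + 1 := by positivity
  obtain ⟨d1, hd1, H1⟩ := h1 (ε/(2 * (‖Ψ‖ + 1))) (by positivity)
  obtain ⟨d2, hd2, H2⟩ := h2 (min 1 (ε/(2*(‖Φ‖ + 1)))) (by positivity)
  refine ⟨min d1 d2, lt_min hd1 hd2, fun D hD => ?_⟩
  obtain ⟨A, cA, hA⟩ := H1 D (hD.trans (min_le_left _ _))
  obtain ⟨B, cB, hB⟩ := H2 D (hD.trans (min_le_right _ _))
  refine ⟨_, cA.mul cB, fun κ α => ?_⟩
  have e : D.φ ((A κ * B κ) α) - (Φ * Ψ).curry κ * D.φ α =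
      (D.φ (A κ (B κ α)) - Φ.curry κ * D.φ (B κ α)) +
      Φ.curry κ * (D.φ (B κ α) - Ψ.curry κ * D.φ α) := by
    have : (Φ * Ψ).curry κ = Φ.curry κ * Ψ.curry κ := rfl
    rw [this, Module.End.mul_apply]; noncomm_ring
  rw [e]
  have n0 := apply_nonneg N (D.φ α)
  have t1 := map_add_le_add N (D.φ (A κ (B κ α)) - Φ.curry κ * D.φ (B κ α))
    (Φ.curry κ * (D.φ (B κ α) - Ψ.curry κ * D.φ α))
  have t2 := hN (Φ.curry κ) (D.φ (B κ α) - Ψ.curry κ * D.φ α)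
  have t3 := hA κ (B κ α)
  have t4 := hB κ α
  have t5 : N (D.φ (B κ α)) ≤ (‖Ψ‖ + 1) * N (D.φ α) := by
    have u1 := map_add_le_add N (D.φ (B κ α) - Ψ.curry κ * D.φ α) (Ψ.curry κ * D.φ α)
    rw [sub_add_cancel] at u1
    have u2 := hN (Ψ.curry κ) (D.φ α)
    have u3 := mul_le_mul_of_nonneg_right (curry_norm_le Ψ κ) n0
    have u4 := mul_le_mul_of_nonneg_right (min_le_left (1:ℝ) (ε/(2*(‖Φ‖ + 1)))) n0
    linarith
  have t6 : N (D.φ (B κ α) - Ψ.curry κ * D.φ α) ≤ (ε/(2*(‖Φ‖ + 1))) * N (D.φ α) :=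
    t4.trans (mul_le_mul_of_nonneg_right (min_le_right _ _) n0)
  have t7 : ‖Φ.curry κ‖ * N (D.φ (B κ α) - Ψ.curry κ * D.φ α) ≤
      (‖Φ‖ + 1) * ((ε/(2*(‖Φ‖ + 1))) * N (D.φ α)) :=
    mul_le_mul ((curry_norm_le Φ κ).trans (by linarith)) t6 (apply_nonneg _ _) p1.le
  have t8 : (ε/(2 * (‖Ψ‖ + 1))) * N (D.φ (B κ α)) ≤
      (ε/(2 * (‖Ψ‖ + 1))) * ((‖Ψ‖ + 1) * N (D.φ α)) := by gcongr
  have e1 : (‖Φ‖ + 1) * ((ε/(2*(‖Φ‖ + 1))) * N (D.φ α)) = ε / 2 * N (D.φ α) := by field_simp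
  have e2 : (ε/(2 * (‖Ψ‖ + 1))) * ((‖Ψ‖ + 1) * N (D.φ α)) = ε / 2 * N (D.φ α) := by field_simp
  linarith

lemma Appr.const (q : ℍ[ℝ]) : Appr v N (ContinuousMap.const _ q) := by
  intro ε hε
  refine ⟨1, one_pos, fun D _ => ⟨_, ContEnd.const (D.Q q), fun κ α => ?_⟩⟩
  have : (ContinuousMap.const ((I × I) × Ω) q).curry κ = ContinuousMap.const Ω q := rfl
  rw [D.hQ, this, sub_self, map_zero]
  exact mul_nonneg hε.le (apply_nonneg _ _)

lemma Appr.fun1 (g : C(I × I, ℝ)) :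
    Appr v N ⟨fun x => ((g x.1 : ℝ) : ℍ[ℝ]), Quaternion.continuous_coe.comp (g.continuous.comp continuous_fst)⟩ := by
  intro ε hε
  refine ⟨1, one_pos, fun D _ => ⟨_, ContEnd.smul g.continuous (ContEnd.const 1), fun κ α => ?_⟩⟩
  have : D.φ ((g κ • (1 : Module.End ℝ D.W)) α) =
      (ContinuousMap.curry (⟨fun x => ((g x.1 : ℝ) : ℍ[ℝ]), Quaternion.continuous_coe.comp (g.continuous.comp continuous_fst)⟩ : C((I × I) × Ω, ℍ[ℝ]))) κ
        * D.φ α := by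
    ext1 ω
    simp [← Quaternion.coe_mul_eq_smul]
  rw [this, sub_self, map_zero]
  exact mul_nonneg hε.le (apply_nonneg _ _)

lemma Appr.vv (a b : Fin 2) : Appr v N ((v a * star (v b)).comp ⟨Prod.snd, continuous_snd⟩) := by
  intro ε hε
  refine ⟨ε, hε, fun D hD => ⟨_, ContEnd.const (D.A a b), fun κ α => ?_⟩⟩
  exact (D.hA a b α).trans (mul_le_mul_of_nonneg_right hD (apply_nonneg _ _))

lemma Appr.closed (hN : ∀ g f, N (g * f) ≤ ‖g‖ * N f) : IsClosed {Φ | Appr v N Φ} := by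
  rw [← closure_subset_iff_isClosed]
  intro Φ hΦ ε hε
  rw [Metric.mem_closure_iff] at hΦ
  obtain ⟨Ψ, hΨ, hd⟩ := hΦ (ε/2) (by positivity)
  obtain ⟨d1, hd1, H1⟩ := hΨ (ε/2) (by positivity)
  refine ⟨d1, hd1, fun D hD => ?_⟩
  obtain ⟨A, cA, hA⟩ := H1 D hD
  refine ⟨A, cA, fun κ α => ?_⟩
  have e : D.φ (A κ α) - Φ.curry κ * D.φ α = (D.φ (A κ α) - Ψ.curry κ * D.φ α) -
      ((Φ - Ψ).curry κ * D.φ α) := by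
    have : (Φ - Ψ).curry κ = Φ.curry κ - Ψ.curry κ := rfl
    rw [this]; noncomm_ring
  rw [e]
  have n0 := apply_nonneg N (D.φ α)
  have t := map_sub_le_add N (D.φ (A κ α) - Ψ.curry κ * D.φ α) ((Φ - Ψ).curry κ * D.φ α)
  have t2 := hN ((Φ - Ψ).curry κ) (D.φ α)
  rw [dist_eq_norm] at hd
  have t3 := mul_le_mul_of_nonneg_right ((curry_norm_le (Φ - Ψ) κ).trans hd.le) n0
  linarith [hA κ α]

variable (v N) in
/-- the subalgebra of approximable functions -/
def ApprAlg (hN : ∀ g f, N (g * f) ≤ ‖g‖ * N f) : Subalgebra ℝ C((I × I) × Ω, ℍ[ℝ]) where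
  carrier := {Φ | Appr v N Φ}
  mul_mem' h1 h2 := Appr.mul hN h1 h2
  add_mem' h1 h2 := Appr.add h1 h2
  algebraMap_mem' r := by
    have := Appr.const (v := v) (N := N) (r : ℍ[ℝ])
    exact this

/-- the point of the 5-sphere attached to a unit vector -/
noncomputable def cpt (w : ℍ[ℝ] × ℍ[ℝ]) (t : ℝ) : EuclideanSpace ℝ (Fin 6) :=
  !₂[Real.cos (Real.pi * t), Real.sin (Real.pi * t) * (2 * (w.1 * star w.1).re - 1),
    Real.sin (Real.pi * t) * (2 * (w.1 * star w.2).re), Real.sin (Real.pi * t) * (2 * (w.1 * star w.2).imI),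
    Real.sin (Real.pi * t) * (2 * (w.1 * star w.2).imJ), Real.sin (Real.pi * t) * (2 * (w.1 * star w.2).imK)]

lemma cpt_mem (w : ℍ[ℝ] × ℍ[ℝ]) (hw : Quaternion.normSq w.1 + Quaternion.normSq w.2 = 1) (t : ℝ) :
    cpt w t ∈ Metric.sphere (0 : EuclideanSpace ℝ (Fin (5 + 1))) 1 := by
  rw [mem_sphere_zero_iff_norm, EuclideanSpace.norm_eq, Real.sqrt_eq_one]
  have h1 : (w.1 * star w.1).re = normSq w.1 := by rw [Quaternion.self_mul_star]; simp
  have h2 : normSq (w.1 * star w.2) = normSq w.1 * normSq w.2 := by simp [normSq_star]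
  rw [Quaternion.normSq_def'] at h2
  simp only [Real.norm_eq_abs, sq_abs, Fin.sum_univ_succ]
  simp [cpt, h1] 
  have := Real.sin_sq_add_cos_sq (Real.pi * t)
  have e2 : normSq w.2 = 1 - normSq w.1 := by linarith
  rw [e2] at h2
  simp only [re_mul, imI_mul, imJ_mul, imK_mul, re_star, imI_star, imJ_star, imK_star] at h2
  linear_combination this + 4 * Real.sin (Real.pi * t)^2 * h2

lemma cpt_continuous : Continuous fun x : (ℍ[ℝ] × ℍ[ℝ]) × ℝ => cpt x.1 x.2 := by
  unfold cpt
  have c1 : Continuous fun x : (ℍ[ℝ] × ℍ[ℝ]) × ℝ => x.1.1 * star x.1.1 := by fun_prop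
  have c2 : Continuous fun x : (ℍ[ℝ] × ℍ[ℝ]) × ℝ => x.1.1 * star x.1.2 := by fun_prop
  have d1 := Quaternion.continuous_re.comp c1
  have d2 := Quaternion.continuous_re.comp c2
  have d3 := Quaternion.continuous_imI.comp c2
  have d4 := Quaternion.continuous_imJ.comp c2
  have d5 := Quaternion.continuous_imK.comp c2
  simp only [Function.comp_def] at d1 d2 d3 d4 d5
  have cs : Continuous fun x : (ℍ[ℝ] × ℍ[ℝ]) × ℝ => Real.sin (Real.pi * x.2) := by fun_prop
  apply (PiLp.continuous_toLp 2 _).comp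
  refine continuous_pi fun i => ?_
  fin_cases i
  · exact (by fun_prop : Continuous fun x : (ℍ[ℝ] × ℍ[ℝ]) × ℝ => Real.cos (Real.pi * x.2))
  · exact cs.mul ((continuous_const.mul d1).sub continuous_const)
  · exact cs.mul (continuous_const.mul d2)
  · exact cs.mul (continuous_const.mul d3)
  · exact cs.mul (continuous_const.mul d4)
  · exact cs.mul (continuous_const.mul d5)

lemma Psi_cont_aux : Continuous fun x : (I × I) × Ω =>
    cpt (v 0 x.2, v 1 x.2) (x.1.1 : ℝ) := by
  have h : Continuous fun x : (I × I) × Ω => (((v 0 x.2, v 1 x.2), (x.1.1 : ℝ)) : (ℍ[ℝ] × ℍ[ℝ]) × ℝ) := by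
    fun_prop
  have := cpt_continuous.comp h
  simpa only [Function.comp_def] using this

/-- the map to S5 x I -/
noncomputable def Psi (hv : ∀ ω, Quaternion.normSq (v 0 ω) + Quaternion.normSq (v 1 ω) = 1) :
    C((I × I) × Ω, unitSphere 5 × I) :=
  ⟨fun x => (⟨cpt (v 0 x.2, v 1 x.2) x.1.1, cpt_mem (v 0 x.2, v 1 x.2) (hv x.2) _⟩, x.1.2),
    (Psi_cont_aux.subtype_mk _).prodMk (continuous_snd.comp continuous_fst)⟩

noncomputable def PsiHom (hv : ∀ ω, Quaternion.normSq (v 0 ω) + Quaternion.normSq (v 1 ω) = 1) :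
    C(unitSphere 5 × I, ℝ) →ₐ[ℝ] C((I × I) × Ω, ℍ[ℝ]) :=
  (AlgHom.compLeftContinuous ℝ (Algebra.ofId ℝ ℍ[ℝ]) Quaternion.continuous_coe).comp
    (ContinuousMap.compRightAlgHom ℝ ℝ (Psi hv))

lemma PsiHom_apply (hv : ∀ ω, Quaternion.normSq (v 0 ω) + Quaternion.normSq (v 1 ω) = 1)
    (F : C(unitSphere 5 × I, ℝ)) (x) : PsiHom hv F x = ((F (Psi hv x) : ℝ) : ℍ[ℝ]) := rfl

lemma PsiHom_cont (hv : ∀ ω, Quaternion.normSq (v 0 ω) + Quaternion.normSq (v 1 ω) = 1) :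
    Continuous (PsiHom hv) := by
  have h1 := ContinuousMap.continuous_precomp (Z := ℝ) (Psi hv)
  have h2 := ContinuousMap.continuous_postcomp (X := (I × I) × Ω)
    (⟨fun r : ℝ => (r : ℍ[ℝ]), Quaternion.continuous_coe⟩ : C(ℝ, ℍ[ℝ]))
  exact h2.comp h1

lemma re_eq_half (q : ℍ[ℝ]) : ((q.re : ℝ) : ℍ[ℝ]) = ((1/2 : ℝ) : ℍ[ℝ]) * (q + star q) := by
  have h : (2:ℝ) * (1/2) = 1 := by norm_num
  generalize (1/2 : ℝ) = r at h
  ext <;> simp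
  linear_combination -q.re * h

theorem appr_real (hN : ∀ g f, N (g * f) ≤ ‖g‖ * N f)
    (hv : ∀ ω, Quaternion.normSq (v 0 ω) + Quaternion.normSq (v 1 ω) = 1)
    (F : C(unitSphere 5 × I, ℝ)) : PsiHom hv F ∈ ApprAlg v N hN := by
  set S : Subalgebra ℝ C(unitSphere 5 × I, ℝ) := (ApprAlg v N hN).comap (PsiHom hv) with hS
  have hc : IsClosed (S : Set C(unitSphere 5 × I, ℝ)) := (Appr.closed hN).preimage (PsiHom_cont hv)
  have cs : CompactSpace (unitSphere 5) := isCompact_iff_compactSpace.1 (isCompact_sphere _ _)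
  -- real parts
  have key : ∀ (e : ℍ[ℝ]) (a b : Fin 2), Appr v N ⟨fun x => (((e * (v a x.2 * star (v b x.2))).re : ℝ) : ℍ[ℝ]),
      Quaternion.continuous_coe.comp (Quaternion.continuous_re.comp (by fun_prop))⟩ := by
    intro e a b
    have := Appr.mul hN (Appr.const ((1/2 : ℝ) : ℍ[ℝ])) (Appr.add
      (Appr.mul hN (Appr.const e) (Appr.vv (v := v) a b))
      (Appr.mul hN (Appr.vv (v := v) b a) (Appr.const (star e))))
    convert this using 1
    ext1 x
    simp only [ContinuousMap.coe_mk, ContinuousMap.mul_apply, ContinuousMap.add_apply,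
      ContinuousMap.const_apply, ContinuousMap.comp_apply, re_eq_half, star_mul, star_star,
      ContinuousMap.star_apply]
  have coord : ∀ i : Fin 6, (⟨fun y => y.1.1 i, by fun_prop⟩ : C(unitSphere 5 × I, ℝ)) ∈ S := by
    intro i
    have sn : ∀ f : C((I × I) × Ω, ℍ[ℝ]), Appr v N f → Appr v N
      ((⟨fun x => ((Real.sin (Real.pi * x.1.1) : ℝ) : ℍ[ℝ]), Quaternion.continuous_coe.comp (by fun_prop)⟩
        : C((I × I) × Ω, ℍ[ℝ])) * f) := fun f hf => Appr.mul hN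
          (Appr.fun1 ⟨fun κ => Real.sin (Real.pi * κ.1), by fun_prop⟩) hf
    have im : ∀ e : ℍ[ℝ], Appr v N (ContinuousMap.const _ ((2:ℝ):ℍ[ℝ]) * ⟨fun x => (((e * (v 0 x.2 * star (v 1 x.2))).re : ℝ) : ℍ[ℝ]),
      Quaternion.continuous_coe.comp (Quaternion.continuous_re.comp (by fun_prop))⟩) :=
        fun e => Appr.mul hN (Appr.const ((2:ℝ):ℍ[ℝ])) (key e 0 1)
    change Appr v N _
    fin_cases i
    · convert Appr.fun1 (v := v) (N := N) ⟨fun κ => Real.cos (Real.pi * κ.1), by fun_prop⟩ using 1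
      ext1 x
      simp [PsiHom_apply, Psi, cpt]
    · convert sn _ (Appr.add (Appr.mul hN (Appr.const ((2:ℝ):ℍ[ℝ])) (key 1 0 0)) (Appr.const ((-1:ℝ):ℍ[ℝ]))) using 1
      ext1 x
      change ((Real.sin (Real.pi * x.1.1) * (2 * (v 0 x.2 * star (v 0 x.2)).re - 1) : ℝ) : ℍ[ℝ]) =
        ((Real.sin (Real.pi * x.1.1) : ℝ) : ℍ[ℝ]) * (((2:ℝ) : ℍ[ℝ]) *
          (((1 * (v 0 x.2 * star (v 0 x.2))).re : ℝ) : ℍ[ℝ]) + ((-1 : ℝ) : ℍ[ℝ]))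
      rw [one_mul, ← Quaternion.coe_mul, ← Quaternion.coe_add, ← Quaternion.coe_mul, sub_eq_add_neg]
    · convert sn _ (im 1) using 1
      ext1 x
      change ((Real.sin (Real.pi * x.1.1) * (2 * (v 0 x.2 * star (v 1 x.2)).re) : ℝ) : ℍ[ℝ]) =
        ((Real.sin (Real.pi * x.1.1) : ℝ) : ℍ[ℝ]) * (((2:ℝ) : ℍ[ℝ]) *
          (((1 * (v 0 x.2 * star (v 1 x.2))).re : ℝ) : ℍ[ℝ]))
      generalize v 0 x.2 * star (v 1 x.2) = q
      have : (1 * q).re = q.re := by simp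
      rw [this, ← Quaternion.coe_mul, ← Quaternion.coe_mul]
    · convert sn _ (im (-qi)) using 1
      ext1 x
      change ((Real.sin (Real.pi * x.1.1) * (2 * (v 0 x.2 * star (v 1 x.2)).imI) : ℝ) : ℍ[ℝ]) =
        ((Real.sin (Real.pi * x.1.1) : ℝ) : ℍ[ℝ]) * (((2:ℝ) : ℍ[ℝ]) *
          ((((-qi) * (v 0 x.2 * star (v 1 x.2))).re : ℝ) : ℍ[ℝ]))
      generalize v 0 x.2 * star (v 1 x.2) = q
      have : ((-qi) * q).re = q.imI := by simp
      rw [this, ← Quaternion.coe_mul, ← Quaternion.coe_mul]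
    · convert sn _ (im (-qj)) using 1
      ext1 x
      change ((Real.sin (Real.pi * x.1.1) * (2 * (v 0 x.2 * star (v 1 x.2)).imJ) : ℝ) : ℍ[ℝ]) =
        ((Real.sin (Real.pi * x.1.1) : ℝ) : ℍ[ℝ]) * (((2:ℝ) : ℍ[ℝ]) *
          ((((-qj) * (v 0 x.2 * star (v 1 x.2))).re : ℝ) : ℍ[ℝ]))
      generalize v 0 x.2 * star (v 1 x.2) = q
      have : ((-qj) * q).re = q.imJ := by simp
      rw [this, ← Quaternion.coe_mul, ← Quaternion.coe_mul]
    · convert sn _ (im (-qk)) using 1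
      ext1 x
      change ((Real.sin (Real.pi * x.1.1) * (2 * (v 0 x.2 * star (v 1 x.2)).imK) : ℝ) : ℍ[ℝ]) =
        ((Real.sin (Real.pi * x.1.1) : ℝ) : ℍ[ℝ]) * (((2:ℝ) : ℍ[ℝ]) *
          ((((-qk) * (v 0 x.2 * star (v 1 x.2))).re : ℝ) : ℍ[ℝ]))
      generalize v 0 x.2 * star (v 1 x.2) = q
      have : ((-qk) * q).re = q.imK := by simp
      rw [this, ← Quaternion.coe_mul, ← Quaternion.coe_mul]
  have coord2 : (⟨fun y => (y.2 : ℝ), by fun_prop⟩ : C(unitSphere 5 × I, ℝ)) ∈ S := by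
    change Appr v N _
    convert Appr.fun1 (v := v) (N := N) ⟨fun κ => κ.2, by fun_prop⟩ using 1
    ext1 x
    simp [PsiHom_apply, Psi]
  have sep : S.SeparatesPoints := by
    rintro ⟨x, s⟩ ⟨y, t⟩ hne
    by_cases h : s = t
    · have : ∃ i, x.1 i ≠ y.1 i := by
        by_contra hcon
        push Not at hcon
        apply hne
        rw [h, Prod.mk.injEq]
        exact ⟨Subtype.ext (PiLp.ext hcon), rfl⟩
      obtain ⟨i, hi⟩ := this
      exact ⟨_, ⟨_, coord i, rfl⟩, hi⟩
    · exact ⟨_, ⟨_, coord2, rfl⟩, fun h' => h (Subtype.ext h')⟩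
  have := ContinuousMap.subalgebra_topologicalClosure_eq_top_of_separatesPoints S sep
  have hF : F ∈ S.topologicalClosure := by rw [this]; trivial
  have : F ∈ closure (S : Set C(unitSphere 5 × I, ℝ)) := hF
  rw [hc.closure_eq] at this
  exact this

theorem appr_quat (hN : ∀ g f, N (g * f) ≤ ‖g‖ * N f)
    (hv : ∀ ω, Quaternion.normSq (v 0 ω) + Quaternion.normSq (v 1 ω) = 1)
    (F : C(unitSphere 5 × I, ℍ[ℝ])) : Appr v N (F.comp (Psi hv)) := by
  have e := fun G => show Appr v N _ from appr_real hN hv G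
  have := ((((e ⟨fun y => (F y).re, Quaternion.continuous_re.comp F.continuous⟩).mul hN (Appr.const 1)).add
    ((e ⟨fun y => (F y).imI, Quaternion.continuous_imI.comp F.continuous⟩).mul hN
      (Appr.const qi))).add
    ((e ⟨fun y => (F y).imJ, Quaternion.continuous_imJ.comp F.continuous⟩).mul hN
      (Appr.const qj))).add
    ((e ⟨fun y => (F y).imK, Quaternion.continuous_imK.comp F.continuous⟩).mul hN
      (Appr.const qk))
  convert this using 1
  ext1 x
  simp only [ContinuousMap.add_apply, ContinuousMap.mul_apply, PsiHom_apply, ContinuousMap.const_apply,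
    ContinuousMap.comp_apply, ContinuousMap.coe_mk]
  ext <;> simp

theorem appr_par (hN : ∀ g f, N (g * f) ≤ ‖g‖ * N f) (F : C(I × I, ℍ[ℝ])) :
    Appr v N (F.comp ⟨Prod.fst, continuous_fst⟩) := by
  have := ((((Appr.fun1 (v := v) (N := N) ⟨fun y => (F y).re, Quaternion.continuous_re.comp F.continuous⟩).mul hN (Appr.const 1)).add
    ((Appr.fun1 ⟨fun y => (F y).imI, Quaternion.continuous_imI.comp F.continuous⟩).mul hN
      (Appr.const qi))).add
    ((Appr.fun1 ⟨fun y => (F y).imJ, Quaternion.continuous_imJ.comp F.continuous⟩).mul hN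
      (Appr.const qj))).add
    ((Appr.fun1 ⟨fun y => (F y).imK, Quaternion.continuous_imK.comp F.continuous⟩).mul hN
      (Appr.const qk))
  convert this using 1
  ext1 x
  simp only [ContinuousMap.add_apply, ContinuousMap.mul_apply, ContinuousMap.const_apply,
    ContinuousMap.comp_apply, ContinuousMap.coe_mk]
  ext <;> simp

end
end

section
open unitInterval Topology Matrix Quaternion

abbrev JJ := Fin 2 ⊕ Fin 2

noncomputable def yq (x : EuclideanSpace ℝ (Fin 6)) : ℍ[ℝ] :=
  x 2 • 1 + x 3 • qi + x 4 • qj + x 5 • qk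

noncomputable def Ym (x : EuclideanSpace ℝ (Fin 6)) : Matrix (Fin 2) (Fin 2) ℍ[ℝ] :=
  !![((x 1 : ℝ) : ℍ[ℝ]), yq x; star (yq x), -((x 1 : ℝ) : ℍ[ℝ])]

noncomputable def F5 (x : EuclideanSpace ℝ (Fin 6)) : Matrix JJ JJ ℍ[ℝ] :=
  fromBlocks ((x 0 : ℝ) • 1) (-Ym x) (Ym x) ((x 0 : ℝ) • 1)

noncomputable def F5' (x : EuclideanSpace ℝ (Fin 6)) : Matrix JJ JJ ℍ[ℝ] :=
  fromBlocks ((x 0 : ℝ) • 1) (Ym x) (-Ym x) ((x 0 : ℝ) • 1)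

lemma yq_cont : Continuous yq := by
  unfold yq
  fun_prop

lemma Ym_cont : Continuous Ym := by
  refine continuous_matrix fun i j => ?_
  have h0 : Continuous fun x : EuclideanSpace ℝ (Fin 6) => ((x 1 : ℝ) : ℍ[ℝ]) :=
    Quaternion.continuous_coe.comp (by fun_prop)
  fin_cases i <;> fin_cases j
  · exact h0
  · exact yq_cont
  · exact yq_cont.star
  · exact h0.neg

lemma Ym_sq (x : EuclideanSpace ℝ (Fin 6)) (hx : ‖x‖ = 1) : Ym x * Ym x = (1 - x 0 ^ 2 : ℝ) • 1 := by
  have h : x 0 ^ 2 + x 1 ^ 2 + x 2 ^ 2 + x 3 ^ 2 + x 4 ^ 2 + x 5 ^ 2 = 1 := by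
    rw [EuclideanSpace.norm_eq, Real.sqrt_eq_one] at hx
    simp [Fin.sum_univ_succ] at hx
    linear_combination hx
  ext i j <;> fin_cases i <;> fin_cases j <;>
    simp [Ym, yq, Matrix.mul_apply] <;> first | ring1 | linear_combination h

lemma F5_mul (x : EuclideanSpace ℝ (Fin 6)) (hx : ‖x‖ = 1) : F5 x * F5' x = 1 := by
  rw [F5, F5', fromBlocks_multiply, ← fromBlocks_one]
  congr 1 <;> simp only [neg_mul, mul_neg, neg_neg, Ym_sq x hx, one_mul, mul_one,
    smul_mul_assoc, mul_smul_comm] <;> module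

lemma F5'_mul (x : EuclideanSpace ℝ (Fin 6)) (hx : ‖x‖ = 1) : F5' x * F5 x = 1 := by
  rw [F5, F5', fromBlocks_multiply, ← fromBlocks_one]
  congr 1 <;> simp only [neg_mul, mul_neg, neg_neg, Ym_sq x hx, one_mul, mul_one,
    smul_mul_assoc, mul_smul_comm] <;> module

/-- block rotation -/
noncomputable def rotM {R : Type*} [Ring R] [Module ℝ R] (P : Matrix (Fin 2) (Fin 2) R) (θ : ℝ) :
    Matrix JJ JJ R :=
  fromBlocks (Real.cos θ • 1) (-(Real.sin θ • (P + P - 1))) (Real.sin θ • (P + P - 1)) (Real.cos θ • 1)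

noncomputable def Pm (w : ℍ[ℝ] × ℍ[ℝ]) : Matrix (Fin 2) (Fin 2) ℍ[ℝ] :=
  !![w.1 * star w.1, w.1 * star w.2; w.2 * star w.1, w.2 * star w.2]

lemma Ym_cpt (w : ℍ[ℝ] × ℍ[ℝ]) (hw : Quaternion.normSq w.1 + Quaternion.normSq w.2 = 1) (t : ℝ) :
    Ym (cpt w t) = Real.sin (Real.pi * t) • (Pm w + Pm w - 1) := by
  have h1 : Quaternion.normSq w.2 = 1 - Quaternion.normSq w.1 := by linarith
  have h2 : w.2 * star w.1 = star (w.1 * star w.2) := by simp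
  have h3 : (w.1 * star w.1) = ((Quaternion.normSq w.1 : ℝ) : ℍ[ℝ]) := Quaternion.self_mul_star _
  have h4 : (w.2 * star w.2) = ((1 - Quaternion.normSq w.1 : ℝ) : ℍ[ℝ]) := by
    rw [Quaternion.self_mul_star, h1]
  rw [Pm, h2, h4, Ym, cpt, yq, h3]
  generalize w.1 * star w.2 = q
  generalize Quaternion.normSq w.1 = r
  generalize Real.sin (Real.pi * t) = s
  ext i j <;> fin_cases i <;> fin_cases j <;> simp <;> ring_nf <;> simp

lemma F5_cpt (w : ℍ[ℝ] × ℍ[ℝ]) (hw : Quaternion.normSq w.1 + Quaternion.normSq w.2 = 1) (t : ℝ) :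
    F5 (cpt w t) = rotM (Pm w) (Real.pi * t) := by
  rw [F5, Ym_cpt w hw, rotM]; rfl

lemma F5'_cpt (w : ℍ[ℝ] × ℍ[ℝ]) (hw : Quaternion.normSq w.1 + Quaternion.normSq w.2 = 1) (t : ℝ) :
    F5' (cpt w t) = rotM (Pm w) (-(Real.pi * t)) := by
  rw [F5', Ym_cpt w hw, rotM, Real.sin_neg, Real.cos_neg, neg_smul, neg_neg]; rfl

theorem null_block (h : ∀ g : C(unitSphere 5, ℍ[ℝ]ˣ), g.Nullhomotopic) :
    ∃ G G' : C(unitSphere 5 × I, Matrix JJ JJ ℍ[ℝ]), (∀ x, G x * G' x = 1) ∧ (∀ x, G' x * G x = 1) ∧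
      (∀ x, G (x, 0) = F5 x.1) ∧ (∀ x y, G (x, 1) = G (y, 1)) := by
  let e : Matrix JJ JJ ℍ[ℝ] ≃+* Matrix (Fin 4) (Fin 4) ℍ[ℝ] :=
    (Matrix.reindexAlgEquiv ℝ ℍ[ℝ] (finSumFinEquiv (m := 2) (n := 2))).toRingEquiv
  have he : Continuous e := by
    show Continuous fun A : Matrix JJ JJ ℍ[ℝ] => A.submatrix finSumFinEquiv.symm finSumFinEquiv.symm
    exact continuous_id.matrix_submatrix _ _
  have he' : Continuous e.symm := by
    show Continuous fun A : Matrix (Fin (2+2)) (Fin (2+2)) ℍ[ℝ] => A.submatrix finSumFinEquiv finSumFinEquiv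
    exact continuous_id.matrix_submatrix _ _
  have c5 : Continuous fun x : unitSphere 5 => F5 x.1 := by
    have := Ym_cont.comp (continuous_subtype_val (p := fun x => x ∈ Metric.sphere (0 : EuclideanSpace ℝ (Fin (5 + 1))) 1))
    exact Continuous.matrix_fromBlocks (by fun_prop) this.neg this (by fun_prop)
  have c5' : Continuous fun x : unitSphere 5 => F5' x.1 := by
    have := Ym_cont.comp (continuous_subtype_val (p := fun x => x ∈ Metric.sphere (0 : EuclideanSpace ℝ (Fin (5 + 1))) 1))
    exact Continuous.matrix_fromBlocks (by fun_prop) this this.neg (by fun_prop)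
  have nx : ∀ x : unitSphere 5, ‖x.1‖ = 1 := fun x => mem_sphere_zero_iff_norm.1 x.2
  let f : C(unitSphere 5, (Matrix (Fin 4) (Fin 4) ℍ[ℝ])ˣ) :=
    ⟨fun x => ⟨e (F5 x.1), e (F5' x.1), by rw [← map_mul, F5_mul _ (nx x), map_one],
      by rw [← map_mul, F5'_mul _ (nx x), map_one]⟩, by
        rw [Units.continuous_iff]
        exact ⟨he.comp c5, he.comp c5'⟩⟩
  obtain ⟨c, ⟨K⟩⟩ := quat_null_four h f
  refine ⟨⟨fun x => e.symm (K (x.2, x.1)).val, he'.comp (Units.continuous_val.comp (by fun_prop))⟩,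
    ⟨fun x => e.symm ((K (x.2, x.1))⁻¹).val, he'.comp (Units.continuous_val.comp
      (continuous_inv.comp (by fun_prop)))⟩, fun x => ?_, fun x => ?_, fun x => ?_, fun x y => ?_⟩
  · simp [← map_mul]
  · simp [← map_mul]
  · simp [f]
  · simp
end

section
open unitInterval Topology Matrix Quaternion

section
variable {Ω : Type} [TopologicalSpace Ω] [CompactSpace Ω] {v : Fin 2 → C(Ω, ℍ[ℝ])}
    {N : Seminorm ℝ C(Ω, ℍ[ℝ])}

variable (N) in
noncomputable def n4 : Seminorm ℝ (JJ → C(Ω, ℍ[ℝ])) :=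
  Seminorm.of (fun z => ∑ i, N (z i)) (fun x y => by
    rw [← Finset.sum_add_distrib]
    exact Finset.sum_le_sum fun i _ => map_add_le_add N _ _) (fun a x => by
    rw [Finset.mul_sum]
    exact Finset.sum_congr rfl fun i _ => map_smul_eq_mul N _ _)

lemma n4_apply (z : JJ → C(Ω, ℍ[ℝ])) : n4 N z = ∑ i, N (z i) := rfl

lemma n4_of_entry {z y : JJ → C(Ω, ℍ[ℝ])} {d : ℝ} (w : JJ → JJ → C(Ω, ℍ[ℝ]))
    (hz : ∀ i, z i = ∑ j, w i j) (h : ∀ i j, N (w i j) ≤ d * N (y j)) :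
    n4 N z ≤ (4 * d) * n4 N y := by
  have : ∀ i, N (z i) ≤ d * n4 N y := by
    intro i
    rw [hz, n4_apply, Finset.mul_sum]
    refine (le_trans ?_ (Finset.sum_le_sum fun j _ => h i j))
    exact Finset.le_sum_of_subadditive N (map_zero N).le (map_add_le_add N) _ _
  calc n4 N z = ∑ i, N (z i) := rfl
    _ ≤ ∑ i : JJ, d * n4 N y := Finset.sum_le_sum fun i _ => this i
    _ = _ := by simp; ring

lemma n4_mulVec (hN : ∀ g f, N (g * f) ≤ ‖g‖ * N f) (M : Matrix JJ JJ C(Ω, ℍ[ℝ])) (B : ℝ)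
    (hM : ∀ i j, ‖M i j‖ ≤ B) (z : JJ → C(Ω, ℍ[ℝ])) : n4 N (M *ᵥ z) ≤ (4 * B) * n4 N z :=
  n4_of_entry (fun i j => M i j * z j) (fun _ => rfl) fun i j => (hN _ _).trans
    (mul_le_mul_of_nonneg_right (hM i j) (apply_nonneg _ _))

/-- coordinates -/
def piJ (W : Type) [AddCommGroup W] [Module ℝ W] (i : JJ) : ((Fin 2 → W) × (Fin 2 → W)) →ₗ[ℝ] W :=
  Sum.elim (fun a => LinearMap.proj a ∘ₗ LinearMap.fst ℝ _ _) (fun a => LinearMap.proj a ∘ₗ LinearMap.snd ℝ _ _) i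

def ioJ (W : Type) [AddCommGroup W] [Module ℝ W] (i : JJ) : W →ₗ[ℝ] ((Fin 2 → W) × (Fin 2 → W)) :=
  Sum.elim (fun a => LinearMap.inl ℝ _ _ ∘ₗ LinearMap.single ℝ (fun _ => W) a)
    (fun a => LinearMap.inr ℝ _ _ ∘ₗ LinearMap.single ℝ (fun _ => W) a) i

lemma piJ_ioJ (W : Type) [AddCommGroup W] [Module ℝ W] (i j : JJ) (w : W) :
    piJ W i (ioJ W j w) = if i = j then w else 0 := by
  rcases i with a | a <;> rcases j with b | b <;> simp [piJ, ioJ, Pi.single_apply]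

/-- the symbol map on vectors -/
noncomputable def QD.psi (D : QD v N) : ((Fin 2 → D.W) × (Fin 2 → D.W)) →ₗ[ℝ] (JJ → C(Ω, ℍ[ℝ])) :=
  LinearMap.pi fun i => D.φ ∘ₗ piJ D.W i

lemma QD.psi_apply (D : QD v N) (ξ) (i) : D.psi ξ i = D.φ (piJ D.W i ξ) := rfl

lemma QD.psi_inj (D : QD v N) (ξ) (h : n4 N (D.psi ξ) = 0) : ξ = 0 := by
  rw [n4_apply, Finset.sum_eq_zero_iff_of_nonneg (fun _ _ => apply_nonneg _ _)] at h
  have h' : ∀ i, piJ D.W i ξ = 0 := fun i => D.φ_inj _ (h i (Finset.mem_univ _))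
  ext a
  · exact h' (Sum.inl a)
  · exact h' (Sum.inr a)

/-- operator matrix -/
noncomputable def QD.op (D : QD v N) (A : JJ → JJ → I × I → Module.End ℝ D.W) (κ : I × I) :
    Module.End ℝ ((Fin 2 → D.W) × (Fin 2 → D.W)) :=
  ∑ i, ∑ j, ioJ D.W i ∘ₗ (A i j κ ∘ₗ piJ D.W j)

lemma QD.op_cont (D : QD v N) (A : JJ → JJ → I × I → Module.End ℝ D.W) (hA : ∀ i j, ContEnd (A i j)) :
    ContEnd (D.op A) :=
  ContEnd.sum _ fun i _ => ContEnd.sum _ fun j _ => (ContEnd.const _).comp ((hA i j).comp (ContEnd.const _))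

lemma QD.op_psi (D : QD v N) (A : JJ → JJ → I × I → Module.End ℝ D.W) (κ ξ) (i) :
    D.psi (D.op A κ ξ) i = ∑ j, D.φ (A i j κ (piJ D.W j ξ)) := by
  rw [D.psi_apply, QD.op]
  simp only [LinearMap.sum_apply, map_sum, LinearMap.comp_apply, piJ_ioJ]
  rw [Finset.sum_comm]
  refine Finset.sum_congr rfl fun j _ => ?_
  rw [Finset.sum_eq_single i]
  · simp
  · intro b _ hb; simp [hb.symm]
  · simp

noncomputable def QD.Pr (D : QD v N) : Module.End ℝ (Fin 2 → D.W) :=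
  LinearMap.pi fun a => ∑ b, D.A a b ∘ₗ LinearMap.proj b

noncomputable def QD.P0 (D : QD v N) : Module.End ℝ (Fin 2 → D.W) := LinearMap.single ℝ (fun _ => D.W) 0 ∘ₗ LinearMap.proj 0

noncomputable def QD.J0 (D : QD v N) : Module.End ℝ (Fin 2 → D.W) :=
  LinearMap.single ℝ (fun _ => D.W) 0 ∘ₗ D.Q qi ∘ₗ LinearMap.proj 0

lemma QD.Qi (D : QD v N) (α) : D.Q qi (D.Q qi α) = -α := by
  have : D.Q qi (D.Q qi α) + α = 0 := by
    apply D.φ_inj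
    rw [map_add, D.hQ, D.hQ, ← mul_assoc]
    have : ContinuousMap.const Ω qi * ContinuousMap.const Ω qi = -1 := by
      ext1 x; exact qi_sq
    rw [this, neg_one_mul, neg_add_cancel, map_zero]
  exact eq_neg_of_add_eq_zero_left this

lemma QD.Pr_sq (D : QD v N) : D.Pr * D.Pr = D.Pr := by
  refine LinearMap.ext fun x => funext fun a => ?_
  have e : ∀ (y : Fin 2 → D.W) a, D.Pr y a = ∑ b, D.A a b (y b) := by
    intro y a
    simp [QD.Pr]
  rw [Module.End.mul_apply, e]
  simp only [e, map_sum]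
  rw [Finset.sum_comm]
  refine Finset.sum_congr rfl fun c _ => ?_
  rw [← D.idem a c]
  simp

lemma QD.P0_sq (D : QD v N) : D.P0 * D.P0 = D.P0 := by
  refine LinearMap.ext fun x => funext fun a => ?_
  simp [QD.P0]

lemma QD.J0_sq (D : QD v N) : D.J0 * D.J0 = -D.P0 := by
  refine LinearMap.ext fun x => funext fun a => ?_
  fin_cases a <;> simp [QD.J0, QD.P0, D.Qi]

lemma QD.P0J0 (D : QD v N) : D.P0 * D.J0 = D.J0 := by
  refine LinearMap.ext fun x => funext fun a => ?_
  fin_cases a <;> simp [QD.J0, QD.P0]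

lemma QD.J0P0 (D : QD v N) : D.J0 * D.P0 = D.J0 := by
  refine LinearMap.ext fun x => funext fun a => ?_
  fin_cases a <;> simp [QD.J0, QD.P0]

/-- the exact rotation -/
lemma QD.psi_P0 (D : QD v N) (θ : ℝ) (ξ) : D.psi (Lp D.P0 θ ξ) =
    rotM (!![1, 0; 0, 0] : Matrix (Fin 2) (Fin 2) C(Ω, ℍ[ℝ])) θ *ᵥ D.psi ξ := by
  ext1 i
  simp only [Matrix.mulVec, dotProduct, Fintype.sum_sum_type, Fin.sum_univ_two, D.psi_apply]
  rcases i with a | a <;> fin_cases a <;>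
  simp [rotM, Lp, piJ, QD.P0] <;> abel

lemma QD.psi_Pr (D : QD v N) (hδ : 0 ≤ D.δ) (θ : ℝ) (ξ) : n4 N (D.psi (Lp D.Pr θ ξ) -
    rotM (Matrix.of fun a b => v a * star (v b) : Matrix (Fin 2) (Fin 2) C(Ω, ℍ[ℝ])) θ *ᵥ D.psi ξ) ≤
    (4 * (2 * D.δ)) * n4 N (D.psi ξ) := by
  let E : Fin 2 → Fin 2 → D.W → C(Ω, ℍ[ℝ]) := fun a b α =>
    (2 * Real.sin θ) • (D.φ (D.A a b α) - v a * star (v b) * D.φ α)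
  have hE : ∀ a b α, N (E a b α) ≤ 2 * D.δ * N (D.φ α) := by
    intro a b α
    simp only [E]
    rw [map_smul_eq_mul]
    have h1 : ‖2 * Real.sin θ‖ ≤ 2 := by
      rw [norm_mul, Real.norm_eq_abs, Real.norm_eq_abs]
      have := Real.abs_sin_le_one θ
      norm_num; linarith
    have := D.hA a b α
    calc _ ≤ 2 * (D.δ * N (D.φ α)) := mul_le_mul h1 this (apply_nonneg _ _) (by norm_num)
      _ = _ := by ring
  refine n4_of_entry (fun i j => match i, j with
    | Sum.inl a, Sum.inl b => 0
    | Sum.inl a, Sum.inr b => - E a b (ξ.2 b)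
    | Sum.inr a, Sum.inl b => E a b (ξ.1 b)
    | Sum.inr a, Sum.inr b => 0) ?_ ?_
  · intro i
    rw [Pi.sub_apply]
    simp only [Matrix.mulVec, dotProduct, Fintype.sum_sum_type, Fin.sum_univ_two, D.psi_apply]
    rcases i with a | a <;> fin_cases a <;>
    simp [rotM, Lp, piJ, QD.Pr, E, Fin.sum_univ_two, add_mul, sub_mul] <;> module
  · have z : ∀ j, 0 ≤ 2 * D.δ * N (D.psi ξ j) := fun j =>
      mul_nonneg (by positivity) (apply_nonneg _ _)
    rintro (a | a) (b | b)
    · simpa using z (Sum.inl b)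
    · change N (-E a b (ξ.2 b)) ≤ _
      rw [map_neg_eq_map]
      exact hE a b (ξ.2 b)
    · exact hE a b (ξ.1 b)
    · simpa using z (Sum.inr b)
end
end

section
open unitInterval Topology Matrix Quaternion

set_option maxHeartbeats 2000000 in
theorem final_contra {Ω : Type} [TopologicalSpace Ω] [CompactSpace Ω] {v : Fin 2 → C(Ω, ℍ[ℝ])}
    {N : Seminorm ℝ C(Ω, ℍ[ℝ])} (hN : ∀ g f, N (g * f) ≤ ‖g‖ * N f)
    (hv : ∀ ω, Quaternion.normSq (v 0 ω) + Quaternion.normSq (v 1 ω) = 1)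
    (hD : ∀ δ : ℝ, 0 < δ → ∃ D : QD v N, 0 ≤ D.δ ∧ D.δ ≤ δ)
    (h : ∀ g : C(unitSphere 5, ℍ[ℝ]ˣ), g.Nullhomotopic) : False := by
  obtain ⟨G, G', hG1, hG2, hG0, hGc⟩ := null_block h
  have hw0 : Quaternion.normSq ((1, 0) : ℍ[ℝ] × ℍ[ℝ]).1 + Quaternion.normSq ((1, 0) : ℍ[ℝ] × ℍ[ℝ]).2 = 1 := by simp
  let b : C(I × I, unitSphere 5 × I) := ⟨fun κ => (⟨cpt (1, 0) κ.1, cpt_mem (1, 0) hw0 κ.1⟩, κ.2), by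
    refine Continuous.prodMk (Continuous.subtype_mk ?_ _) (by fun_prop)
    have hh : Continuous fun κ : I × I => ((((1, 0) : ℍ[ℝ] × ℍ[ℝ]), (κ.1 : ℝ)) : (ℍ[ℝ] × ℍ[ℝ]) × ℝ) := by
      fun_prop
    have := cpt_continuous.comp hh
    simpa only [Function.comp_def] using this⟩
  let en : C(unitSphere 5 × I, Matrix JJ JJ ℍ[ℝ]) → JJ → JJ → C(unitSphere 5 × I, ℍ[ℝ]) :=
    fun K i j => ⟨fun x => K x i j, K.continuous.matrix_elem i j⟩
  let pj : C((I × I) × Ω, I × I) := ⟨Prod.fst, continuous_fst⟩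
  let gA : JJ → JJ → C((I × I) × Ω, ℍ[ℝ]) := fun i j => (en G i j).comp (Psi hv)
  let gA' : JJ → JJ → C((I × I) × Ω, ℍ[ℝ]) := fun i j => (en G' i j).comp (Psi hv)
  let gB : JJ → JJ → C((I × I) × Ω, ℍ[ℝ]) := fun i j => ((en G i j).comp b).comp pj
  let gB' : JJ → JJ → C((I × I) × Ω, ℍ[ℝ]) := fun i j => ((en G' i j).comp b).comp pj
  let Hc : JJ → JJ → C((I × I) × Ω, ℍ[ℝ]) := fun i j => ∑ l, gA i l * gB' l j
  let Hc' : JJ → JJ → C((I × I) × Ω, ℍ[ℝ]) := fun i j => ∑ l, gB i l * gA' l j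
  let sl : (JJ → JJ → C((I × I) × Ω, ℍ[ℝ])) → I × I → Matrix JJ JJ C(Ω, ℍ[ℝ]) :=
    fun K κ => Matrix.of fun i j => (K i j).curry κ
  have slm : ∀ (K K' : JJ → JJ → C((I × I) × Ω, ℍ[ℝ])) κ, sl (fun i j => ∑ l, K i l * K' l j) κ =
      sl K κ * sl K' κ := by
    intro K K' κ
    ext1 i j
    ext1 x
    simp only [sl, Matrix.of_apply, Matrix.mul_apply, ContinuousMap.curry_apply, ContinuousMap.sum_apply,
      ContinuousMap.mul_apply]
  have mext : ∀ (M M' : Matrix JJ JJ C(Ω, ℍ[ℝ])), (∀ x, M.map (fun f => f x) = M'.map (fun f => f x)) → M = M' := by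
    intro M M' hM
    ext1 i j
    ext1 x
    exact congrFun (congrFun (hM x) i) j
  have mmul : ∀ (M M' : Matrix JJ JJ C(Ω, ℍ[ℝ])) x, (M * M').map (fun f => f x) =
      M.map (fun f => f x) * M'.map (fun f => f x) := by
    intro M M' x
    ext1 i j
    simp [Matrix.mul_apply]
  have mone : ∀ x, (1 : Matrix JJ JJ C(Ω, ℍ[ℝ])).map (fun f => f x) = 1 := by
    intro x
    exact Matrix.map_one _ rfl rfl
  have sA : ∀ κ x, (sl gA κ).map (fun f => f x) = G (Psi hv (κ, x)) := fun κ x => rfl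
  have sA' : ∀ κ x, (sl gA' κ).map (fun f => f x) = G' (Psi hv (κ, x)) := fun κ x => rfl
  have sB : ∀ κ x, (sl gB κ).map (fun f => f x) = G (b κ) := fun κ x => rfl
  have sB' : ∀ κ x, (sl gB' κ).map (fun f => f x) = G' (b κ) := fun κ x => rfl
  have A1 : ∀ κ, sl gA' κ * sl gA κ = 1 := fun κ => mext _ _ fun x => by
    rw [mmul, mone, sA, sA', hG2]
  have B1 : ∀ κ, sl gB κ * sl gB' κ = 1 := fun κ => mext _ _ fun x => by
    rw [mmul, mone, sB, sB', hG1]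
  have HH : ∀ κ, sl Hc' κ * sl Hc κ = 1 := by
    intro κ
    rw [slm, slm, mul_assoc, ← mul_assoc (sl gA' κ), A1, one_mul, B1]
  -- the boundary values
  have bd : ∀ κ, (∀ x, G (Psi hv (κ, x)) = G (b κ)) → sl Hc κ = 1 := by
    intro κ hκ
    rw [slm]
    refine mext _ _ fun x => ?_
    rw [mmul, mone, sA, sB', hκ, hG1]
  have cpt0 : ∀ w w', cpt w 0 = cpt w' 0 := by
    intro w w'; simp [cpt]
  have cpt1 : ∀ w w', cpt w 1 = cpt w' 1 := by
    intro w w'; simp [cpt]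
  have H0 : ∀ τ, sl Hc (0, τ) = 1 := fun τ => bd _ fun x => by
    congr 1
    exact Prod.ext (Subtype.ext (cpt0 _ _)) rfl
  have H1 : ∀ τ, sl Hc (1, τ) = 1 := fun τ => bd _ fun x => by
    congr 1
    exact Prod.ext (Subtype.ext (cpt1 _ _)) rfl
  have H2 : ∀ t, sl Hc (t, 1) = 1 := fun t => bd _ fun x => hGc _ _
  -- bounds
  obtain ⟨B, hB0, hB1, hB2⟩ : ∃ B : ℝ, 0 ≤ B ∧ (∀ i j, ‖Hc' i j‖ ≤ B) ∧ (∀ i j, ‖gB' i j‖ ≤ B) := by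
    refine ⟨∑ i, ∑ j, (‖Hc' i j‖ + ‖gB' i j‖), by positivity, fun i j => ?_, fun i j => ?_⟩
    · calc _ ≤ ‖Hc' i j‖ + ‖gB' i j‖ := by linarith [norm_nonneg (gB' i j)]
        _ ≤ ∑ j, (‖Hc' i j‖ + ‖gB' i j‖) := Finset.single_le_sum (f := fun j => ‖Hc' i j‖ + ‖gB' i j‖) (fun _ _ => by positivity) (Finset.mem_univ j)
        _ ≤ _ := Finset.single_le_sum (f := fun i => ∑ j, (‖Hc' i j‖ + ‖gB' i j‖)) (fun _ _ => by positivity) (Finset.mem_univ i)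
    · calc _ ≤ ‖Hc' i j‖ + ‖gB' i j‖ := by linarith [norm_nonneg (Hc' i j)]
        _ ≤ ∑ j, (‖Hc' i j‖ + ‖gB' i j‖) := Finset.single_le_sum (f := fun j => ‖Hc' i j‖ + ‖gB' i j‖) (fun _ _ => by positivity) (Finset.mem_univ j)
        _ ≤ _ := Finset.single_le_sum (f := fun i => ∑ j, (‖Hc' i j‖ + ‖gB' i j‖)) (fun _ _ => by positivity) (Finset.mem_univ i)
  set ε : ℝ := 1 / (10 * (4 * B + 1)) with hε
  have εpos : 0 < ε := by positivity
  -- approximability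
  have ap : ∀ i j, Appr v N (Hc i j) := by
    intro i j
    change Hc i j ∈ ApprAlg v N hN
    refine Subalgebra.sum_mem _ fun l _ => Subalgebra.mul_mem _ ?_ ?_
    · exact appr_quat hN hv _
    · exact appr_par hN _
  choose d hd hdA using fun i j => ap i j (ε / 4) (by positivity)
  obtain ⟨δ, hδ, hδd⟩ : ∃ δ : ℝ, 0 < δ ∧ ∀ i j, δ ≤ d i j := by
    refine ⟨Finset.univ.inf' Finset.univ_nonempty fun p : JJ × JJ => d p.1 p.2, ?_, fun i j => ?_⟩
    · rw [Finset.lt_inf'_iff]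
      exact fun p _ => hd _ _
    · exact Finset.inf'_le (fun p : JJ × JJ => d p.1 p.2) (Finset.mem_univ (i, j))
  obtain ⟨D, hD0, hDδ⟩ := hD (min δ (ε / (32 * (B + 1)))) (by positivity)
  choose A cA hA using fun i j => hdA i j D ((hDδ.trans (min_le_left _ _)).trans (hδd i j))
  let L : I → Module.End ℝ ((Fin 2 → D.W) × (Fin 2 → D.W)) := fun t =>
    Lp D.Pr (Real.pi * t) * Lp D.P0 (-(Real.pi * t))
  have cLp : ∀ (p : Module.End ℝ (Fin 2 → D.W)) (θ : I → ℝ), Continuous θ → ContEnd fun t => Lp p (θ t) := by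
    intro p θ hθ
    exact (ContEnd.smul (by fun_prop) (ContEnd.const _)).add (ContEnd.smul (by fun_prop) (ContEnd.const _))
  have L1 : L 1 = 1 := by
    have l1 : Lp D.Pr (Real.pi * ((1 : I) : ℝ)) = -1 := by simp [Lp]; exact LinearMap.ext fun x => by simp
    have l2 : Lp D.P0 (-(Real.pi * ((1 : I) : ℝ))) = -1 := by simp [Lp]; exact LinearMap.ext fun x => by simp
    simp only [L]
    rw [l1, l2]
    exact LinearMap.ext fun x => neg_neg x
  have X1 : ∀ κ ξ, n4 N (D.psi (D.op A κ ξ) - sl Hc κ *ᵥ D.psi ξ) ≤ ε * n4 N (D.psi ξ) := by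
    intro κ ξ
    have := n4_of_entry (N := N) (d := ε / 4) (z := D.psi (D.op A κ ξ) - sl Hc κ *ᵥ D.psi ξ) (y := D.psi ξ)
      (fun i j => D.φ (A i j κ (piJ D.W j ξ)) - (Hc i j).curry κ * D.φ (piJ D.W j ξ)) (fun i => by
        rw [Finset.sum_sub_distrib, Pi.sub_apply, D.op_psi]
        rfl) (fun i j => hA i j κ _)
    calc _ ≤ _ := this
      _ = _ := by ring
  have X2 : ∀ t ξ, n4 N (D.psi (L t ξ) - sl Hc (t, 0) *ᵥ D.psi ξ) ≤ ε * n4 N (D.psi ξ) := by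
    intro t ξ
    have e1 : sl gB' (t, 0) = rotM (!![1, 0; 0, 0] : Matrix (Fin 2) (Fin 2) C(Ω, ℍ[ℝ])) (-(Real.pi * t)) := by
      refine mext _ _ fun x => ?_
      rw [sB']
      have k1 : G (b (t, 0)) = F5 (cpt (1, 0) t) := hG0 _
      have k2 : G' (b (t, 0)) = F5' (cpt (1, 0) t) := by
        have k3 := F5_mul (cpt (1, 0) t) (mem_sphere_zero_iff_norm.1 (cpt_mem (1, 0) hw0 t))
        have k4 := hG2 (b (t, 0))
        rw [k1] at k4
        exact left_inv_eq_right_inv k4 k3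
      rw [k2, F5'_cpt _ hw0]
      ext1 i j
      rcases i with i | i <;> rcases j with j | j <;> fin_cases i <;> fin_cases j <;> simp [rotM, Pm]
    have e2 : sl gA (t, 0) = rotM (Matrix.of fun a b => v a * star (v b)) (Real.pi * t) := by
      refine mext _ _ fun x => ?_
      rw [sA]
      have k1 : G (Psi hv ((t, 0), x)) = F5 (cpt (v 0 x, v 1 x) t) := hG0 _
      rw [k1, F5_cpt _ (hv x)]
      ext1 i j
      rcases i with i | i <;> rcases j with j | j <;> fin_cases i <;> fin_cases j <;> simp [rotM, Pm]
    have e3 : D.psi (Lp D.P0 (-(Real.pi * t)) ξ) = sl gB' (t, 0) *ᵥ D.psi ξ := by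
      rw [e1, D.psi_P0]
    have e4 : sl Hc (t, 0) *ᵥ D.psi ξ = sl gA (t, 0) *ᵥ D.psi (Lp D.P0 (-(Real.pi * t)) ξ) := by
      rw [slm, e3, mulVec_mulVec]
    have e5 := D.psi_Pr hD0 (Real.pi * t) (Lp D.P0 (-(Real.pi * t)) ξ)
    rw [← e2, ← e4] at e5
    have e6 := n4_mulVec hN (sl gB' (t, 0)) B (fun i j => (curry_norm_le _ _).trans (hB2 i j)) (D.psi ξ)
    rw [← e3] at e6
    have e7 : D.δ ≤ ε / (32 * (B + 1)) := hDδ.trans (min_le_right _ _)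
    calc _ ≤ _ := e5
      _ ≤ (4 * (2 * (ε / (32 * (B + 1))))) * ((4 * B) * n4 N (D.psi ξ)) := by
        gcongr
      _ = ε * (B / (B + 1)) * n4 N (D.psi ξ) := by field_simp; ring
      _ ≤ ε * 1 * n4 N (D.psi ξ) := by
        gcongr
        rw [div_le_one (by positivity)]; linarith
      _ = _ := by ring
  have X3 : ∀ κ z, n4 N z ≤ (4 * B) * n4 N (sl Hc κ *ᵥ z) := by
    intro κ z
    have e6 := n4_mulVec hN (sl Hc' κ) B (fun i j => (curry_norm_le _ _).trans (hB1 i j)) (sl Hc κ *ᵥ z)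
    rwa [mulVec_mulVec, HH, one_mulVec] at e6
  obtain ⟨T, cT, uT, T0, T1, T2, T3⟩ := correct_boundary (n4 N) D.psi D.psi_inj
    (fun κ z => sl Hc κ *ᵥ z) (D.op A) L (D.op_cont A cA)
    ((cLp _ _ (by fun_prop)).mul (cLp _ _ (by fun_prop))) ε (4 * B) εpos X1 X2
    (fun τ z => by rw [H0, one_mulVec]) (fun τ z => by rw [H1, one_mulVec])
    (fun τ z => by rw [H2, one_mulVec]) (by simp [L, Lp]) L1 X3 (by positivity) (by rw [hε]; field_simp; linarith)
  have h2 := Module.finrank_pi_fintype ℝ (M := fun _ : Fin 2 => D.W)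
  have h3 := D.two
  rw [Fin.sum_univ_two] at h2
  refine core_final (by omega) D.Pr D.P0 D.J0 D.Pr_sq D.odd D.P0_sq D.J0_sq D.P0J0 D.J0P0 T cT uT T0 T1 T2 T3
end

section
open unitInterval Topology Matrix Quaternion

abbrev V4 : Type := Fin 2 ⊕ Fin 2
abbrev CE : Type := EuclideanSpace ℂ V4
abbrev Om : Type := Metric.sphere (0 : CE) 1

noncomputable instance ceRI : InnerProductSpace ℝ CE := InnerProductSpace.complexToReal

noncomputable def muS : MeasureTheory.Measure Om := (MeasureTheory.volume : MeasureTheory.Measure CE).toSphere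

instance : FiniteDimensional ℝ CE := FiniteDimensional.complexToReal CE
instance : MeasureTheory.IsFiniteMeasure muS := by unfold muS; infer_instance
instance : CompactSpace Om := by infer_instance

lemma muS_ne : muS ≠ 0 := by
  unfold muS; exact MeasureTheory.Measure.toSphere_ne_zero _

noncomputable def sphMap (g : CE ≃ₗᵢ[ℝ] CE) : C(Om, Om) where
  toFun x := ⟨g x.1, by simp⟩
  continuous_toFun := by fun_prop

open Pointwise in
lemma sphMap_mp (g : CE ≃ₗᵢ[ℝ] CE) : MeasureTheory.MeasurePreserving (sphMap g) muS muS := by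
  refine ⟨(sphMap g).continuous.measurable, ?_⟩
  ext s hs
  rw [MeasureTheory.Measure.map_apply (sphMap g).continuous.measurable hs]
  unfold muS
  rw [MeasureTheory.Measure.toSphere_apply' _ hs, MeasureTheory.Measure.toSphere_apply' _
    ((sphMap g).continuous.measurable hs)]
  congr 1
  have hp := g.measurePreserving
  have : Set.Ioo (0:ℝ) 1 • (((↑) : Om → CE) '' (sphMap g ⁻¹' s)) =
      g.toMeasurableEquiv ⁻¹' (Set.Ioo (0:ℝ) 1 • (((↑) : Om → CE) '' s)) := by
    ext x
    constructor
    · rintro ⟨r, hr, y, ⟨y, hy, rfl⟩, rfl⟩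
      exact ⟨r, hr, _, ⟨_, hy, rfl⟩, by simp [sphMap]⟩
    · rintro ⟨r, hr, y, ⟨y, hy, rfl⟩, h⟩
      refine ⟨r, hr, _, ⟨sphMap g.symm y, ?_, rfl⟩, ?_⟩
      · have : sphMap g (sphMap g.symm y) = y := Subtype.ext (by simp [sphMap])
        rw [Set.mem_preimage, this]; exact hy
      · apply g.injective
        have h : r • y.1 = g x := h
        simp [sphMap, h]
  rw [this]
  exact MeasureTheory.MeasurePreserving.measure_preimage_equiv (f := g.toMeasurableEquiv) hp _

noncomputable abbrev tC : C(Om, ℂ) →L[ℂ] MeasureTheory.Lp ℂ 2 muS := ContinuousMap.toLp 2 muS ℂ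
noncomputable abbrev tH : C(Om, ℍ[ℝ]) →L[ℝ] MeasureTheory.Lp ℍ[ℝ] 2 muS := ContinuousMap.toLp 2 muS ℝ

noncomputable def NN : Seminorm ℝ C(Om, ℍ[ℝ]) :=
  (normSeminorm ℝ (MeasureTheory.Lp ℍ[ℝ] 2 muS)).comp tH.toLinearMap

lemma NN_apply (f : C(Om, ℍ[ℝ])) : NN f = ‖tH f‖ := rfl

lemma NN_mono_H {f g : C(Om, ℍ[ℝ])} {c : ℝ} (h : ∀ x, ‖f x‖ ≤ c * ‖g x‖) : NN f ≤ c * NN g := by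
  rw [NN_apply, NN_apply]
  refine MeasureTheory.Lp.norm_le_mul_norm_of_ae_le_mul ?_
  filter_upwards [ContinuousMap.coeFn_toLp (p := 2) (𝕜 := ℝ) muS f,
    ContinuousMap.coeFn_toLp (p := 2) (𝕜 := ℝ) muS g] with x h1 h2
  rw [h1, h2]; exact h x

lemma NN_mono_C {f : C(Om, ℍ[ℝ])} {g : C(Om, ℂ)} {c : ℝ} (h : ∀ x, ‖f x‖ ≤ c * ‖g x‖) : NN f ≤ c * ‖tC g‖ := by
  rw [NN_apply]
  refine MeasureTheory.Lp.norm_le_mul_norm_of_ae_le_mul ?_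
  filter_upwards [ContinuousMap.coeFn_toLp (p := 2) (𝕜 := ℝ) muS f,
    ContinuousMap.coeFn_toLp (p := 2) (𝕜 := ℂ) muS g] with x h1 h2
  rw [h1, h2]; exact h x

lemma tC_mono_H {f : C(Om, ℂ)} {g : C(Om, ℍ[ℝ])} {c : ℝ} (h : ∀ x, ‖f x‖ ≤ c * ‖g x‖) : ‖tC f‖ ≤ c * NN g := by
  rw [NN_apply]
  refine MeasureTheory.Lp.norm_le_mul_norm_of_ae_le_mul ?_
  filter_upwards [ContinuousMap.coeFn_toLp (p := 2) (𝕜 := ℂ) muS f,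
    ContinuousMap.coeFn_toLp (p := 2) (𝕜 := ℝ) muS g] with x h1 h2
  rw [h1, h2]; exact h x

lemma tC_mono_C {f g : C(Om, ℂ)} {c : ℝ} (h : ∀ x, ‖f x‖ ≤ c * ‖g x‖) : ‖tC f‖ ≤ c * ‖tC g‖ := by
  refine MeasureTheory.Lp.norm_le_mul_norm_of_ae_le_mul ?_
  filter_upwards [ContinuousMap.coeFn_toLp (p := 2) (𝕜 := ℂ) muS f,
    ContinuousMap.coeFn_toLp (p := 2) (𝕜 := ℂ) muS g] with x h1 h2
  rw [h1, h2]; exact h x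

lemma NN_mul (g f : C(Om, ℍ[ℝ])) : NN (g * f) ≤ ‖g‖ * NN f :=
  NN_mono_H fun x => by
    rw [ContinuousMap.mul_apply, norm_mul]
    gcongr
    exact g.norm_coe_le_norm x

lemma tC_one : tC 1 ≠ 0 := by
  intro h
  have h2 := MeasureTheory.ContinuousMap.inner_toLp (𝕜 := ℂ) muS (1 : C(Om, ℂ)) 1
  rw [h] at h2
  simp only [inner_zero_left, ContinuousMap.one_apply, map_one, mul_one, MeasureTheory.integral_const] at h2
  have : muS.real Set.univ ≠ 0 := by
    rw [MeasureTheory.measureReal_ne_zero_iff]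
    exact fun h => muS_ne (MeasureTheory.Measure.measure_univ_eq_zero.1 h)
  apply this
  simpa using h2.symm

lemma inner_inv (g : CE ≃ₗᵢ[ℝ] CE) (f h : C(Om, ℂ)) :
    inner ℂ (tC (f.comp (sphMap g))) (tC (h.comp (sphMap g))) = inner ℂ (tC f) (tC h) := by
  rw [MeasureTheory.ContinuousMap.inner_toLp, MeasureTheory.ContinuousMap.inner_toLp]
  have := (sphMap_mp g).map_eq
  conv_rhs => rw [← this]
  rw [MeasureTheory.integral_map (sphMap g).continuous.aemeasurable
    (by exact (Continuous.aestronglyMeasurable (by fun_prop)))]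
  rfl
end

section
open unitInterval Topology Matrix Quaternion

abbrev PP : Type := MvPolynomial V4 ℂ

noncomputable def uu (a : V4) : C(Om, ℂ) where
  toFun x := x.1 a
  continuous_toFun := by fun_prop

noncomputable def ev : PP →ₐ[ℂ] C(Om, ℂ) := MvPolynomial.aeval uu

lemma ev_X (a : V4) : ev (MvPolynomial.X a) = uu a := by simp [ev]

lemma hasDeriv_aeval (x : V4 → ℝ → C(Om, ℂ)) (x' : V4 → C(Om, ℂ)) (h : ∀ a, HasDerivAt (x a) (x' a) 0)
    (p : PP) : HasDerivAt (fun t => MvPolynomial.aeval (fun a => x a t) p)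
      (∑ a, MvPolynomial.aeval (fun a => x a 0) (MvPolynomial.pderiv a p) * x' a) 0 := by
  induction p using MvPolynomial.induction_on with
  | C c => simpa using hasDerivAt_const _ _
  | add p q hp hq =>
    simp only [map_add, add_mul, Finset.sum_add_distrib]
    exact hp.add hq
  | mul_X p i hp =>
    have := hp.mul (h i)
    simp only [map_mul, MvPolynomial.aeval_X]
    refine this.congr_deriv (Eq.symm ?_)
    simp only [MvPolynomial.pderiv_mul, map_add, map_mul, MvPolynomial.aeval_X, add_mul,
      Finset.sum_add_distrib]
    congr 1
    · rw [Finset.sum_mul]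
      exact Finset.sum_congr rfl fun a _ => by ring
    · rw [Finset.sum_eq_single i]
      · simp
      · intro b _ hb
        rw [MvPolynomial.pderiv_X_of_ne hb.symm]; simp
      · simp

noncomputable def Lam (a : V4) : (CE →L[ℂ] CE) →L[ℝ] C(Om, ℂ) :=
  LinearMap.mkContinuous
    { toFun := fun T => ⟨fun x => (T x.1) a, by fun_prop⟩
      map_add' := fun S T => by ext x; simp
      map_smul' := fun r T => by ext x; simp } 1 (by
    intro T
    rw [one_mul, ContinuousMap.norm_le _ (norm_nonneg _)]
    intro x
    calc ‖(T x.1) a‖ ≤ ‖T x.1‖ := PiLp.norm_apply_le _ _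
      _ ≤ ‖T‖ * ‖x.1‖ := T.le_opNorm _
      _ = ‖T‖ := by simp)

lemma Lam_apply (a : V4) (T : CE →L[ℂ] CE) (x : Om) : Lam a T x = (T x.1) a := rfl

noncomputable def dX (X : CE →L[ℂ] CE) (p : PP) : C(Om, ℂ) := ∑ a, ev (MvPolynomial.pderiv a p) * Lam a X

lemma curve_exists (X : CE →L[ℂ] CE) (hX : X ∈ skewAdjoint (CE →L[ℂ] CE)) (t : ℝ) :
    ∃ g : CE ≃ₗᵢ[ℝ] CE, ∀ x, g x = NormedSpace.exp (t • X) x := by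
  have h : NormedSpace.exp (t • X) ∈ unitary (CE →L[ℂ] CE) := by
    let _ : NormedAlgebra ℚ (CE →L[ℂ] CE) := NormedAlgebra.restrictScalars ℚ ℝ _
    apply NormedSpace.exp_mem_unitary_of_mem_skewAdjoint
    exact skewAdjoint.smul_mem t hX
  let g := Unitary.linearIsometryEquiv ⟨_, h⟩
  exact ⟨⟨g.toLinearEquiv.restrictScalars ℝ, g.norm_map⟩, fun x => rfl⟩

lemma exp0 (X : CE →L[ℂ] CE) : (fun a => Lam a (NormedSpace.exp ((0:ℝ) • X))) = uu := by
  have h : NormedSpace.exp ((0:ℝ) • X) = 1 := by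
    have h0 : (0:ℝ) • X = 0 := zero_smul ℝ X
    rw [h0, NormedSpace.exp_zero]
  funext a; ext x
  rw [Lam_apply, h]; rfl

lemma skew_inner (X : CE →L[ℂ] CE) (hX : X ∈ skewAdjoint (CE →L[ℂ] CE)) (p q : PP) :
    inner ℂ (tC (dX X p)) (tC (ev q)) + inner ℂ (tC (ev p)) (tC (dX X q)) = 0 := by
  have hd : ∀ p, HasDerivAt (fun t : ℝ => tC (MvPolynomial.aeval (fun a => Lam a (NormedSpace.exp (t • X))) p))
      (tC (dX X p)) 0 := by
    intro p
    have h1 : HasDerivAt (fun t : ℝ => NormedSpace.exp (t • X)) X 0 := by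
      simpa using hasDerivAt_exp_smul_const (𝕂 := ℝ) X 0
    have h2 := hasDeriv_aeval (fun a t => Lam a (NormedSpace.exp (t • X))) (fun a => Lam a X)
      (fun a => (Lam a).hasFDerivAt.comp_hasDerivAt 0 h1) p
    have h3 := (tC.restrictScalars ℝ).hasFDerivAt.comp_hasDerivAt (0:ℝ) h2
    refine h3.congr_deriv ?_
    rw [exp0 X]
    rfl
  have h0 : ∀ p, tC (MvPolynomial.aeval (fun a => Lam a (NormedSpace.exp ((0:ℝ) • X))) p) = tC (ev p) := by
    intro p
    rw [exp0 X]; rfl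
  have hi := (hd p).inner ℂ (hd q)
  rw [h0, h0] at hi
  have hc : (fun t : ℝ => inner ℂ (tC (MvPolynomial.aeval (fun a => Lam a (NormedSpace.exp (t • X))) p))
      (tC (MvPolynomial.aeval (fun a => Lam a (NormedSpace.exp (t • X))) q))) =
      fun _ => inner ℂ (tC (ev p)) (tC (ev q)) := by
    funext t
    obtain ⟨g, hg⟩ := curve_exists X hX t
    have : ∀ p, MvPolynomial.aeval (fun a => Lam a (NormedSpace.exp (t • X))) p = (ev p).comp (sphMap g) := by
      intro p
      have e : (MvPolynomial.aeval (fun a => Lam a (NormedSpace.exp (t • X))) : PP →ₐ[ℂ] C(Om, ℂ)) =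
          (ContinuousMap.compRightAlgHom ℂ ℂ (sphMap g)).comp ev := by
        apply MvPolynomial.algHom_ext
        intro a
        ext x
        simp [ev_X, Lam_apply, uu, sphMap, hg]
      rw [e]; rfl
    rw [this, this, inner_inv]
  rw [hc] at hi
  have := hi.unique (hasDerivAt_const _ _)
  rw [add_comm]; exact this

lemma Lam_mat (M : Matrix V4 V4 ℂ) (a : V4) : Lam a (Matrix.toEuclideanCLM (𝕜 := ℂ) M) = ∑ b, M a b • uu b := by
  ext x
  rw [Lam_apply]
  simp [Matrix.mulVec, dotProduct, uu]

lemma dX_mat (M : Matrix V4 V4 ℂ) (p : PP) : dX (Matrix.toEuclideanCLM (𝕜 := ℂ) M) p =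
    ∑ a, ∑ b, M a b • ev (MvPolynomial.X b * MvPolynomial.pderiv a p) := by
  unfold dX
  refine Finset.sum_congr rfl fun a _ => ?_
  rw [Lam_mat, Finset.mul_sum]
  refine Finset.sum_congr rfl fun b _ => ?_
  rw [map_mul, ev_X, mul_smul_comm, mul_comm]

lemma dX_single (a b : V4) (c : ℂ) (p : PP) : dX (Matrix.toEuclideanCLM (𝕜 := ℂ) (Matrix.single a b c)) p =
    c • ev (MvPolynomial.X b * MvPolynomial.pderiv a p) := by
  rw [dX_mat, Finset.sum_eq_single a, Finset.sum_eq_single b]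
  · simp
  · intro b' _ h; simp [h.symm]
  · simp
  · intro a' _ h; simp [h.symm]
  · simp

lemma dX_add (X Y : CE →L[ℂ] CE) (p : PP) : dX (X + Y) p = dX X p + dX Y p := by
  simp [dX, mul_add, Finset.sum_add_distrib]

lemma inner_adj (a b : V4) (p q : PP) :
    inner ℂ (tC (ev (MvPolynomial.X b * MvPolynomial.pderiv a p))) (tC (ev q)) =
    inner ℂ (tC (ev p)) (tC (ev (MvPolynomial.X a * MvPolynomial.pderiv b q))) := by
  have key : ∀ c : ℂ, inner ℂ (tC (c • ev (MvPolynomial.X b * MvPolynomial.pderiv a p) -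
      star c • ev (MvPolynomial.X a * MvPolynomial.pderiv b p))) (tC (ev q)) +
      inner ℂ (tC (ev p)) (tC (c • ev (MvPolynomial.X b * MvPolynomial.pderiv a q) -
      star c • ev (MvPolynomial.X a * MvPolynomial.pderiv b q))) = 0 := by
    intro c
    have := skew_inner (Matrix.toEuclideanCLM (𝕜 := ℂ) (Matrix.single a b c) +
      Matrix.toEuclideanCLM (𝕜 := ℂ) (Matrix.single b a (-star c))) (by
        rw [← map_add, skewAdjoint.mem_iff, ← map_star, ← map_neg]
        congr 1
        rw [star_eq_conjTranspose, conjTranspose_add, conjTranspose_single, conjTranspose_single]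
        simp only [star_neg, star_star]
        rw [neg_add, ← Matrix.single_neg, ← Matrix.single_neg, neg_neg, add_comm]) p q
    simp only [dX_add, dX_single, neg_smul, ← sub_eq_add_neg] at this
    exact this
  have h1 := key 1
  have h2 := key Complex.I
  simp only [map_sub, map_smul, inner_sub_left, inner_sub_right, inner_smul_left, inner_smul_right,
    star_one, Complex.star_def, Complex.conj_I, map_neg, map_one] at h1 h2
  have hI := Complex.I_mul_I
  linear_combination (1/2) * h1 + (1/2) * Complex.I * h2 + (1/2) * hI *
    (inner ℂ (tC (ev (MvPolynomial.X b * MvPolynomial.pderiv a p))) (tC (ev q)) +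
    inner ℂ (tC (ev (MvPolynomial.X a * MvPolynomial.pderiv b p))) (tC (ev q)) -
    inner ℂ (tC (ev p)) (tC (ev (MvPolynomial.X b * MvPolynomial.pderiv a q))) -
    inner ℂ (tC (ev p)) (tC (ev (MvPolynomial.X a * MvPolynomial.pderiv b q))))
end

section
open unitInterval Topology Matrix Quaternion

lemma inner_mul_adj (u f g : C(Om, ℂ)) :
    inner ℂ (tC (u * f)) (tC g) = inner ℂ (tC f) (tC (star u * g)) := by
  rw [MeasureTheory.ContinuousMap.inner_toLp, MeasureTheory.ContinuousMap.inner_toLp]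
  congr 1
  funext x
  simp only [ContinuousMap.mul_apply, map_mul, ContinuousMap.star_apply, Complex.star_def]
  ring

lemma sum_star_uu : ∑ a, star (uu a) * uu a = 1 := by
  ext x
  have h : ‖x.1‖ ^ 2 = 1 := by simp
  rw [EuclideanSpace.norm_sq_eq] at h
  have h2 : ∀ a, (star (uu a) * uu a) x = ((‖x.1 a‖ ^ 2 : ℝ) : ℂ) := by
    intro a
    simp only [ContinuousMap.mul_apply, ContinuousMap.star_apply, Complex.star_def]
    rw [mul_comm, Complex.mul_conj, Complex.normSq_eq_norm_sq]; rfl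
  rw [ContinuousMap.sum_apply, Finset.sum_congr rfl fun a _ => h2 a, ← Complex.ofReal_sum, h]
  simp

lemma inner_uu_sum (f g : C(Om, ℂ)) :
    ∑ a, inner ℂ (tC (uu a * f)) (tC (uu a * g)) = inner ℂ (tC f) (tC g) := by
  simp_rw [inner_mul_adj, ← mul_assoc]
  rw [← inner_sum, ← map_sum, ← Finset.sum_mul, sum_star_uu, one_mul]

lemma norm_star_uu_sum (f : C(Om, ℂ)) : ∑ a, ‖tC (star (uu a) * f)‖ ^ 2 = ‖tC f‖ ^ 2 := by
  have h : ∑ a, inner ℂ (tC (star (uu a) * f)) (tC (star (uu a) * f)) = inner ℂ (tC f) (tC f) := by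
    simp_rw [inner_mul_adj, ← mul_assoc, star_star]
    rw [← inner_sum, ← map_sum, ← Finset.sum_mul]
    have := sum_star_uu
    simp_rw [mul_comm (star _)] at this
    rw [this, one_mul]
  simp_rw [inner_self_eq_norm_sq_to_K] at h
  exact_mod_cast h

lemma sum_pderiv_X {p : PP} {m : ℕ} (hp : p.IsHomogeneous m) :
    ∑ b, MvPolynomial.pderiv b (MvPolynomial.X b * p) = ((m : ℂ) + 4) • p := by
  simp_rw [MvPolynomial.pderiv_mul, MvPolynomial.pderiv_X_self, one_mul]
  rw [Finset.sum_add_distrib, hp.sum_X_mul_pderiv]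
  rw [Finset.sum_const, Finset.card_univ, add_smul, add_comm, ← Nat.cast_smul_eq_nsmul ℂ,
    ← Nat.cast_smul_eq_nsmul ℂ]
  congr 2

lemma euler_smul {p : PP} {m : ℕ} (hp : p.IsHomogeneous m) :
    ∑ b, MvPolynomial.X b * MvPolynomial.pderiv b p = (m : ℂ) • p := by
  rw [hp.sum_X_mul_pderiv, Nat.cast_smul_eq_nsmul]

lemma casimir {p : PP} {m : ℕ} (hp : p.IsHomogeneous (m + 1)) :
    ∑ a, ∑ b, MvPolynomial.X a * MvPolynomial.pderiv b (MvPolynomial.X b * MvPolynomial.pderiv a p) =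
      (((m : ℂ) + 4) * ((m : ℂ) + 1)) • p := by
  simp_rw [← Finset.mul_sum]
  have : ∀ a, ∑ b, MvPolynomial.pderiv b (MvPolynomial.X b * MvPolynomial.pderiv a p) =
    ((m : ℂ) + 4) • MvPolynomial.pderiv a p := fun a => sum_pderiv_X (by
      simpa using hp.pderiv (i := a))
  simp_rw [this, mul_smul_comm]
  rw [← Finset.smul_sum, euler_smul hp, smul_smul]
  push_cast; rfl

lemma sum_pderiv_norm {p : PP} {m : ℕ} (hp : p.IsHomogeneous (m + 1)) :
    ∑ a, ‖tC (ev (MvPolynomial.pderiv a p))‖ ^ 2 = ((m : ℝ) + 4) * (m + 1) * ‖tC (ev p)‖ ^ 2 := by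
  have h : ∑ a, inner ℂ (tC (ev (MvPolynomial.pderiv a p))) (tC (ev (MvPolynomial.pderiv a p))) =
      (((m : ℂ) + 4) * ((m : ℂ) + 1)) * inner ℂ (tC (ev p)) (tC (ev p)) := by
    have e : ∀ a, inner ℂ (tC (ev (MvPolynomial.pderiv a p))) (tC (ev (MvPolynomial.pderiv a p))) =
        inner ℂ (tC (ev p)) (tC (ev (∑ b, MvPolynomial.X a * MvPolynomial.pderiv b
          (MvPolynomial.X b * MvPolynomial.pderiv a p)))) := by
      intro a
      rw [← inner_uu_sum, map_sum, map_sum, inner_sum]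
      refine Finset.sum_congr rfl fun b _ => ?_
      rw [← ev_X, ← map_mul, inner_adj]
    rw [Finset.sum_congr rfl fun a _ => e a, ← inner_smul_right, ← inner_sum, ← map_sum, ← map_sum,
      casimir hp, map_smul, map_smul]
  simp_rw [inner_self_eq_norm_sq_to_K] at h
  have h2 : ((∑ a, ‖tC (ev (MvPolynomial.pderiv a p))‖ ^ 2 : ℝ) : ℂ) =
      ((((m : ℝ) + 4) * (m + 1) * ‖tC (ev p)‖ ^ 2 : ℝ) : ℂ) := by
    push_cast
    exact h
  exact Complex.ofReal_injective h2

lemma faithful {p : PP} {m : ℕ} (hp : p.IsHomogeneous m) (h : tC (ev p) = 0) : p = 0 := by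
  induction m generalizing p with
  | zero =>
    obtain ⟨c, rfl⟩ : ∃ c, p = MvPolynomial.C c := by
      have := MvPolynomial.totalDegree_eq_zero_iff_eq_C.1 (Nat.le_zero.1 hp.totalDegree_le)
      exact ⟨_, this⟩
    have e : ev (MvPolynomial.C c) = c • 1 := by
      rw [ev, MvPolynomial.aeval_C, Algebra.algebraMap_eq_smul_one]
    rw [e, map_smul, smul_eq_zero] at h
    rcases h with rfl | h
    · simp
    · exact (tC_one h).elim
  | succ m ih =>
    have h1 := sum_pderiv_norm hp
    rw [h, norm_zero, zero_pow two_ne_zero, mul_zero,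
      Finset.sum_eq_zero_iff_of_nonneg (fun _ _ => by positivity)] at h1
    have h2 : ∀ a, MvPolynomial.pderiv a p = 0 := fun a => ih (by simpa using hp.pderiv (i := a)) (by
      simpa using h1 a (Finset.mem_univ a))
    have h3 := euler_smul hp
    simp only [h2, mul_zero, Finset.sum_const_zero] at h3
    have := (smul_eq_zero.1 h3.symm)
    rcases this with h | h
    · exact absurd h (by exact_mod_cast Nat.succ_ne_zero m)
    · exact h

lemma est_gen {p : PP} {m : ℕ} (hp : p.IsHomogeneous (m + 1)) (l : ℝ) (a : V4) :
    ‖tC ((l : ℂ) • ev (MvPolynomial.pderiv a p) - star (uu a) * ev p)‖ ^ 2 ≤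
      (l ^ 2 * ((m + 4) * (m + 1)) - 2 * l * (m + 1) + 1) * ‖tC (ev p)‖ ^ 2 := by
  have h1 : ∑ a, ‖tC ((l : ℂ) • ev (MvPolynomial.pderiv a p) - star (uu a) * ev p)‖ ^ 2 =
      (l ^ 2 * ((m + 4) * (m + 1)) - 2 * l * (m + 1) + 1) * ‖tC (ev p)‖ ^ 2 := by
    have hx : ∀ a, ‖tC ((l : ℂ) • ev (MvPolynomial.pderiv a p) - star (uu a) * ev p)‖ ^ 2 =
        l ^ 2 * ‖tC (ev (MvPolynomial.pderiv a p))‖ ^ 2 -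
        2 * l * RCLike.re (inner ℂ (tC (ev (MvPolynomial.X a * MvPolynomial.pderiv a p))) (tC (ev p))) +
        ‖tC (star (uu a) * ev p)‖ ^ 2 := by
      intro a
      rw [map_sub, map_smul, @norm_sub_sq ℂ, norm_smul, mul_pow, inner_smul_left, ← inner_mul_adj,
        map_mul ev, ev_X]
      simp only [Complex.norm_real, Real.norm_eq_abs, sq_abs, Complex.conj_ofReal]
      simp only [RCLike.re_to_complex, Complex.re_ofReal_mul]
      ring
    simp_rw [hx]
    rw [Finset.sum_add_distrib, Finset.sum_sub_distrib, ← Finset.mul_sum, ← Finset.mul_sum,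
      sum_pderiv_norm hp, norm_star_uu_sum, ← map_sum, ← sum_inner, ← map_sum, ← map_sum, euler_smul hp,
      map_smul, map_smul, inner_smul_left, inner_self_eq_norm_sq_to_K]
    have : RCLike.re ((starRingEnd ℂ) ((m + 1 : ℕ) : ℂ) * ((‖tC (ev p)‖ : ℝ) : ℂ) ^ 2) =
        (m + 1) * ‖tC (ev p)‖ ^ 2 := by
      rw [Complex.conj_natCast, ← Complex.ofReal_natCast, ← Complex.ofReal_pow, ← Complex.ofReal_mul]
      rw [RCLike.re_to_complex, Complex.ofReal_re]; push_cast; rfl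
    erw [this]
    ring
  rw [← h1]
  exact Finset.single_le_sum (f := fun a =>
    ‖tC ((l : ℂ) • ev (MvPolynomial.pderiv a p) - star (uu a) * ev p)‖ ^ 2)
    (fun _ _ => by positivity) (Finset.mem_univ a)

lemma est1 {p : PP} {m : ℕ} (hp : p.IsHomogeneous (m + 1)) (a : V4) :
    ‖tC ((((m : ℝ) + 4)⁻¹ : ℝ) • ev (MvPolynomial.pderiv a p) - star (uu a) * ev p)‖ ≤
      Real.sqrt (3 / (m + 1)) * ‖tC (ev p)‖ := by
  apply le_of_sq_le_sq _ (by positivity)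
  rw [mul_pow, Real.sq_sqrt (by positivity)]
  refine (est_gen hp _ a).trans ?_
  gcongr
  have : (0:ℝ) ≤ m := by positivity
  field_simp
  ring_nf
  nlinarith

lemma est2 {p : PP} {m : ℕ} (hp : p.IsHomogeneous (m + 1)) (a : V4) :
    ‖tC ((((m : ℝ) + 1)⁻¹ : ℝ) • ev (MvPolynomial.pderiv a p) - star (uu a) * ev p)‖ ≤
      Real.sqrt (3 / (m + 1)) * ‖tC (ev p)‖ := by
  apply le_of_sq_le_sq _ (by positivity)
  rw [mul_pow, Real.sq_sqrt (by positivity)]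
  refine (est_gen hp _ a).trans ?_
  gcongr
  have : (0:ℝ) ≤ m := by positivity
  field_simp
  ring_nf
  nlinarith
end

section
open unitInterval Topology Matrix Quaternion

noncomputable def sgv : V4 → PP
  | Sum.inl a => -MvPolynomial.X (Sum.inr a)
  | Sum.inr a => MvPolynomial.X (Sum.inl a)

noncomputable def sg : PP →+* PP :=
  MvPolynomial.eval₂Hom (MvPolynomial.C.comp (starRingEnd ℂ)) sgv

lemma sg_C (c : ℂ) : sg (MvPolynomial.C c) = MvPolynomial.C (star c) := by simp [sg]
lemma sg_z (a : Fin 2) : sg (MvPolynomial.X (Sum.inl a)) = -MvPolynomial.X (Sum.inr a) := by simp [sg, sgv]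
lemma sg_w (a : Fin 2) : sg (MvPolynomial.X (Sum.inr a)) = MvPolynomial.X (Sum.inl a) := by simp [sg, sgv]

lemma sg_smul (c : ℂ) (p : PP) : sg (c • p) = star c • sg p := by
  rw [MvPolynomial.smul_eq_C_mul, map_mul, sg_C, ← MvPolynomial.smul_eq_C_mul]

lemma real_smul_PP (r : ℝ) (p : PP) : r • p = (r : ℂ) • p := (Complex.coe_smul r p).symm

lemma sg_rsmul (r : ℝ) (p : PP) : sg (r • p) = r • sg p := by
  rw [real_smul_PP, sg_smul, real_smul_PP]; simp

lemma sgv_hom (i : V4) : (sgv i).IsHomogeneous 1 := by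
  rcases i with a | a
  · exact (MvPolynomial.isHomogeneous_X _ _).neg
  · exact MvPolynomial.isHomogeneous_X _ _

lemma sg_hom {p : PP} {m : ℕ} (hp : p.IsHomogeneous m) : (sg p).IsHomogeneous m := by
  have := hp.eval₂ (MvPolynomial.C.comp (starRingEnd ℂ)) sgv
    (fun r => MvPolynomial.isHomogeneous_C _ _) sgv_hom
  rwa [one_mul] at this

lemma sg_sg_eval (p : PP) : sg (sg p) = MvPolynomial.aeval (fun i => -(MvPolynomial.X i : PP)) p := by
  have : sg.comp sg = (MvPolynomial.aeval (fun i => -(MvPolynomial.X i : PP)) : PP →ₐ[ℂ] PP).toRingHom := by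
    apply MvPolynomial.ringHom_ext
    · intro r
      simp [sg_C]
    · intro i
      rcases i with a | a <;> simp [sg_z, sg_w]
  exact congrArg (fun f : PP →+* PP => f p) this

lemma sg_sg {p : PP} {m : ℕ} (hp : p.IsHomogeneous m) : sg (sg p) = (-1 : ℂ) ^ m • p := by
  rw [sg_sg_eval]
  conv_rhs => rw [p.as_sum]
  conv_lhs => rw [p.as_sum]
  rw [map_sum, Finset.smul_sum]
  refine Finset.sum_congr rfl fun d hd => ?_
  have hd' : d.degree = m := by
    have := hp (MvPolynomial.mem_support_iff.1 hd)
    rwa [Finsupp.degree_eq_weight_one]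
  rw [MvPolynomial.aeval_monomial, MvPolynomial.monomial_eq]
  have : d.prod (fun i k => (-(MvPolynomial.X i : PP)) ^ k) = (-1) ^ m * d.prod fun i k => (MvPolynomial.X i : PP) ^ k := by
    rw [← hd', Finsupp.degree, Finsupp.prod, Finsupp.prod]
    simp_rw [neg_pow (MvPolynomial.X _ : PP)]
    rw [Finset.prod_mul_distrib, Finset.prod_pow_eq_pow_sum]
    rfl
  rw [this, MvPolynomial.smul_eq_C_mul]
  simp only [MvPolynomial.algebraMap_eq, map_pow, map_neg, map_one]
  ring

lemma sg_dw (a : Fin 2) (p : PP) : sg (MvPolynomial.pderiv (Sum.inr a) p) = MvPolynomial.pderiv (Sum.inl a) (sg p) := by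
  induction p using MvPolynomial.induction_on with
  | C c => simp [sg_C]
  | add p q hp hq => simp only [map_add, hp, hq]
  | mul_X p i hp =>
    simp only [map_mul, MvPolynomial.pderiv_mul, map_add, hp]
    suffices h : sg (MvPolynomial.pderiv (Sum.inr a) (MvPolynomial.X i)) =
        MvPolynomial.pderiv (Sum.inl a) (sg (MvPolynomial.X i)) by rw [h]
    rcases i with b | b
    · rw [sg_z]; simp [MvPolynomial.pderiv_X]
    · rw [sg_w]; by_cases h : b = a
      · subst h; simp
      · rw [MvPolynomial.pderiv_X_of_ne (by simpa using h), MvPolynomial.pderiv_X_of_ne (by simpa using h), map_zero]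

lemma sg_dz (a : Fin 2) (p : PP) : sg (MvPolynomial.pderiv (Sum.inl a) p) = -MvPolynomial.pderiv (Sum.inr a) (sg p) := by
  induction p using MvPolynomial.induction_on with
  | C c => simp [sg_C]
  | add p q hp hq => simp only [map_add, hp, hq, neg_add]
  | mul_X p i hp =>
    simp only [map_mul, MvPolynomial.pderiv_mul, map_add, hp, neg_add, neg_mul, ← mul_neg]
    suffices h : sg (MvPolynomial.pderiv (Sum.inl a) (MvPolynomial.X i)) =
        -MvPolynomial.pderiv (Sum.inr a) (sg (MvPolynomial.X i)) by rw [h]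
    rcases i with b | b
    · rw [sg_z]; by_cases h : b = a
      · subst h; simp
      · rw [map_neg, MvPolynomial.pderiv_X_of_ne (by simpa using h), MvPolynomial.pderiv_X_of_ne (by simpa using h), map_zero]; simp
    · rw [sg_w]; simp [MvPolynomial.pderiv_X]

noncomputable def sgL : PP →ₗ[ℝ] PP where
  toFun := sg
  map_add' := map_add sg
  map_smul' := sg_rsmul

noncomputable def WW (k : ℕ) : Submodule ℝ PP := (MvPolynomial.homogeneousSubmodule V4 ℂ k).restrictScalars ℝ

lemma mem_WW {k : ℕ} {p : PP} : p ∈ WW k ↔ p.IsHomogeneous k := Iff.rfl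

noncomputable def KR (k : ℕ) : Submodule ℝ PP := WW k ⊓ LinearMap.eqLocus sgL LinearMap.id

lemma mem_KR {k : ℕ} {p : PP} : p ∈ KR k ↔ p.IsHomogeneous k ∧ sg p = p := Iff.rfl

noncomputable def pdL (a : V4) : PP →ₗ[ℝ] PP := ((MvPolynomial.pderiv a : Derivation ℂ PP PP) : PP →ₗ[ℂ] PP).restrictScalars ℝ
noncomputable def mX (a : V4) : PP →ₗ[ℝ] PP := LinearMap.mulLeft ℝ (MvPolynomial.X a : PP)

lemma pdL_apply (a : V4) (p : PP) : pdL a p = MvPolynomial.pderiv a p := rfl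
lemma mX_apply (a : V4) (p : PP) : mX a p = MvPolynomial.X a * p := rfl

noncomputable def cR (m : ℕ) (b : Fin 2) : PP →ₗ[ℝ] PP :=
  ((m : ℝ) + 4)⁻¹ • (pdL (Sum.inl b) - pdL (Sum.inr b) ∘ₗ sgL)
noncomputable def dR (b : Fin 2) : PP →ₗ[ℝ] PP :=
  -(mX (Sum.inl b) ∘ₗ sgL) - mX (Sum.inr b)
noncomputable def sS (m : ℕ) (a : Fin 2) : PP × PP →ₗ[ℝ] PP :=
  mX (Sum.inl a) ∘ₗ LinearMap.fst ℝ PP PP - ((m : ℝ) + 2)⁻¹ • (pdL (Sum.inr a) ∘ₗ LinearMap.snd ℝ PP PP)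

lemma cR_apply (m : ℕ) (b : Fin 2) (p : PP) : cR m b p = ((m : ℝ) + 4)⁻¹ •
    (MvPolynomial.pderiv (Sum.inl b) p - MvPolynomial.pderiv (Sum.inr b) (sg p)) := rfl
lemma dR_apply (b : Fin 2) (p : PP) : dR b p =
    -(MvPolynomial.X (Sum.inl b) * sg p) - MvPolynomial.X (Sum.inr b) * p := rfl
lemma sS_apply (m : ℕ) (a : Fin 2) (x : PP × PP) : sS m a x = MvPolynomial.X (Sum.inl a) * x.1 -
    ((m : ℝ) + 2)⁻¹ • MvPolynomial.pderiv (Sum.inr a) x.2 := rfl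

lemma hom_rsmul {p : PP} {k : ℕ} (r : ℝ) (hp : p.IsHomogeneous k) : (r • p).IsHomogeneous k :=
  (WW k).smul_mem r hp

lemma sg_sg_odd (m : ℕ) (hm : Even m) {p : PP} (hp : p.IsHomogeneous (m + 1)) : sg (sg p) = -p := by
  rw [sg_sg hp, pow_succ, hm.neg_one_pow]; simp

lemma cR_mem (m : ℕ) (hm : Even m) (b : Fin 2) {p : PP} (hp : p.IsHomogeneous (m + 1)) : cR m b p ∈ KR m := by
  refine ⟨?_, ?_⟩
  · rw [cR_apply]
    exact hom_rsmul _ (MvPolynomial.IsHomogeneous.sub (by simpa using hp.pderiv) (by simpa using (sg_hom hp).pderiv))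
  · show sg _ = cR m b p
    rw [cR_apply, sg_rsmul, map_sub, sg_dz, sg_dw, sg_sg_odd m hm hp, map_neg]
    congr 1
    abel

lemma dR_mem (m : ℕ) (hm : Even m) (b : Fin 2) {p : PP} (hp : p.IsHomogeneous (m + 1)) : dR b p ∈ KR (m + 2) := by
  refine ⟨?_, ?_⟩
  · rw [dR_apply]
    have e : m + 2 = 1 + (m + 1) := by ring
    rw [e]
    exact MvPolynomial.IsHomogeneous.sub ((MvPolynomial.isHomogeneous_X _ _).mul (sg_hom hp)).neg
      ((MvPolynomial.isHomogeneous_X _ _).mul hp)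
  · show sg _ = dR b p
    rw [dR_apply, map_sub, map_neg, map_mul, map_mul, sg_z, sg_w, sg_sg_odd m hm hp]
    ring

lemma sS_mem (m : ℕ) (a : Fin 2) {x : PP × PP} (h1 : x.1.IsHomogeneous m) (h2 : x.2.IsHomogeneous (m + 2)) :
    (sS m a x).IsHomogeneous (m + 1) := by
  rw [sS_apply]
  refine MvPolynomial.IsHomogeneous.sub ?_ (hom_rsmul _ (by simpa using h2.pderiv))
  rw [add_comm]
  exact (MvPolynomial.isHomogeneous_X _ _).mul h1

lemma sg_sS (m : ℕ) (a : Fin 2) {x : PP × PP} (h1 : sg x.1 = x.1) (h2 : sg x.2 = x.2) :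
    sg (sS m a x) = -(MvPolynomial.X (Sum.inr a) * x.1) - ((m : ℝ) + 2)⁻¹ • MvPolynomial.pderiv (Sum.inl a) x.2 := by
  rw [sS_apply, map_sub, map_mul, sg_z, sg_rsmul, sg_dw, h1, h2]; ring

lemma pd_rsmul (a : V4) (r : ℝ) (p : PP) : MvPolynomial.pderiv a (r • p) = r • MvPolynomial.pderiv a p :=
  (pdL a).map_smul r p

lemma pd_comm (a b : V4) (p : PP) : MvPolynomial.pderiv a (MvPolynomial.pderiv b p) =
    MvPolynomial.pderiv b (MvPolynomial.pderiv a p) := by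
  have h : ⁅(MvPolynomial.pderiv a : Derivation ℂ PP PP), (MvPolynomial.pderiv b : Derivation ℂ PP PP)⁆ = 0 := by
    apply MvPolynomial.derivation_ext
    intro i
    rw [Derivation.commutator_apply]
    simp only [MvPolynomial.pderiv_X, Pi.single_apply, Derivation.coe_zero, Pi.zero_apply]
    split_ifs <;> simp
  have h2 := congrArg (fun D : Derivation ℂ PP PP => D p) h
  simp only [Derivation.commutator_apply, Derivation.coe_zero, Pi.zero_apply] at h2
  exact sub_eq_zero.1 h2

lemma cS (m : ℕ) {x : PP × PP} (h1 : x.1 ∈ KR m) (h2 : x.2 ∈ KR (m + 2)) :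
    ∑ b, cR m b (sS m b x) = x.1 := by
  have key : ∀ b, cR m b (sS m b x) = ((m : ℝ) + 4)⁻¹ • (MvPolynomial.pderiv (Sum.inl b) (MvPolynomial.X (Sum.inl b) * x.1)
      + MvPolynomial.pderiv (Sum.inr b) (MvPolynomial.X (Sum.inr b) * x.1)) := by
    intro b
    rw [cR_apply, sg_sS m b h1.2 h2.2, sS_apply]
    congr 1
    rw [map_sub, map_sub, map_neg, pd_rsmul, pd_rsmul, pd_comm (Sum.inr b)]
    abel
  rw [Finset.sum_congr rfl fun b _ => key b, ← Finset.smul_sum, Finset.sum_add_distrib]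
  have := sum_pderiv_X h1.1
  rw [Fintype.sum_sum_type] at this
  rw [this, real_smul_PP, smul_smul]
  have h4 : ((m : ℂ) + 4) ≠ 0 := by exact_mod_cast (by omega : m + 4 ≠ 0)
  push_cast
  rw [inv_mul_cancel₀ h4, one_smul]

lemma dS (m : ℕ) {x : PP × PP} (h1 : x.1 ∈ KR m) (h2 : x.2 ∈ KR (m + 2)) :
    ∑ b, dR b (sS m b x) = x.2 := by
  have key : ∀ b, dR b (sS m b x) = ((m : ℝ) + 2)⁻¹ • (MvPolynomial.X (Sum.inl b) * MvPolynomial.pderiv (Sum.inl b) x.2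
      + MvPolynomial.X (Sum.inr b) * MvPolynomial.pderiv (Sum.inr b) x.2) := by
    intro b
    rw [dR_apply, sg_sS m b h1.2 h2.2, sS_apply]
    rw [mul_sub, mul_sub, mul_smul_comm, mul_smul_comm, smul_add]
    ring
  rw [Finset.sum_congr rfl fun b _ => key b, ← Finset.smul_sum, Finset.sum_add_distrib]
  have := euler_smul h2.1
  rw [Fintype.sum_sum_type] at this
  rw [this, real_smul_PP, smul_smul]
  have h4 : ((m : ℂ) + 2) ≠ 0 := by exact_mod_cast (by omega : m + 2 ≠ 0)
  push_cast
  rw [inv_mul_cancel₀ h4, one_smul]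
end

section
open unitInterval Topology Matrix Quaternion

lemma finrank_hom (m : ℕ) : Module.finrank ℂ (MvPolynomial.homogeneousSubmodule V4 ℂ m) = (m + 3).choose 3 := by
  have e : MvPolynomial.homogeneousSubmodule V4 ℂ m = MvPolynomial.restrictSupport ℂ {d : V4 →₀ ℕ | d.degree = m} :=
    MvPolynomial.homogeneousSubmodule_eq_finsupp_supported V4 ℂ m
  rw [e, Module.finrank_eq_nat_card_basis (MvPolynomial.basisRestrictSupport ℂ _)]
  have e2 : {d : V4 →₀ ℕ | d.degree = m} = ((Finset.univ : Finset V4).finsuppAntidiag m : Set (V4 →₀ ℕ)) := by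
    ext d
    simp [Finset.mem_finsuppAntidiag, Finsupp.degree_eq_sum]
  rw [e2]
  rw [Nat.card_eq_fintype_card]
  simp only [Finset.coe_sort_coe, Fintype.card_coe]
  rw [Finset.card_finsuppAntidiag_nat_eq_choose]
  simp only [Finset.card_univ, Fintype.card_sum, Fintype.card_fin]
  rw [show 2 + 2 + m - 1 = m + 3 by omega]
  exact (Nat.choose_symm_of_eq_add (by omega))

instance finWW (k : ℕ) : FiniteDimensional ℝ (WW k) := by
  have h : FiniteDimensional ℂ (MvPolynomial.homogeneousSubmodule V4 ℂ k) :=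
    Module.Finite.iff_fg.2 (MvPolynomial.homogeneousSubmodule_fg V4 ℂ k)
  exact Module.Finite.trans (R := ℝ) ℂ (MvPolynomial.homogeneousSubmodule V4 ℂ k)

instance finKR (k : ℕ) : FiniteDimensional ℝ (KR k) :=
  Submodule.finiteDimensional_of_le (inf_le_left : KR k ≤ WW k)

lemma finrank_WW (m : ℕ) : Module.finrank ℝ (WW m) = 2 * (m + 3).choose 3 := by
  rw [← finrank_hom m, ← Complex.finrank_real_complex]
  exact (Module.finrank_mul_finrank ℝ ℂ (MvPolynomial.homogeneousSubmodule V4 ℂ m)).symm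

noncomputable def IL : PP →ₗ[ℝ] PP := (LinearMap.lsmul ℂ PP Complex.I).restrictScalars ℝ
lemma IL_apply (p : PP) : IL p = Complex.I • p := rfl

lemma finrank_KR (m : ℕ) (hm : Even m) : Module.finrank ℝ (KR m) = (m + 3).choose 3 := by
  let F : (KR m × KR m) →ₗ[ℝ] PP := (KR m).subtype ∘ₗ LinearMap.fst ℝ _ _ + IL ∘ₗ (KR m).subtype ∘ₗ LinearMap.snd ℝ _ _
  have hF : ∀ x, F x = x.1.1 + Complex.I • x.2.1 := fun _ => rfl
  have hsF : ∀ x, sg (F x) = x.1.1 - Complex.I • x.2.1 := by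
    intro x
    rw [hF, map_add, sg_smul, (mem_KR.1 x.1.2).2, (mem_KR.1 x.2.2).2]
    simp [sub_eq_add_neg]
  have inj : Function.Injective F := by
    rw [← LinearMap.ker_eq_bot, LinearMap.ker_eq_bot']
    intro x hx
    have h1 := hF x
    have h2 := hsF x
    rw [hx] at h1 h2
    rw [map_zero] at h2
    have a1 : x.1.1 = 0 := by
      have : (2:ℂ) • x.1.1 = 0 := by
        rw [two_smul]
        linear_combination -h1 - h2
      exact (smul_eq_zero.1 this).resolve_left (by norm_num)
    have a2 : x.2.1 = 0 := by
      rw [a1, zero_add] at h1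
      exact (smul_eq_zero.1 h1.symm).resolve_left Complex.I_ne_zero
    exact Prod.ext (Subtype.ext a1) (Subtype.ext a2)
  have rg : LinearMap.range F = WW m := by
    apply le_antisymm
    · rintro _ ⟨x, rfl⟩
      rw [hF]
      exact (mem_KR.1 x.1.2).1.add ((MvPolynomial.homogeneousSubmodule V4 ℂ m).smul_mem Complex.I (mem_KR.1 x.2.2).1)
    · intro p hp
      have hp' : p.IsHomogeneous m := hp
      have hss : sg (sg p) = p := by rw [sg_sg hp', hm.neg_one_pow, one_smul]
      have hs := sg_hom hp'
      refine ⟨(⟨(1/2:ℂ) • (p + sg p), ?_, ?_⟩, ⟨(-Complex.I/2) • (p - sg p), ?_, ?_⟩), ?_⟩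
      · exact (MvPolynomial.homogeneousSubmodule V4 ℂ m).smul_mem _ (hp'.add hs)
      · show sg _ = _
        rw [sg_smul, map_add, hss, add_comm]; simp
      · exact (MvPolynomial.homogeneousSubmodule V4 ℂ m).smul_mem _ (hp'.sub hs)
      · show sg _ = (-Complex.I/2) • (p - sg p)
        rw [sg_smul, map_sub, hss]
        simp only [star_div₀, star_neg, Complex.star_def, Complex.conj_I, Complex.conj_ofNat, neg_neg, neg_div]
        rw [neg_smul, ← smul_neg, neg_sub]
      · rw [hF]
        show (1/2:ℂ) • (p + sg p) + Complex.I • (-Complex.I/2) • (p - sg p) = p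
        rw [smul_smul, show Complex.I * (-Complex.I/2) = 1/2 by
          rw [mul_div_assoc', mul_neg, Complex.I_mul_I]; norm_num, ← smul_add]
        rw [show p + sg p + (p - sg p) = (2:ℂ) • p by rw [two_smul]; ring, smul_smul]
        norm_num
  have h1 := LinearMap.finrank_range_of_inj inj
  rw [rg, finrank_WW, Module.finrank_prod] at h1
  omega

lemma choose3 (n : ℕ) : 6 * (n + 3).choose 3 = (n + 1) * (n + 2) * (n + 3) := by
  induction n with
  | zero => rfl
  | succ n ih =>
    have h2 : (n + 3).choose 2 * 2 = (n + 3) * (n + 2) := by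
      rw [Nat.choose_two_right]
      exact Nat.div_mul_cancel (Nat.even_mul_pred_self (n + 3)).two_dvd
    have : (n + 1 + 3).choose 3 = (n + 3).choose 2 + (n + 3).choose 3 := by
      exact Nat.choose_succ_succ (n+3) 2
    rw [this]
    nlinarith

lemma parity (n : ℕ) : Odd ((2 * n + 3).choose 3 + (2 * n + 2 + 3).choose 3) := by
  have h1 := choose3 (2 * n)
  have h2 := choose3 (2 * n + 2)
  have e : 6 * ((2 * n + 3).choose 3 + (2 * n + 2 + 3).choose 3) = (2*n+3) * (2 * ((2*n+1)*(n+1) + (n+2)*(2*n+5))) := by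
    nlinarith
  have e2 : 3 * ((2 * n + 3).choose 3 + (2 * n + 2 + 3).choose 3) = (2*n+3) * ((2*n+1)*(n+1) + (n+2)*(2*n+5)) := by
    nlinarith
  have o : Odd ((2*n+3) * ((2*n+1)*(n+1) + (n+2)*(2*n+5))) :=
    Odd.mul ⟨n+1, by ring⟩ ⟨2*n^2+6*n+5, by ring⟩
  rw [← e2] at o
  exact (Nat.odd_mul.1 o).2
end

section
open unitInterval Topology Matrix Quaternion

noncomputable def qq (x y : ℂ) : ℍ[ℝ] := ⟨x.re, x.im, y.re, -y.im⟩

@[simp] lemma qq_re (x y : ℂ) : (qq x y).re = x.re := rfl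
@[simp] lemma qq_imI (x y : ℂ) : (qq x y).imI = x.im := rfl
@[simp] lemma qq_imJ (x y : ℂ) : (qq x y).imJ = y.re := rfl
@[simp] lemma qq_imK (x y : ℂ) : (qq x y).imK = -y.im := rfl

lemma qq_mul (x y x' y' : ℂ) : qq x y * qq x' y' = qq (x * x' - star y * y') (star x * y' + y * x') := by
  ext <;> simp <;> ring
lemma qq_star (x y : ℂ) : star (qq x y) = qq (star x) (-y) := by
  ext <;> simp
lemma qq_add (x y x' y' : ℂ) : qq x y + qq x' y' = qq (x + x') (y + y') := by
  ext <;> simp <;> ring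
lemma qq_sub (x y x' y' : ℂ) : qq x y - qq x' y' = qq (x - x') (y - y') := by
  ext <;> simp <;> ring
lemma qq_rsmul (r : ℝ) (x y : ℂ) : r • qq x y = qq (r • x) (r • y) := by
  ext <;> simp
lemma qq_normSq (x y : ℂ) : Quaternion.normSq (qq x y) = ‖x‖ ^ 2 + ‖y‖ ^ 2 := by
  rw [Quaternion.normSq_def', ← Complex.normSq_eq_norm_sq, ← Complex.normSq_eq_norm_sq,
    Complex.normSq_apply, Complex.normSq_apply]
  simp; ring
lemma qq_norm_sq (x y : ℂ) : ‖qq x y‖ ^ 2 = ‖x‖ ^ 2 + ‖y‖ ^ 2 := by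
  rw [← qq_normSq, Quaternion.normSq_eq_norm_mul_self, sq]
lemma qq_l (x y : ℂ) : ‖x‖ ≤ ‖qq x y‖ := by
  apply abs_le_of_sq_le_sq' _ (norm_nonneg _) |>.2
  rw [qq_norm_sq]; nlinarith [sq_nonneg ‖y‖]
lemma qq_r (x y : ℂ) : ‖y‖ ≤ ‖qq x y‖ := by
  apply abs_le_of_sq_le_sq' _ (norm_nonneg _) |>.2
  rw [qq_norm_sq]; nlinarith [sq_nonneg ‖x‖]
lemma qq_x (x : ℂ) : ‖qq x 0‖ = ‖x‖ := by
  have := qq_norm_sq x 0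
  rw [norm_zero] at this
  exact (pow_left_inj₀ (norm_nonneg _) (norm_nonneg _) two_ne_zero).1 (by linarith)
lemma qq_y (x : ℂ) : ‖qq 0 x‖ = ‖x‖ := by
  have := qq_norm_sq 0 x
  rw [norm_zero] at this
  exact (pow_left_inj₀ (norm_nonneg _) (norm_nonneg _) two_ne_zero).1 (by linarith)
lemma qq_cont : Continuous (fun p : ℂ × ℂ => qq p.1 p.2) := by
  have : (fun p : ℂ × ℂ => qq p.1 p.2) = fun p => (p.1.re : ℝ) • (1 : ℍ[ℝ]) + p.1.im • qi + p.2.re • qj + (-p.2.im) • qk := by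
    funext p
    ext <;> simp
  rw [this]
  fun_prop
lemma qq_of (q : ℍ[ℝ]) : q = qq ⟨q.re, q.imI⟩ ⟨q.imJ, -q.imK⟩ := by
  ext <;> simp

noncomputable def qqC (f g : C(Om, ℂ)) : C(Om, ℍ[ℝ]) where
  toFun x := qq (f x) (g x)
  continuous_toFun := qq_cont.comp (f.continuous.prodMk g.continuous)

lemma qqC_apply (f g : C(Om, ℂ)) (x : Om) : qqC f g x = qq (f x) (g x) := rfl

lemma qqC_mul (f g f' g' : C(Om, ℂ)) : qqC f g * qqC f' g' = qqC (f * f' - star g * g') (star f * g' + g * f') := by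
  ext1 x; exact qq_mul _ _ _ _
lemma qqC_star (f g : C(Om, ℂ)) : star (qqC f g) = qqC (star f) (-g) := by
  ext1 x; exact qq_star _ _
lemma qqC_add (f g f' g' : C(Om, ℂ)) : qqC f g + qqC f' g' = qqC (f + f') (g + g') := by
  ext1 x; exact qq_add _ _ _ _
lemma qqC_sub (f g f' g' : C(Om, ℂ)) : qqC f g - qqC f' g' = qqC (f - f') (g - g') := by
  ext1 x; exact qq_sub _ _ _ _
lemma qqC_rsmul (r : ℝ) (f g : C(Om, ℂ)) : r • qqC f g = qqC (r • f) (r • g) := by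
  ext1 x; exact qq_rsmul _ _ _

lemma NN_qqC (f g : C(Om, ℂ)) : NN (qqC f g) ≤ ‖tC f‖ + ‖tC g‖ := by
  have : qqC f g = qqC f 0 + qqC 0 g := by rw [qqC_add]; simp
  rw [this]
  refine (map_add_le_add NN _ _).trans (add_le_add ?_ ?_)
  · simpa using NN_mono_C (f := qqC f 0) (g := f) (c := 1) (fun x => by
      rw [one_mul]; exact (qq_x (f x)).le)
  · simpa using NN_mono_C (f := qqC 0 g) (g := g) (c := 1) (fun x => by
      rw [one_mul]; exact (qq_y (g x)).le)
lemma tC_l (f g : C(Om, ℂ)) : ‖tC f‖ ≤ NN (qqC f g) := by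
  simpa using tC_mono_H (f := f) (g := qqC f g) (c := 1) (fun x => by rw [one_mul]; exact qq_l _ _)
lemma tC_r (f g : C(Om, ℂ)) : ‖tC g‖ ≤ NN (qqC f g) := by
  simpa using tC_mono_H (f := g) (g := qqC f g) (c := 1) (fun x => by rw [one_mul]; exact qq_r _ _)

noncomputable def vv (a : Fin 2) : C(Om, ℍ[ℝ]) := qqC (uu (Sum.inl a)) (uu (Sum.inr a))

lemma vv_norm (x : Om) : Quaternion.normSq (vv 0 x) + Quaternion.normSq (vv 1 x) = 1 := by
  rw [vv, vv, qqC_apply, qqC_apply, qq_normSq, qq_normSq]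
  have h : ‖x.1‖ = 1 := by simp
  have h2 := EuclideanSpace.norm_sq_eq x.1
  rw [h, Fintype.sum_sum_type, Fin.sum_univ_two, Fin.sum_univ_two] at h2
  show ‖x.1 (Sum.inl 0)‖ ^ 2 + ‖x.1 (Sum.inr 0)‖ ^ 2 + (‖x.1 (Sum.inl 1)‖ ^ 2 + ‖x.1 (Sum.inr 1)‖ ^ 2) = 1
  linarith

lemma vv_le (a : Fin 2) : ‖vv a‖ ≤ 1 := by
  rw [ContinuousMap.norm_le _ zero_le_one]
  intro x
  have h := vv_norm x
  rw [Quaternion.normSq_eq_norm_mul_self, Quaternion.normSq_eq_norm_mul_self] at h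
  fin_cases a
  · show ‖vv 0 x‖ ≤ 1
    nlinarith [norm_nonneg (vv 0 x), norm_nonneg (vv 1 x)]
  · show ‖vv 1 x‖ ≤ 1
    nlinarith [norm_nonneg (vv 0 x), norm_nonneg (vv 1 x)]

lemma ev_rsmul (r : ℝ) (p : PP) : ev (r • p) = r • ev p := by
  rw [real_smul_PP, map_smul]; ext x; simp

noncomputable def ph : PP →ₗ[ℝ] C(Om, ℍ[ℝ]) where
  toFun p := qqC (ev p) (-ev (sg p))
  map_add' p q := by rw [qqC_add, map_add, map_add, map_add, neg_add]
  map_smul' r p := by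
    rw [RingHom.id_apply, qqC_rsmul, sg_rsmul, ev_rsmul, ev_rsmul, smul_neg]

lemma ph_apply (p : PP) : ph p = qqC (ev p) (-ev (sg p)) := rfl

noncomputable def QL (q : ℍ[ℝ]) : PP →ₗ[ℝ] PP :=
  (LinearMap.lsmul ℂ PP ⟨q.re, q.imI⟩).restrictScalars ℝ + (LinearMap.lsmul ℂ PP ⟨q.imJ, q.imK⟩).restrictScalars ℝ ∘ₗ sgL

lemma QL_apply (q : ℍ[ℝ]) (p : PP) : QL q p = (⟨q.re, q.imI⟩ : ℂ) • p + (⟨q.imJ, q.imK⟩ : ℂ) • sg p := rfl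

lemma QL_mem (q : ℍ[ℝ]) (k : ℕ) (p : PP) (hp : p ∈ WW k) : QL q p ∈ WW k := by
  rw [QL_apply]
  exact (MvPolynomial.IsHomogeneous.add ((MvPolynomial.homogeneousSubmodule V4 ℂ k).smul_mem _ hp)
    ((MvPolynomial.homogeneousSubmodule V4 ℂ k).smul_mem _ (sg_hom hp)))

lemma ph_QL (m : ℕ) (hm : Even m) (q : ℍ[ℝ]) (p : PP) (hp : p.IsHomogeneous (m + 1)) :
    ph (QL q p) = ContinuousMap.const Om q * ph p := by
  rw [ph_apply, ph_apply, QL_apply, map_add sg, sg_smul, sg_smul, sg_sg_odd m hm hp]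
  ext1 x
  rw [ContinuousMap.mul_apply, ContinuousMap.const_apply]
  conv_rhs => rw [qq_of q]
  rw [qqC_apply, qqC_apply, qq_mul]
  have s1 : star (⟨q.re, q.imI⟩ : ℂ) = ⟨q.re, -q.imI⟩ := rfl
  have s2 : star (⟨q.imJ, q.imK⟩ : ℂ) = ⟨q.imJ, -q.imK⟩ := rfl
  have s3 : star (⟨q.imJ, -q.imK⟩ : ℂ) = ⟨q.imJ, q.imK⟩ := by rw [← s2, star_star]
  rw [s1, s2, s3]
  congr 1
  · simp only [map_add, map_smul, ContinuousMap.add_apply, ContinuousMap.smul_apply, ContinuousMap.neg_apply, smul_eq_mul]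
    ring
  · simp only [map_add, map_neg, map_smul, ContinuousMap.add_apply, ContinuousMap.smul_apply, ContinuousMap.neg_apply, smul_eq_mul]
    ring
end

section
open unitInterval Topology Matrix Quaternion

lemma estA (m : ℕ) (hm : Even m) (a b : Fin 2) (p : PP) (hp : p.IsHomogeneous (m + 1)) :
    NN (ph (sS m a (cR m b p, dR b p)) - vv a * star (vv b) * ph p) ≤
      (4 * Real.sqrt (3 / (m + 1))) * NN (ph p) := by
  have hc := cR_mem m hm b hp
  have hd := dR_mem m hm b hp
  have e1 : star (vv b) * ph p = qqC (star (uu (Sum.inl b)) * ev p - star (uu (Sum.inr b)) * ev (sg p)) (ev (dR b p)) := by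
    rw [vv, qqC_star, ph_apply, qqC_mul, dR_apply]
    congr 1
    · rw [star_neg]; ring
    · simp only [map_sub, map_neg, map_mul, ev_X, star_star]; ring
  have hdN : ‖tC (ev (dR b p))‖ ≤ NN (ph p) := by
    have h0 := tC_r (star (uu (Sum.inl b)) * ev p - star (uu (Sum.inr b)) * ev (sg p)) (ev (dR b p))
    rw [← e1] at h0
    refine h0.trans ((NN_mul _ _).trans ?_)
    have : ‖star (vv b)‖ ≤ 1 := by
      rw [ContinuousMap.norm_le _ zero_le_one]
      intro x
      rw [ContinuousMap.star_apply, Quaternion.norm_star]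
      exact (ContinuousMap.norm_coe_le_norm _ _).trans (vv_le b)
    calc _ ≤ 1 * NN (ph p) := by gcongr
      _ = _ := one_mul _
  set c := cR m b p with hcdef
  set d := dR b p with hddef
  have e2 : ph (sS m a (c, d)) = qqC (uu (Sum.inl a) * ev c - ((m : ℝ) + 2)⁻¹ • ev (MvPolynomial.pderiv (Sum.inr a) d))
      (uu (Sum.inr a) * ev c + ((m : ℝ) + 2)⁻¹ • ev (MvPolynomial.pderiv (Sum.inl a) d)) := by
    rw [ph_apply, sg_sS m a (x := (c, d)) hc.2 hd.2, sS_apply]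
    simp only [map_sub, map_neg, map_mul, ev_X, ev_rsmul]
    congr 1
    ring
  have e3 : ph (sS m a (c, d)) - vv a * star (vv b) * ph p =
      vv a * qqC (ev c - (star (uu (Sum.inl b)) * ev p - star (uu (Sum.inr b)) * ev (sg p))) 0 +
      qqC (-(((m : ℝ) + 2)⁻¹ • ev (MvPolynomial.pderiv (Sum.inr a) d) - star (uu (Sum.inr a)) * ev d))
        (((m : ℝ) + 2)⁻¹ • ev (MvPolynomial.pderiv (Sum.inl a) d) - star (uu (Sum.inl a)) * ev d) := by
    rw [mul_assoc, e1, e2, vv, qqC_mul, qqC_mul, qqC_sub, qqC_add]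
    congr 1 <;> ring
  have e4 : ev c - (star (uu (Sum.inl b)) * ev p - star (uu (Sum.inr b)) * ev (sg p)) =
      (((m : ℝ) + 4)⁻¹ • ev (MvPolynomial.pderiv (Sum.inl b) p) - star (uu (Sum.inl b)) * ev p) -
      (((m : ℝ) + 4)⁻¹ • ev (MvPolynomial.pderiv (Sum.inr b) (sg p)) - star (uu (Sum.inr b)) * ev (sg p)) := by
    rw [hcdef, cR_apply, ev_rsmul, map_sub, smul_sub]; ring
  have hf : ‖tC (ev p)‖ ≤ NN (ph p) := tC_l _ _
  have hg : ‖tC (ev (sg p))‖ ≤ NN (ph p) := by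
    have := tC_r (ev p) (-ev (sg p))
    rwa [map_neg, norm_neg] at this
  set N := NN (ph p) with hN
  have hN0 : 0 ≤ N := apply_nonneg NN _
  set η := Real.sqrt (3 / ((m : ℝ) + 1)) with hη
  have hη0 : 0 ≤ η := Real.sqrt_nonneg _
  have hE : ∀ i, ‖tC (((m : ℝ) + 2)⁻¹ • ev (MvPolynomial.pderiv i d) - star (uu i) * ev d)‖ ≤ η * N := by
    intro i
    have h := est2 (m := m + 1) (p := d) hd.1 i
    have e : (((m + 1 : ℕ) : ℝ) + 1) = (m : ℝ) + 2 := by push_cast; ring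
    rw [e] at h
    refine h.trans ?_
    have : Real.sqrt (3 / ((m : ℝ) + 2)) ≤ η := by
      apply Real.sqrt_le_sqrt
      gcongr
      norm_num
    gcongr
  rw [e3]
  refine (map_add_le_add NN _ _).trans ?_
  have b1 : NN (vv a * qqC (ev c - (star (uu (Sum.inl b)) * ev p - star (uu (Sum.inr b)) * ev (sg p))) 0) ≤ 2 * η * N := by
    refine (NN_mul _ _).trans ?_
    calc _ ≤ 1 * NN (qqC (ev c - (star (uu (Sum.inl b)) * ev p - star (uu (Sum.inr b)) * ev (sg p))) 0) := by
          gcongr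
          exact vv_le a
      _ ≤ ‖tC (ev c - (star (uu (Sum.inl b)) * ev p - star (uu (Sum.inr b)) * ev (sg p)))‖ := by
          rw [one_mul]
          refine (NN_qqC _ _).trans ?_
          simp
      _ ≤ η * N + η * N := by
          rw [e4, map_sub]
          refine (norm_sub_le _ _).trans (add_le_add ?_ ?_)
          · exact (est1 hp _).trans (by gcongr)
          · exact (est1 (sg_hom hp) _).trans (by gcongr)
      _ = _ := by ring
  have b2 := NN_qqC (-(((m : ℝ) + 2)⁻¹ • ev (MvPolynomial.pderiv (Sum.inr a) d) - star (uu (Sum.inr a)) * ev d))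
        (((m : ℝ) + 2)⁻¹ • ev (MvPolynomial.pderiv (Sum.inl a) d) - star (uu (Sum.inl a)) * ev d)
  rw [map_neg, norm_neg] at b2
  have b3 := hE (Sum.inr a)
  have b4 := hE (Sum.inl a)
  linarith

noncomputable def Rb (m : ℕ) (hm : Even m) (b : Fin 2) : WW (m + 1) →ₗ[ℝ] KR m × KR (m + 2) :=
  LinearMap.prod
    (LinearMap.codRestrict (KR m) (cR m b ∘ₗ (WW (m + 1)).subtype) fun x => cR_mem m hm b x.2)
    (LinearMap.codRestrict (KR (m + 2)) (dR b ∘ₗ (WW (m + 1)).subtype) fun x => dR_mem m hm b x.2)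

noncomputable def Sa (m : ℕ) (a : Fin 2) : KR m × KR (m + 2) →ₗ[ℝ] WW (m + 1) :=
  LinearMap.codRestrict (WW (m + 1)) (sS m a ∘ₗ LinearMap.prodMap (KR m).subtype (KR (m + 2)).subtype)
    fun x => sS_mem m a x.1.2.1 x.2.2.1

lemma RS (m : ℕ) (hm : Even m) : ∑ b, Rb m hm b ∘ₗ Sa m b = LinearMap.id := by
  apply LinearMap.ext
  intro x
  have h1 := cS m (x := (x.1.1, x.2.1)) x.1.2 x.2.2
  have h2 := dS m (x := (x.1.1, x.2.1)) x.1.2 x.2.2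
  rw [Fin.sum_univ_two] at *
  exact Prod.ext (Subtype.ext h1) (Subtype.ext h2)

noncomputable def Ac (m : ℕ) (hm : Even m) (a b : Fin 2) : Module.End ℝ (WW (m + 1)) := Sa m a ∘ₗ Rb m hm b

lemma Ac_idem (m : ℕ) (hm : Even m) (a c : Fin 2) : ∑ b, Ac m hm a b * Ac m hm b c = Ac m hm a c := by
  have h : ∀ b, Ac m hm a b * Ac m hm b c = Sa m a ∘ₗ (Rb m hm b ∘ₗ Sa m b) ∘ₗ Rb m hm c := fun b => rfl
  simp_rw [h]
  apply LinearMap.ext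
  intro x
  have := LinearMap.congr_fun (RS m hm) (Rb m hm c x)
  rw [LinearMap.sum_apply] at *
  simp only [LinearMap.comp_apply, LinearMap.id_apply] at *
  rw [← map_sum, this]
  rfl

lemma Ac_rank (m : ℕ) (hm : Even m) :
    Module.finrank ℝ (LinearMap.range (LinearMap.pi fun a => ∑ b, Ac m hm a b ∘ₗ LinearMap.proj b :
      Module.End ℝ (Fin 2 → WW (m + 1)))) = (m + 3).choose 3 + (m + 2 + 3).choose 3 := by
  let Sp : (KR m × KR (m + 2)) →ₗ[ℝ] (Fin 2 → WW (m + 1)) := LinearMap.pi fun a => Sa m a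
  let Rs : (Fin 2 → WW (m + 1)) →ₗ[ℝ] (KR m × KR (m + 2)) := ∑ b, Rb m hm b ∘ₗ LinearMap.proj b
  have h1 : ∀ x, Rs (Sp x) = x := by
    intro x
    have := LinearMap.congr_fun (RS m hm) x
    rw [LinearMap.sum_apply] at this
    simp only [Rs, LinearMap.sum_apply]
    exact this
  have h2 : (LinearMap.pi fun a => ∑ b, Ac m hm a b ∘ₗ LinearMap.proj b :
      Module.End ℝ (Fin 2 → WW (m + 1))) = Sp ∘ₗ Rs := by
    apply LinearMap.ext
    intro x
    funext a
    simp only [Sp, Rs, LinearMap.pi_apply, LinearMap.comp_apply, LinearMap.sum_apply, map_sum]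
    rfl
  have h3 : LinearMap.range Rs = ⊤ := LinearMap.range_eq_top.2 fun x => ⟨Sp x, h1 x⟩
  have h4 : Function.Injective Sp := Function.LeftInverse.injective h1
  rw [h2, LinearMap.range_comp_of_range_eq_top _ h3, LinearMap.finrank_range_of_inj h4, Module.finrank_prod,
    finrank_KR m hm, finrank_KR (m + 2) (hm.add even_two)]

noncomputable def theQD (n : ℕ) : QD vv NN where
  W := WW (2 * n + 1)
  φ := ph ∘ₗ (WW (2 * n + 1)).subtype
  φ_inj := by
    intro α h
    have h1 : ‖tC (ev α.1)‖ ≤ NN (ph α.1) := tC_l _ _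
    have h0 : NN (ph α.1) = 0 := h
    rw [h0] at h1
    exact Subtype.ext (faithful α.2 (norm_le_zero_iff.1 h1))
  Q q := (QL q).restrict (fun p hp => QL_mem q _ p hp)
  hQ q α := ph_QL (2 * n) (even_two_mul n) q α.1 α.2
  A := Ac (2 * n) (even_two_mul n)
  idem := Ac_idem (2 * n) (even_two_mul n)
  δ := 4 * Real.sqrt (3 / (((2 * n : ℕ) : ℝ) + 1))
  hA a b α := estA (2 * n) (even_two_mul n) a b α.1 α.2
  odd := by
    rw [Ac_rank]
    exact parity n
  two := by
    rw [finrank_WW]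
    have : 0 < (2 * n + 1 + 3).choose 3 := Nat.choose_pos (by omega)
    omega

lemma theQD_small (δ : ℝ) (hδ : 0 < δ) : ∃ D : QD vv NN, 0 ≤ D.δ ∧ D.δ ≤ δ := by
  have h : Filter.Tendsto (fun n : ℕ => 4 * Real.sqrt (3 / (((2 * n : ℕ) : ℝ) + 1))) Filter.atTop (𝓝 (4 * Real.sqrt 0)) := by
    refine Filter.Tendsto.const_mul _ (Filter.Tendsto.sqrt ?_)
    refine Filter.Tendsto.div_atTop tendsto_const_nhds ?_
    refine Filter.tendsto_atTop_add_const_right _ _ ?_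
    refine tendsto_natCast_atTop_atTop.comp ?_
    exact Filter.tendsto_id.const_mul_atTop' (by norm_num)
  rw [Real.sqrt_zero, mul_zero] at h
  obtain ⟨n, hn⟩ := (h.eventually (gt_mem_nhds hδ)).exists
  exact ⟨theQD n, by show 0 ≤ 4 * _; positivity, hn.le⟩

lemma exists_essential : ∃ f : C(unitSphere 5, ℍ[ℝ]ˣ), ¬ f.Nullhomotopic := by
  by_contra hcon
  push Not at hcon
  exact final_contra NN_mul vv_norm theQD_small hcon
end

/-- There exists a fiber bundle over `S⁶` with fiber `S²` whose total space is not
homotopy equivalent to `S² × S⁶`. -/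
theorem exists_sphere_bundle_over_S6_not_homotopyEquiv_product :
    ∃ (Z : Type) (_ : TopologicalSpace Z) (p : Z → unitSphere 6),
      IsFiberBundleWithFiber (unitSphere 2) p ∧
        ¬ Nonempty (ContinuousMap.HomotopyEquiv Z (unitSphere 2 × unitSphere 6)) := by
  obtain ⟨f, hf⟩ := exists_essential
  exact bundle_of_essential f hf
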